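/- arXiv:1502.03969 — 5 statements merged into one kernel-verified Lean document; each statement's English description precedes it below -/
import Mathlib

section
/- Let N ≥ 2 be an integer and let p, μ, m be real numbers with 1 < p < N, 0 ≤ μ < μ̄ := ((N−p)/p)^p and m > 0. Let f : ℝ → ℝ be continuous and satisfy (F). Let u : (0,∞) → ℝ be a radial profile solution of the equation (hypothesis (S)) that also satisfies (W). Then there exists a constant C with 0 < C < ∞ such that u(r)·r^{γ₁} → C as r → 0+, where γ₁ is the unique zero of Γ_μ in [0, (N−p)/p). -/
open Filter Topology MeasureTheory Set

lemma trap_aux (f f' B B' : ℝ → ℝ) (a b : ℝ) (hf : ∀ x, HasDerivAt f (f' x) x)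
    (hB : ∀ x, HasDerivAt B (B' x) x) (h0 : f a ≤ B a)
    (h : ∀ x, a ≤ x → x < b → f x = B x → f' x < B' x) :
    ∀ x, a ≤ x → x ≤ b → f x ≤ B x := by
  intro x hx hxb
  refine image_le_of_deriv_right_lt_deriv_boundary (a := a) (b := b) (f := f) (f' := f') (B := B) (B' := B')
    (fun y _ => (hf y).continuousAt.continuousWithinAt)
    (fun y _ => (hf y).hasDerivWithinAt) h0 hB (fun y hy => h y hy.1 hy.2) ⟨hx, hxb⟩

lemma lin_deriv (c d S : ℝ) (x : ℝ) : HasDerivAt (fun s => c + d * (s - S)) d x := by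
  simpa using (((hasDerivAt_id x).sub_const S).const_mul d).const_add c

lemma lower_aux (z z' : ℝ → ℝ) (hz : ∀ x, HasDerivAt z (z' x) x) (k η S : ℝ)
    (hη : 0 < η) (h1 : ∀ s, S ≤ s → z s ≤ 0 → z' s ≤ k * z s + η) (hk : 0 < k)
    (h0 : k * z S < - (2 * η)) : ∀ s, S ≤ s → z s ≤ z S + (-η) * (s - S) := by
  intro s hs
  refine trap_aux z z' (fun s => z S + (-η) * (s - S)) (fun _ => -η) S s hz (lin_deriv _ _ _) (by simp)
    ?_ s hs le_rfl
  intro x hx _ he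
  have hzS : z S < 0 := by
    by_contra hh
    push Not at hh
    nlinarith [mul_nonneg hk.le hh]
  have h2 : z x ≤ z S := by rw [he]; nlinarith
  have h3 := h1 x hx (by linarith)
  have h4 : k * z x ≤ k * z S := by gcongr
  show z' x < -η
  linarith

lemma upper_aux (z z' : ℝ → ℝ) (hz : ∀ x, HasDerivAt z (z' x) x) (k η S Z : ℝ)
    (hη : 0 < η) (h1 : ∀ s, S ≤ s → 0 ≤ z s → z s ≤ Z → k * z s - η ≤ z' s) (hk : 0 < k)
    (hZ : 2 * η < k * Z)
    (h0 : 2 * η < k * z S) : ∃ T, ∀ s, T ≤ s → Z ≤ z s := by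
  have hzS : 0 < z S := by
    by_contra hh
    push Not at hh
    nlinarith [mul_nonneg hk.le (neg_nonneg.2 hh)]
  have hZ0 : 0 < Z := by
    by_contra hh
    push Not at hh
    nlinarith [mul_nonneg hk.le (neg_nonneg.2 hh)]
  have key : ∃ T, S ≤ T ∧ Z ≤ z T := by
    rcases le_total Z (z S) with h | h
    · exact ⟨S, le_rfl, h⟩
    refine ⟨S + (Z - z S) / η, ?_, ?_⟩
    · have : 0 ≤ (Z - z S) / η := div_nonneg (by linarith) hη.le
      linarith
    have hT : S ≤ S + (Z - z S) / η := by
      have : 0 ≤ (Z - z S) / η := div_nonneg (by linarith) hη.le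
      linarith
    have := trap_aux (fun s => z S + η * (s - S)) (fun _ => η) z z' S (S + (Z - z S) / η)
      (lin_deriv _ _ _) hz (by simp) ?_ _ hT le_rfl
    · have e : z S + η * (S + (Z - z S) / η - S) = Z := by field_simp; ring
      simp only [e] at this
      exact this
    intro x hx hxT he
    have h2 : z S ≤ z x := by rw [← he]; nlinarith
    have h3 : z x ≤ Z := by
      rw [← he]
      have : x - S < (Z - z S) / η := by linarith
      rw [lt_div_iff₀ hη] at this
      show z S + η * (x - S) ≤ Z
      linarith
    have h4 := h1 x hx (by linarith) h3
    have h5 : k * z S ≤ k * z x := by gcongr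
    show η < z' x
    linarith
  obtain ⟨T, hST, hT⟩ := key
  refine ⟨T, fun s hs => ?_⟩
  refine trap_aux (fun _ => Z) (fun _ => 0) z z' T s (fun x => hasDerivAt_const x Z) hz hT ?_ s hs le_rfl
  intro x hx _ he
  have he : Z = z x := he
  have := h1 x (by linarith) (by linarith) (by linarith)
  rw [← he] at this
  show 0 < z' x
  linarith

lemma blowup_aux (x x' : ℝ → ℝ) (hx : ∀ s, HasDerivAt x (x' s) s) (p S : ℝ) (hp : 1 < p)
    (h0 : ∀ s, S ≤ s → 0 < x s)
    (h1 : ∀ s, S ≤ s → (p - 1) * x s ^ (p / (p - 1)) ≤ x' s) : False := by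
  have hp' : 0 < p - 1 := by linarith
  have hd : ∀ s, S ≤ s → HasDerivAt (fun s => x s ^ (-(1 / (p - 1))) + s)
      (x' s * (-(1 / (p - 1))) * x s ^ (-(1 / (p - 1)) - 1) + 1) s := by
    intro s hs
    exact ((hx s).rpow_const (Or.inl (h0 s hs).ne')).add (hasDerivAt_id s)
  have hanti : AntitoneOn (fun s => x s ^ (-(1 / (p - 1))) + s) (Ici S) := by
    refine antitoneOn_of_deriv_nonpos (convex_Ici S)
      (fun s hs => (hd s hs).continuousAt.continuousWithinAt) ?_ ?_
    · intro s hs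
      rw [interior_Ici] at hs
      exact (hd s (le_of_lt hs)).differentiableAt.differentiableWithinAt
    · intro s hs
      rw [interior_Ici] at hs
      have hs : S ≤ s := le_of_lt hs
      rw [(hd s hs).deriv]
      have e : x s ^ (p / (p - 1)) * x s ^ (-(1 / (p - 1)) - 1) = 1 := by
        rw [← Real.rpow_add (h0 s hs)]
        have : p / (p - 1) + (-(1 / (p - 1)) - 1) = 0 := by field_simp; ring
        rw [this, Real.rpow_zero]
      have hpos : 0 < x s ^ (-(1 / (p - 1)) - 1) := Real.rpow_pos_of_pos (h0 s hs) _
      have h2 := mul_le_mul_of_nonneg_right (h1 s hs) hpos.le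
      rw [mul_assoc, e] at h2
      have h3 : x' s * (-(1 / (p - 1))) * x s ^ (-(1 / (p - 1)) - 1)
        = -(x' s * x s ^ (-(1 / (p - 1)) - 1)) / (p - 1) := by ring
      rw [h3, neg_div]
      have : 1 ≤ x' s * x s ^ (-(1 / (p - 1)) - 1) / (p - 1) := by
        rw [le_div_iff₀ hp']; linarith
      linarith
  have hh : 0 < x S ^ (-(1 / (p - 1))) := Real.rpow_pos_of_pos (h0 S le_rfl) _
  have hT : S ≤ S + x S ^ (-(1 / (p - 1))) := by linarith
  have := hanti (self_mem_Ici) (show _ ∈ Ici S from hT) hT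
  have h3 : 0 < x (S + x S ^ (-(1 / (p - 1)))) ^ (-(1 / (p - 1))) :=
    Real.rpow_pos_of_pos (h0 _ hT) _
  simp only at this
  linarith

lemma conv_abs (q : ℝ) (hq : 1 ≤ q) : ConvexOn ℝ univ (fun w : ℝ => |w| ^ q) := by
  refine ⟨convex_univ, fun x _ y _ a b ha hb hab => ?_⟩
  have h := (convexOn_rpow hq).2 (show |x| ∈ Ici 0 from abs_nonneg x) (show |y| ∈ Ici 0 from abs_nonneg y) ha hb hab
  refine le_trans ?_ h
  refine Real.rpow_le_rpow (abs_nonneg _) ?_ (by linarith)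
  simp only [smul_eq_mul]
  calc |a * x + b * y| ≤ |a * x| + |b * y| := abs_add_le _ _
    _ = _ := by rw [abs_mul, abs_mul, abs_of_nonneg ha, abs_of_nonneg hb]

lemma line_aux (G : ℝ → ℝ) (hG : ConvexOn ℝ univ G) (w1 w2 e : ℝ) (h12 : w1 < w2) (h1 : G w1 = 0)
    (h2 : G w2 = -e) :
    (∀ w, w ≤ w1 → -(e / (w2 - w1)) * (w - w1) ≤ G w) ∧
    (∀ w, w1 ≤ w → w ≤ w2 → G w ≤ -(e / (w2 - w1)) * (w - w1)) := by
  have hd : 0 < w2 - w1 := by linarith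
  constructor
  · intro w hw
    rcases hw.eq_or_lt with rfl | hw
    · simp [h1]
    have := hG.slope_mono_adjacent (mem_univ w) (mem_univ w2) hw h12
    rw [h1, h2, div_le_div_iff₀ (by linarith) hd] at this
    have e1 : -(e / (w2 - w1)) * (w - w1) = (e * (w1 - w)) / (w2 - w1) := by ring
    rw [e1, div_le_iff₀ hd]
    linarith
  · intro w hw hw2
    rcases hw.eq_or_lt with rfl | hw
    · simp [h1]
    rcases hw2.eq_or_lt with rfl | hw2
    · rw [h2]; apply le_of_eq; field_simp
    have := hG.slope_mono_adjacent (mem_univ w1) (mem_univ w2) hw hw2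
    rw [h1, h2, div_le_div_iff₀ (by linarith) (by linarith)] at this
    have e1 : -(e / (w2 - w1)) * (w - w1) = (-e * (w - w1)) / (w2 - w1) := by ring
    rw [e1, le_div_iff₀ hd]
    linarith

lemma phi_pos (p y : ℝ) (hy : 0 < y) : |y| ^ (p - 2) * y = y ^ (p - 1) := by
  rw [abs_of_pos hy]
  nth_rewrite 2 [← Real.rpow_one y]
  rw [← Real.rpow_add hy]; congr 1; ring

lemma phi_abs (p y : ℝ) (hp : 1 < p) : |(|y| ^ (p - 2) * y)| = |y| ^ (p - 1) := by
  rcases eq_or_ne y 0 with rfl | hy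
  · simp [Real.zero_rpow (show p - 1 ≠ 0 by linarith)]
  rw [abs_mul, abs_of_nonneg (Real.rpow_nonneg (abs_nonneg y) _)]
  have := phi_pos p |y| (abs_pos.2 hy)
  rwa [abs_abs] at this

/-- one-step estimate -/
lemma est_aux (p g μ γ k : ℝ) (hp : 1 < p) (hg : 0 < g) (hμ0 : 0 ≤ μ)
    (hγ0 : 0 ≤ γ) (hγg : γ < g)
    (hk : 0 < k)
    (hl1 : ∀ w, w ≤ γ ^ (p - 1) → -k * (w - γ ^ (p - 1)) ≤ (p - 1) * |w| ^ (p / (p - 1)) - p * g * w + μ)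
    (hl2 : ∀ w, γ ^ (p - 1) ≤ w → w ≤ g ^ (p - 1) →
       (p - 1) * |w| ^ (p / (p - 1)) - p * g * w + μ ≤ -k * (w - γ ^ (p - 1)))
    (v y w ε : ℝ → ℝ) (hv : ∀ s, HasDerivAt v (y s) s)
    (hwy : ∀ s, w s = |y s| ^ (p - 2) * y s)
    (hw : ∀ s, HasDerivAt w (-((p - 1) * |w s| ^ (p / (p - 1)) - p * g * w s + μ + ε s)) s)
    (hlim : Tendsto (fun s => v s - g * s) atTop atBot)
    (S η : ℝ) (hη : 0 < η) (hηZ : 2 * η < k * (g ^ (p - 1) - γ ^ (p - 1)))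
    (hε : ∀ s, S ≤ s → |ε s| ≤ η) : |w S - γ ^ (p - 1)| ≤ 2 * η / k := by
  have hz : ∀ s, HasDerivAt (fun s => w s - γ ^ (p - 1))
    (-((p - 1) * |w s| ^ (p / (p - 1)) - p * g * w s + μ + ε s)) s := fun s => (hw s).sub_const _
  by_contra hcon
  push Not at hcon
  rw [lt_abs, div_lt_iff₀ hk, div_lt_iff₀ hk] at hcon
  rcases hcon with hcon | hcon
  · obtain ⟨T, hT⟩ := upper_aux _ _ hz k η S (g ^ (p - 1) - γ ^ (p - 1)) hη (by
      intro s hs h0 h1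
      have a := hl2 (w s) (by linarith) (by linarith)
      have b := abs_le.1 (hε s hs)
      linarith) hk hηZ (by linarith)
    have hyg : ∀ s, T ≤ s → g ≤ y s := by
      intro s hs
      have h1 : g ^ (p - 1) ≤ w s := by have := hT s hs; linarith
      by_contra hy
      push Not at hy
      have hgp : 0 < g ^ (p - 1) := Real.rpow_pos_of_pos hg _
      rw [hwy] at h1
      rcases le_or_gt (y s) 0 with h | h
      · have : |y s| ^ (p - 2) * y s ≤ 0 := mul_nonpos_of_nonneg_of_nonpos (by positivity) h
        linarith
      · rw [phi_pos _ _ h] at h1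
        have := Real.rpow_lt_rpow h.le hy (show 0 < p - 1 by linarith)
        linarith
    have hd : ∀ s, HasDerivAt (fun s => v s - g * s) (y s - g) s := fun s => by
      have := (hv s).fun_sub ((hasDerivAt_id' s).const_mul g)
      rwa [mul_one] at this
    have hmono : MonotoneOn (fun s => v s - g * s) (Ici T) := by
      refine monotoneOn_of_deriv_nonneg (convex_Ici T)
        (fun s hs => (hd s).continuousAt.continuousWithinAt)
        (fun s hs => (hd s).differentiableAt.differentiableWithinAt) ?_
      intro s hs
      rw [interior_Ici] at hs
      rw [(hd s).deriv]
      linarith [hyg s (le_of_lt hs)]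
    have h1 := (hlim.eventually (eventually_lt_atBot (v T - g * T))).and (eventually_ge_atTop T)
    obtain ⟨s, hs1, hs2⟩ := h1.exists
    have := hmono (self_mem_Ici) (show s ∈ Ici T from hs2) hs2
    simp only at this
    linarith
  · have hlow := lower_aux _ _ hz k η S hη (by
      intro s hs h0
      have a := hl1 (w s) (by linarith)
      have b := abs_le.1 (hε s hs)
      linarith) hk (by linarith)
    -- blow up
    have hpg : 0 < p * g := by positivity
    have : Tendsto (fun s => w S + (-η) * (s - S)) atTop atBot := by
      apply tendsto_atBot_add_const_left
      apply Tendsto.const_mul_atTop_of_neg (by linarith)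
      exact tendsto_atTop_add_const_right _ _ tendsto_id
    obtain ⟨T, hT⟩ := eventually_atTop.1
      ((this.eventually (eventually_lt_atBot (-(η / (p * g))))).and (eventually_ge_atTop S))
    have hwT : ∀ s, T ≤ s → w s < -(η / (p * g)) := by
      intro s hs
      have := hlow s (hT s hs).2
      linarith [(hT s hs).1]
    have hη' : 0 < η / (p * g) := by positivity
    refine blowup_aux (fun s => - w s) _ (fun s => (hw s).neg) p T hp ?_ ?_
    · intro s hs
      linarith [hwT s hs]
    · intro s hs
      have h1 := hwT s hs
      have h2 : |w s| = - w s := abs_of_neg (by linarith)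
      have h3 : η < p * g * (- w s) := by
        have : η / (p * g) < - w s := by linarith
        rwa [div_lt_iff₀' hpg] at this
      have b := abs_le.1 (hε s (hT s hs).2)
      rw [h2]
      linarith

lemma conv_aux (p g μ γ : ℝ) (hp : 1 < p) (hg : 0 < g) (hμ0 : 0 ≤ μ) (hμ : μ < g ^ p)
    (hγ0 : 0 ≤ γ) (hγg : γ < g) (hγ : γ ^ (p - 1) * ((p - 1) * γ - p * g) + μ = 0)
    (v y w ε : ℝ → ℝ) (hv : ∀ s, HasDerivAt v (y s) s)
    (hwy : ∀ s, w s = |y s| ^ (p - 2) * y s)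
    (hw : ∀ s, HasDerivAt w (-((p - 1) * |w s| ^ (p / (p - 1)) - p * g * w s + μ + ε s)) s)
    (hlim : Tendsto (fun s => v s - g * s) atTop atBot)
    (C1 C2 : ℝ) (hC1 : 0 < C1) (hC2 : 0 < C2)
    (hε : ∀ s, |ε s| ≤ C1 * Real.exp (-p * s) + C2 * Real.exp (p / g * (v s - g * s))) :
    ∃ L, Tendsto (fun s => v s - γ * s) atTop (𝓝 L) := by
  have hp' : 0 < p - 1 := by linarith
  have hpp : 0 < p := by linarith
  have hrp : ∀ x : ℝ, 0 ≤ x → x ^ p = x ^ (p - 1) * x := by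
    intro x hx
    rcases hx.eq_or_lt with rfl | hx
    · rw [Real.zero_rpow hpp.ne', mul_zero]
    · nth_rewrite 3 [← Real.rpow_one x]
      rw [← Real.rpow_add hx]; congr 1; ring
  have hrq : ∀ x : ℝ, 0 ≤ x → |x ^ (p - 1)| ^ (p / (p - 1)) = x ^ p := by
    intro x hx
    rw [abs_of_nonneg (Real.rpow_nonneg hx _), ← Real.rpow_mul hx]
    congr 1; field_simp
  have hZ : γ ^ (p - 1) < g ^ (p - 1) := Real.rpow_lt_rpow hγ0 hγg hp'
  have hconv : ConvexOn ℝ univ (fun w : ℝ => (p - 1) * |w| ^ (p / (p - 1)) - p * g * w + μ) := by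
    have h1 := (conv_abs (p / (p - 1)) (by rw [le_div_iff₀ hp']; linarith)).smul hp'.le
    have h2 : ConvexOn ℝ univ (fun w : ℝ => (- (p * g)) * w + μ) := by
      refine ⟨convex_univ, fun x _ y _ a b ha hb hab => le_of_eq ?_⟩
      simp only [smul_eq_mul]
      have : b = 1 - a := by linarith
      subst this; ring
    have h3 := h1.add h2
    refine h3.congr ?_
    intro x _
    simp only [Pi.add_apply, smul_eq_mul]
    ring
  obtain ⟨hl1, hl2⟩ := line_aux _ hconv (γ ^ (p - 1)) (g ^ (p - 1)) (g ^ p - μ) hZ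
    (by rw [hrq γ hγ0, hrp γ hγ0]; linarith)
    (by rw [hrq g hg.le, hrp g hg.le]; ring)
  set k := (g ^ p - μ) / (g ^ (p - 1) - γ ^ (p - 1)) with hkdef
  have hk : 0 < k := div_pos (by linarith) (by linarith)
  have est := est_aux p g μ γ k hp hg hμ0 hγ0 hγg hk hl1 hl2 v y w ε hv hwy hw hlim
  have hkZ : 0 < k * (g ^ (p - 1) - γ ^ (p - 1)) := mul_pos hk (by linarith)
  -- ε → 0
  have hb0 : Tendsto (fun s => C1 * Real.exp (-p * s) + C2 * Real.exp (p / g * (v s - g * s))) atTop (𝓝 0) := by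
    have h1 : Tendsto (fun s : ℝ => Real.exp (-p * s)) atTop (𝓝 0) :=
      Real.tendsto_exp_atBot.comp (tendsto_id.const_mul_atTop_of_neg (by linarith))
    have h2 : Tendsto (fun s : ℝ => Real.exp (p / g * (v s - g * s))) atTop (𝓝 0) :=
      Real.tendsto_exp_atBot.comp (hlim.const_mul_atBot (by positivity))
    simpa using (h1.const_mul C1).add (h2.const_mul C2)
  have hw0 : Tendsto w atTop (𝓝 (γ ^ (p - 1))) := by
    rw [Metric.tendsto_atTop]
    intro δ hδ
    have hη : 0 < min (k * δ / 4) (k * (g ^ (p - 1) - γ ^ (p - 1)) / 4) := by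
      apply lt_min <;> positivity
    obtain ⟨S, hS⟩ := eventually_atTop.1 (hb0.eventually (eventually_lt_nhds hη))
    refine ⟨S, fun s hs => ?_⟩
    have h1 := est s _ hη (by
      have := min_le_right (k * δ / 4) (k * (g ^ (p - 1) - γ ^ (p - 1)) / 4)
      linarith) (fun t ht => (hε t).trans (hS t (by linarith)).le)
    rw [Real.dist_eq]
    refine lt_of_le_of_lt h1 ?_
    rw [div_lt_iff₀ hk]
    have := min_le_left (k * δ / 4) (k * (g ^ (p - 1) - γ ^ (p - 1)) / 4)
    nlinarith [mul_pos hk hδ]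
  -- rough bound on v
  have hmid : γ ^ (p - 1) < ((γ + g) / 2) ^ (p - 1) :=
    Real.rpow_lt_rpow hγ0 (by linarith) hp'
  obtain ⟨S1, hS1⟩ := eventually_atTop.1 ((hw0.eventually (eventually_lt_nhds hmid)).and
    (eventually_ge_atTop 0))
  have hy1 : ∀ s, S1 ≤ s → y s ≤ (γ + g) / 2 := by
    intro s hs
    by_contra hc
    push Not at hc
    have h1 := (hS1 s hs).1
    rw [hwy, phi_pos _ _ (by linarith)] at h1
    have := Real.rpow_lt_rpow (by linarith) hc hp'
    linarith
  have hd : ∀ (c s : ℝ), HasDerivAt (fun s => v s - c * s) (y s - c) s := fun c s => by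
    have := (hv s).fun_sub ((hasDerivAt_id' s).const_mul c)
    rwa [mul_one] at this
  have hanti : AntitoneOn (fun s => v s - (γ + g) / 2 * s) (Ici S1) := by
    refine antitoneOn_of_deriv_nonpos (convex_Ici S1)
      (fun s hs => (hd _ s).continuousAt.continuousWithinAt)
      (fun s hs => (hd _ s).differentiableAt.differentiableWithinAt) ?_
    intro s hs
    rw [interior_Ici] at hs
    rw [(hd _ s).deriv]
    linarith [hy1 s (le_of_lt hs)]
  set c := v S1 - (γ + g) / 2 * S1 with hc
  set κ := p / g * ((g - γ) / 2) with hκ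
  have hκ0 : 0 < κ := by
    have : 0 < g - γ := by linarith
    positivity
  have hκp : κ ≤ p := by
    rw [hκ, div_mul_eq_mul_div, div_le_iff₀ hg]
    gcongr
    linarith
  set K := C1 + C2 * Real.exp (p / g * c) with hK
  have hK0 : 0 < K := by positivity
  have hεK : ∀ s, S1 ≤ s → |ε s| ≤ K * Real.exp (-κ * s) := by
    intro s hs
    refine (hε s).trans ?_
    have hs0 := (hS1 s hs).2
    have h1 : Real.exp (-p * s) ≤ Real.exp (-κ * s) := by
      apply Real.exp_le_exp.2
      nlinarith
    have h2 : Real.exp (p / g * (v s - g * s)) ≤ Real.exp (p / g * c) * Real.exp (-κ * s) := by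
      rw [← Real.exp_add]
      apply Real.exp_le_exp.2
      have h3 := hanti (self_mem_Ici) (show s ∈ Ici S1 from hs) hs
      simp only [← hc] at h3
      have : p / g * c + -κ * s = p / g * (c - (g - γ) / 2 * s) := by rw [hκ]; ring
      rw [this]
      refine mul_le_mul_of_nonneg_left ?_ (by positivity)
      linarith
    calc _ ≤ C1 * Real.exp (-κ * s) + C2 * (Real.exp (p / g * c) * Real.exp (-κ * s)) := by gcongr
      _ = _ := by rw [hK]; ring
  have hexp0 : Tendsto (fun s : ℝ => K * Real.exp (-κ * s)) atTop (𝓝 0) := by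
    have h1 : Tendsto (fun s : ℝ => Real.exp (-κ * s)) atTop (𝓝 0) :=
      Real.tendsto_exp_atBot.comp (tendsto_id.const_mul_atTop_of_neg (by linarith))
    simpa using h1.const_mul K
  have hzK : ∀ᶠ s in atTop, |w s - γ ^ (p - 1)| ≤ (2 * K / k) * Real.exp (-κ * s) := by
    filter_upwards [hexp0.eventually (eventually_lt_nhds (half_pos hkZ)), eventually_ge_atTop S1]
      with s hs1 hs2
    have h1 := est s (K * Real.exp (-κ * s)) (by positivity) (by linarith) (by
      intro t ht
      refine (hεK t (by linarith)).trans ?_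
      refine mul_le_mul_of_nonneg_left (Real.exp_le_exp.2 ?_) hK0.le
      nlinarith)
    refine h1.trans (le_of_eq ?_)
    ring
  -- decay of y - γ
  have hyO : ∃ κ' > 0, (fun s => y s - γ) =O[atTop] (fun s => Real.exp (-κ' * s)) := by
    rcases hγ0.eq_or_lt with h0 | h0
    · subst h0
      refine ⟨κ / (p - 1), by positivity, ?_⟩
      refine Asymptotics.IsBigO.of_bound ((2 * K / k) ^ (1 / (p - 1))) ?_
      filter_upwards [hzK] with s hs
      rw [Real.zero_rpow hp'.ne', sub_zero, hwy, phi_abs _ _ hp] at hs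
      rw [sub_zero, Real.norm_eq_abs, Real.norm_eq_abs, Real.abs_exp]
      have h1 := Real.rpow_le_rpow (by positivity) hs (show 0 ≤ 1 / (p - 1) by positivity)
      rw [← Real.rpow_mul (abs_nonneg _), mul_one_div_cancel hp'.ne', Real.rpow_one,
        Real.mul_rpow (by positivity) (by positivity), ← Real.exp_mul] at h1
      refine h1.trans (le_of_eq ?_)
      congr 2
      ring
    · refine ⟨κ, hκ0, ?_⟩
      have hw1 : 0 < γ ^ (p - 1) := Real.rpow_pos_of_pos h0 _
      have h1 : HasDerivAt (fun x : ℝ => x ^ (1 / (p - 1))) _ (γ ^ (p - 1)) :=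
        Real.hasDerivAt_rpow_const (Or.inl hw1.ne')
      have h2 := (h1.isBigO_sub).comp_tendsto hw0
      have h3 : (fun s => w s - γ ^ (p - 1)) =O[atTop] (fun s => Real.exp (-κ * s)) := by
        refine Asymptotics.IsBigO.of_bound (2 * K / k) ?_
        filter_upwards [hzK] with s hs
        rwa [Real.norm_eq_abs, Real.norm_eq_abs, Real.abs_exp]
      refine (h2.trans h3).congr' ?_ EventuallyEq.rfl
      filter_upwards [hw0.eventually (eventually_gt_nhds hw1)] with s hs
      have hy : 0 < y s := by
        by_contra hc
        push Not at hc
        rw [hwy] at hs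
        have : |y s| ^ (p - 2) * y s ≤ 0 := mul_nonpos_of_nonneg_of_nonpos (by positivity) hc
        linarith
      simp only [Function.comp]
      rw [hwy, phi_pos _ _ hy, ← Real.rpow_mul hy.le, ← Real.rpow_mul hγ0,
        mul_one_div_cancel hp'.ne', Real.rpow_one, Real.rpow_one]
  obtain ⟨κ', hκ', hO⟩ := hyO
  obtain ⟨D, hD⟩ := hO.bound
  obtain ⟨S2, hS2⟩ := eventually_atTop.1 hD
  have hmeas : Measurable y := by
    have : y = deriv v := by ext s; exact (hv s).deriv.symm
    rw [this]; exact measurable_deriv v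
  have hint : IntegrableOn (fun s => y s - γ) (Ioi S2) := by
    refine Integrable.mono' (g := fun s => D * Real.exp (-κ' * s))
      ((exp_neg_integrableOn_Ioi S2 hκ').const_mul D) (by fun_prop) ?_
    rw [ae_restrict_iff' measurableSet_Ioi]
    refine Eventually.of_forall fun s hs => ?_
    have := hS2 s (le_of_lt hs)
    rwa [Real.norm_eq_abs (Real.exp _), Real.abs_exp] at this
  exact ⟨_, tendsto_limUnder_of_hasDerivAt_of_integrableOn_Ioi (fun s _ => hd γ s) hint⟩

theorem stmt_0
    (N : ℕ) (hN : 2 ≤ N) (p μ m : ℝ)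
    (hp1 : 1 < p) (hpN : p < N)
    (hμ0 : 0 ≤ μ) (hμ : μ < (((N : ℝ) - p) / p) ^ p)
    (hm : 0 < m)
    (f : ℝ → ℝ) (hf : Continuous f)
    (hF : ∃ A > (0:ℝ), ∃ q > p, ∃ t₀ > (0:ℝ),
      (∀ t : ℝ, |t| ≤ t₀ → |f t| ≤ A * |t| ^ (q - 1)) ∧
      (∀ t : ℝ, t₀ ≤ |t| → |f t| ≤ A * |t| ^ ((N : ℝ) * p / ((N : ℝ) - p) - 1)))
    (u u' : ℝ → ℝ)
    (hu_pos : ∀ r : ℝ, 0 < r → 0 < u r)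
    (hu' : ∀ r : ℝ, 0 < r → HasDerivAt u (u' r) r)
    (hS : ∀ r : ℝ, 0 < r →
      HasDerivAt (fun s : ℝ => s ^ ((N : ℝ) - 1) * |u' s| ^ (p - 2) * u' s)
        (-(r ^ ((N : ℝ) - 1) *
          (μ / r ^ p * u r ^ (p - 1) - m * u r ^ (p - 1) + f (u r)))) r)
    (hW1 : IntegrableOn
      (fun r : ℝ => (u r ^ p + |u' r| ^ p) * r ^ ((N : ℝ) - 1)) (Ioo 0 1))
    (hW2 : Tendsto (fun r : ℝ => u r * r ^ (((N : ℝ) - p) / p)) (𝓝[>] 0) (𝓝 0))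
    (γ₁ : ℝ)
    (hγ₁ : 0 ≤ γ₁ ∧ γ₁ < ((N : ℝ) - p) / p ∧
      γ₁ ^ (p - 1) * ((p - 1) * γ₁ - ((N : ℝ) - p)) + μ = 0) :
    ∃ C : ℝ, 0 < C ∧ Tendsto (fun r : ℝ => u r * r ^ γ₁) (𝓝[>] 0) (𝓝 C) := by
  obtain ⟨A, hA, q, hq, t₀, ht₀, hF1, hF2⟩ := hF
  obtain ⟨hγ0, hγg, hγ⟩ := hγ₁
  have hNp : 0 < (N : ℝ) - p := by linarith
  have hpp : 0 < p := by linarith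
  have hp' : 0 < p - 1 := by linarith
  set g := ((N : ℝ) - p) / p with hgdef
  have hg : 0 < g := by positivity
  have hpg : (N : ℝ) - p = p * g := by rw [hgdef]; field_simp
  set v : ℝ → ℝ := fun s => Real.log (u (Real.exp (-s))) with hvdef
  have hup : ∀ s, 0 < u (Real.exp (-s)) := fun s => hu_pos _ (Real.exp_pos _)
  have huv : ∀ s, u (Real.exp (-s)) = Real.exp (v s) := fun s => (Real.exp_log (hup s)).symm
  have hupow : ∀ s a, u (Real.exp (-s)) ^ a = Real.exp (v s * a) := fun s a => by
    rw [huv, ← Real.exp_mul]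
  have hrpow : ∀ s a, Real.exp (-s) ^ a = Real.exp (-s * a) := fun s a => by
    rw [← Real.exp_mul]
  set y : ℝ → ℝ := fun s => -(Real.exp (-s) * u' (Real.exp (-s)) / u (Real.exp (-s))) with hydef
  set w : ℝ → ℝ := fun s => |y s| ^ (p - 2) * y s with hwdef
  set ε : ℝ → ℝ := fun s => Real.exp (-p * s) *
    (-m + f (u (Real.exp (-s))) * Real.exp (-(p - 1) * v s)) with hεdef
  have her : ∀ s : ℝ, HasDerivAt (fun s : ℝ => Real.exp (-s)) (-Real.exp (-s)) s := fun s => by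
    simpa using (hasDerivAt_neg s).exp
  have hv : ∀ s, HasDerivAt v (y s) s := by
    intro s
    have h1 := ((hu' _ (Real.exp_pos (-s))).comp s (her s)).log (hup s).ne'
    refine HasDerivAt.congr_deriv h1 ?_
    simp only [hydef, Function.comp]
    ring
  set F : ℝ → ℝ := fun s : ℝ => s ^ ((N : ℝ) - 1) * |u' s| ^ (p - 2) * u' s with hFdef
  have hwF : ∀ s, w s = -F (Real.exp (-s)) * Real.exp ((p * g) * s - (p - 1) * v s) := by
    intro s
    simp only [hwdef, hydef, hFdef]
    rw [abs_neg, abs_div, abs_mul, Real.abs_exp, abs_of_pos (hup s),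
      Real.div_rpow (by positivity) (hup s).le, Real.mul_rpow (by positivity) (by positivity),
      hupow, hrpow, hrpow, huv s, ← hpg]
    have e1 : Real.exp (-s * ((N : ℝ) - 1)) * Real.exp (((N : ℝ) - p) * s - (p - 1) * v s)
       = Real.exp (-s * (p - 2)) * Real.exp (-s) / (Real.exp (v s * (p - 2)) * Real.exp (v s)) := by
      rw [← Real.exp_add, ← Real.exp_add, ← Real.exp_add, ← Real.exp_sub]
      congr 1; ring
    calc _ = -(|u' (Real.exp (-s))| ^ (p - 2) * u' (Real.exp (-s))) *
          (Real.exp (-s * (p - 2)) * Real.exp (-s) / (Real.exp (v s * (p - 2)) * Real.exp (v s))) := by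
            field_simp
      _ = _ := by rw [← e1]; ring
  have hyw : ∀ s, y s * w s = |w s| ^ (p / (p - 1)) := by
    intro s
    simp only [hwdef]
    rw [phi_abs _ _ hp1, ← Real.rpow_mul (abs_nonneg _), mul_div_cancel₀ _ hp'.ne']
    rcases eq_or_ne (y s) 0 with h | h
    · simp [h, Real.zero_rpow hpp.ne']
    · have h2 : y s * (|y s| ^ (p - 2) * y s) = |y s| ^ (p - 2) * |y s| ^ (2 : ℝ) := by
        rw [Real.rpow_two, sq_abs]; ring
      rw [h2, ← Real.rpow_add (abs_pos.2 h)]; congr 1; ring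
  have hw : ∀ s, HasDerivAt w (-((p - 1) * |w s| ^ (p / (p - 1)) - p * g * w s + μ + ε s)) s := by
    intro s
    have h1 : HasDerivAt F _ (Real.exp (-s)) := hS _ (Real.exp_pos (-s))
    have h2 := (h1.comp s (her s)).neg
    have h3 : HasDerivAt (fun s => (p * g) * s - (p - 1) * v s) (p * g - (p - 1) * y s) s := by
      have := ((hasDerivAt_id' s).const_mul (p * g)).fun_sub ((hv s).const_mul (p - 1))
      rwa [mul_one] at this
    have h4 := h2.mul h3.exp
    have hwe : w = -(F ∘ fun s => Real.exp (-s)) * (fun s => Real.exp ((p * g) * s - (p - 1) * v s)) := by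
      ext s; rw [hwF]; rfl
    rw [← hwe] at h4
    refine HasDerivAt.congr_deriv h4 (Eq.symm ?_)
    have h5 : (-(F ∘ fun s => Real.exp (-s))) s * (Real.exp ((p * g) * s - (p - 1) * v s) * (p * g - (p - 1) * y s)) = w s * (p * g - (p - 1) * y s) := by
      rw [hwF]; simp only [Pi.neg_apply, Function.comp]; ring
    rw [h5, ← hyw]
    have e1 : Real.exp (-s * ((N : ℝ) - 1)) * Real.exp (-s) * Real.exp ((p * g) * s - (p - 1) * v s)
       = Real.exp (-p * s) * Real.exp (-(p - 1) * v s) := by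
      rw [← hpg, ← Real.exp_add, ← Real.exp_add, ← Real.exp_add]
      congr 1; ring
    have e2 : Real.exp (-p * s) * Real.exp (-(p - 1) * v s) * (1 / Real.exp (-s * p) * Real.exp (v s * (p - 1))) = 1 := by
      rw [one_div, ← Real.exp_neg, ← Real.exp_add, ← Real.exp_add, ← Real.exp_add, ← Real.exp_zero]
      congr 1; ring
    have e3 : Real.exp (-(p - 1) * v s) * Real.exp (v s * (p - 1)) = 1 := by
      rw [← Real.exp_add, ← Real.exp_zero]
      congr 1; ring
    rw [hrpow, hrpow, hupow]
    simp only [hεdef]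
    linear_combination (μ / Real.exp (-s * p) * Real.exp (v s * (p - 1)) - m * Real.exp (v s * (p - 1))
      + f (u (Real.exp (-s)))) * e1 + μ * e2 - m * Real.exp (-p * s) * e3
  have hlim : Tendsto (fun s => v s - g * s) atTop atBot := by
    have hr : Tendsto (fun s : ℝ => Real.exp (-s)) atTop (𝓝[>] 0) :=
      tendsto_nhdsWithin_iff.2 ⟨Real.tendsto_exp_neg_atTop_nhds_zero,
        Eventually.of_forall fun s => Real.exp_pos _⟩
    have h1 := hW2.comp hr
    have h2 : Tendsto (fun s => u (Real.exp (-s)) * Real.exp (-s) ^ g) atTop (𝓝[>] 0) :=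
      tendsto_nhdsWithin_iff.2 ⟨h1, Eventually.of_forall fun s =>
        mul_pos (hup s) (Real.rpow_pos_of_pos (Real.exp_pos _) _)⟩
    refine (Real.tendsto_log_nhdsGT_zero.comp h2).congr fun s => ?_
    simp only [Function.comp]
    rw [hrpow, huv, ← Real.exp_add, Real.log_exp]; ring
  have hε : ∀ s, |ε s| ≤ (m + A * t₀ ^ (q - p)) * Real.exp (-p * s)
      + A * Real.exp (p / g * (v s - g * s)) := by
    intro s
    have hfu : |f (u (Real.exp (-s)))| ≤ A * t₀ ^ (q - p) * u (Real.exp (-s)) ^ (p - 1)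
        + A * u (Real.exp (-s)) ^ ((N : ℝ) * p / ((N : ℝ) - p) - 1) := by
      have hU := hup s
      set U := u (Real.exp (-s))
      have p1 : 0 ≤ A * t₀ ^ (q - p) * U ^ (p - 1) := by positivity
      have p2 : 0 ≤ A * U ^ ((N : ℝ) * p / ((N : ℝ) - p) - 1) := by positivity
      rcases le_total U t₀ with h | h
      · have h1 := hF1 U (by rwa [abs_of_pos hU])
        rw [abs_of_pos hU] at h1
        have h2 : U ^ (q - 1) = U ^ (q - p) * U ^ (p - 1) := by
          rw [← Real.rpow_add hU]; congr 1; ring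
        have h3 : U ^ (q - p) ≤ t₀ ^ (q - p) := Real.rpow_le_rpow hU.le h (by linarith)
        have h4 : A * U ^ (q - 1) ≤ A * t₀ ^ (q - p) * U ^ (p - 1) := by
          rw [h2, ← mul_assoc]; gcongr
        linarith
      · have h1 := hF2 U (by rwa [abs_of_pos hU])
        rw [abs_of_pos hU] at h1
        linarith
    rw [hupow, hupow] at hfu
    simp only [hεdef]
    rw [abs_mul, Real.abs_exp]
    have e3 : Real.exp (v s * (p - 1)) * Real.exp (-(p - 1) * v s) = 1 := by
      rw [← Real.exp_add, ← Real.exp_zero]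
      congr 1; ring
    have e4 : Real.exp (-p * s) * (Real.exp (v s * ((N : ℝ) * p / ((N : ℝ) - p) - 1)) * Real.exp (-(p - 1) * v s))
       = Real.exp (p / g * (v s - g * s)) := by
      rw [← Real.exp_add, ← Real.exp_add]
      congr 1
      rw [hgdef]; field_simp; ring
    calc _ ≤ Real.exp (-p * s) * (m + |f (u (Real.exp (-s)))| * Real.exp (-(p - 1) * v s)) := by
          gcongr
          refine (abs_add_le _ _).trans (le_of_eq ?_)
          rw [abs_neg, abs_of_pos hm, abs_mul, Real.abs_exp]
      _ ≤ Real.exp (-p * s) * (m + (A * t₀ ^ (q - p) * Real.exp (v s * (p - 1)) +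
            A * Real.exp (v s * ((N : ℝ) * p / ((N : ℝ) - p) - 1))) * Real.exp (-(p - 1) * v s)) := by
          gcongr
      _ = _ := by
          linear_combination Real.exp (-p * s) * A * t₀ ^ (q - p) * e3 + A * e4
  obtain ⟨L, hL⟩ := conv_aux p g μ γ₁ hp1 hg hμ0 hμ hγ0 hγg (by rw [← hpg]; exact hγ) v y w ε hv
    (fun s => rfl) hw hlim _ _ (by positivity) hA hε
  refine ⟨Real.exp L, Real.exp_pos L, ?_⟩
  have hl : Tendsto (fun r : ℝ => - Real.log r) (𝓝[>] 0) atTop :=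
    tendsto_neg_atBot_atTop.comp Real.tendsto_log_nhdsGT_zero
  have h1 := (Real.continuous_exp.tendsto L).comp (hL.comp hl)
  refine h1.congr' ?_
  filter_upwards [self_mem_nhdsWithin] with r hr
  have hr : 0 < r := hr
  simp only [Function.comp, hvdef, neg_neg, Real.exp_log hr]
  rw [Real.exp_sub, Real.exp_log (hu_pos r hr), Real.rpow_def_of_pos hr, div_eq_mul_inv, ← Real.exp_neg]
  congr 2; ring
end

section
/- Let N ≥ 2 be an integer and let p, μ, m be real numbers with 1 < p < N, 0 ≤ μ < μ̄ := ((N−p)/p)^p and m > 0. Let f : ℝ → ℝ be continuous and satisfy (F). Let u : (0,∞) → ℝ be a radial profile solution of the equation (hypothesis (S)) such that u(r) → 0 as r → ∞. Then there exists a constant C with 0 < C < ∞ such that u(r)·r^{(N−1)/(p(p−1))}·e^{(m/(p−1))^{1/p}·r} → C as r → ∞. -/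
open Filter Topology Set

lemma rpow_quad (s v0 : ℝ) (hv : 0 < v0) :
    ∃ C : ℝ, 0 ≤ C ∧ ∀ᶠ x in 𝓝 v0,
      |x ^ s - v0 ^ s - s * v0 ^ (s - 1) * (x - v0)| ≤ C * (x - v0) ^ 2 := by
  have h1 : AnalyticAt ℝ (fun x : ℝ => x ^ s) v0 := by
    have := Real.contDiffAt_rpow_const_of_ne (x := v0) (p := s) (n := ⊤) hv.ne'
    exact this.analyticAt
  obtain ⟨P, hP⟩ := h1
  have h2 := hP.has_fpower_series_dslope_fslope.differentiableAt
  have h3 := h2.isBigO_sub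
  obtain ⟨C, hC, h4⟩ := h3.exists_nonneg
  refine ⟨C, hC, ?_⟩
  filter_upwards [h4.bound] with x hx
  have hd : deriv (fun x : ℝ => x ^ s) v0 = s * v0 ^ (s - 1) :=
    (Real.hasDerivAt_rpow_const (Or.inl hv.ne')).deriv
  have h5 := sub_smul_dslope (fun x : ℝ => x ^ s) v0 x
  rw [dslope_same, hd] at hx
  simp only [smul_eq_mul, Real.norm_eq_abs] at h5 hx
  have : x ^ s - v0 ^ s - s * v0 ^ (s - 1) * (x - v0)
      = (x - v0) * (dslope (fun x : ℝ => x ^ s) v0 x - s * v0 ^ (s - 1)) := by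
    linear_combination -h5
  rw [this, abs_mul, ← sq_abs (x - v0)]
  nlinarith [abs_nonneg (x - v0)]

lemma trap (φ φ' : ℝ → ℝ) (c r1 : ℝ) (hd : ∀ r, r1 ≤ r → HasDerivAt φ (φ' r) r)
    (h1 : c ≤ φ r1) (h : ∀ r, r1 ≤ r → φ r = c → 0 < φ' r) :
    ∀ r, r1 ≤ r → c ≤ φ r := by
  intro r hr
  have := image_le_of_deriv_right_lt_deriv_boundary' (f := fun x => - φ x) (f' := fun x => - φ' x)
    (a := r1) (b := r) (B := fun _ => -c) (B' := fun _ => 0)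
    (fun x hx => (hd x hx.1).neg.continuousAt.continuousWithinAt)
    (fun x hx => (hd x hx.1).neg.hasDerivWithinAt) (by simpa using h1) continuousOn_const
    (fun x _ => hasDerivWithinAt_const _ _ _)
    (fun x hx hh => by have := h x hx.1 (by simpa using hh); linarith) (right_mem_Icc.2 hr)
  simpa using this

lemma anti_of (φ φ' : ℝ → ℝ) (r1 : ℝ) (hd : ∀ r, r1 ≤ r → HasDerivAt φ (φ' r) r)
    (h : ∀ r, r1 ≤ r → φ' r ≤ 0) : AntitoneOn φ (Ici r1) := by
  refine antitoneOn_of_hasDerivWithinAt_nonpos (convex_Ici r1) (f' := φ')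
    (fun x hx => (hd x hx).continuousAt.continuousWithinAt)
    (fun x hx => (hd x (interior_subset hx)).hasDerivWithinAt)
    (fun x hx => h x (interior_subset hx))

/-- linear decrease makes a function negative -/
lemma lin_neg (φ φ' : ℝ → ℝ) (r1 κ : ℝ) (hκ : 0 < κ) (hd : ∀ r, r1 ≤ r → HasDerivAt φ (φ' r) r)
    (h : ∀ r, r1 ≤ r → φ' r ≤ -κ) : ∃ r, r1 ≤ r ∧ φ r ≤ 0 := by
  have := anti_of (fun r => φ r + κ * r) (fun r => φ' r + κ * 1) r1
    (fun r hr => (hd r hr).add ((hasDerivAt_id r).const_mul κ)) (fun r hr => by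
      have := h r hr; linarith)
  have hr : r1 ≤ r1 + |φ r1| / κ := by
    have : 0 ≤ |φ r1| / κ := by positivity
    linarith
  refine ⟨_, hr, ?_⟩
  have h2 := this (self_mem_Ici) hr hr
  simp only [mul_add] at h2
  rw [mul_div_cancel₀ _ hκ.ne'] at h2
  have := le_abs_self (φ r1)
  linarith

lemma conv_of (E E' : ℝ → ℝ) (R C p : ℝ) (hR : 0 < R) (hp : 1 < p)
    (hd : ∀ r, R ≤ r → HasDerivAt E (E' r) r)
    (h : ∀ r, R ≤ r → |E' r| ≤ C * (r ^ (-2:ℝ) + r ^ (-p))) :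
    ∃ l, Tendsto E atTop (𝓝 l) := by
  refine ⟨_, MeasureTheory.tendsto_limUnder_of_hasDerivAt_of_integrableOn_Ioi (a := R) (f' := deriv E)
    (fun x hx => (hd x (le_of_lt hx)).differentiableAt.hasDerivAt) ?_⟩
  have hi : MeasureTheory.IntegrableOn (fun r : ℝ => C * (r ^ (-2:ℝ) + r ^ (-p))) (Ioi R) :=
    ((integrableOn_Ioi_rpow_of_lt (by norm_num) hR).add
      (integrableOn_Ioi_rpow_of_lt (by linarith) hR)).const_mul C
  refine MeasureTheory.Integrable.mono' hi (measurable_deriv E).aestronglyMeasurable ?_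
  refine (MeasureTheory.ae_restrict_iff' measurableSet_Ioi).2 (Eventually.of_forall fun x hx => ?_)
  rw [(hd x (le_of_lt hx)).deriv]
  exact h x (le_of_lt hx)

lemma riccati (a P m n : ℝ) (ha : 0 < a) (hP : 1 < P) (hm : 0 < m) (hn : 0 ≤ n)
    (v ε : ℝ → ℝ) (v0 : ℝ) (hv0 : 0 < v0) (hv0m : a * v0 ^ P = m)
    (hε : Tendsto ε atTop (𝓝 0))
    (hd : ∀ r, 0 < r → HasDerivAt v (a * |v r| ^ P - n / r * v r - m + ε r) r)
    (hneg : ∀ r1, 0 < r1 → ¬ ∀ r, r1 ≤ r → v r ≤ 0) :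
    Tendsto v atTop (𝓝 v0) := by
  have up : ∀ x, v0 < x → ∀ᶠ r in atTop, v r < x := by
    intro x hx
    have hx0 : 0 < x := hv0.trans hx
    have hxP : 0 < x ^ P := Real.rpow_pos_of_pos hx0 _
    have hlt : v0 ^ P < x ^ P := Real.rpow_lt_rpow hv0.le hx (by linarith)
    obtain ⟨κ, hκ⟩ : ∃ κ, κ * x ^ P = a * x ^ P - m := ⟨(a * x ^ P - m) / x ^ P, by field_simp⟩
    have hκ0 : 0 < κ := by
      have : 0 < κ * x ^ P := by rw [hκ, ← hv0m]; nlinarith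
      exact pos_of_mul_pos_left this hxP.le
    have hxP1 : 0 < x ^ (P - 1) := Real.rpow_pos_of_pos hx0 _
    have e1 : ∀ᶠ r in atTop, |ε r| < κ / 4 * x ^ P := by
      have := hε.abs; rw [abs_zero] at this
      exact this.eventually_lt_const (by positivity)
    have e2 : ∀ᶠ r : ℝ in atTop, n / r < κ / 4 * x ^ (P - 1) :=
      (tendsto_const_nhds.div_atTop tendsto_id).eventually_lt_const (by positivity)
    obtain ⟨R, hR⟩ := eventually_atTop.1 (e1.and (e2.and (eventually_gt_atTop 0)))
    have key : ∀ r, R ≤ r → x ≤ v r →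
        κ / 2 * v r ^ P ≤ a * |v r| ^ P - n / r * v r - m + ε r := by
      intro r hr hxv
      obtain ⟨h1, h2, h3⟩ := hR r hr
      have hv : 0 < v r := hx0.trans_le hxv
      rw [abs_of_pos hv]
      have g1 : x ^ P ≤ v r ^ P := Real.rpow_le_rpow hx0.le hxv (by linarith)
      have g2 : v r ^ P = v r ^ (P - 1) * v r := by
        rw [Real.rpow_sub_one hv.ne']; field_simp
      have g3 : x ^ (P - 1) ≤ v r ^ (P - 1) := Real.rpow_le_rpow hx0.le hxv (by linarith)
      have g4 : n / r * v r ≤ κ / 4 * v r ^ P := by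
        rw [g2, ← mul_assoc]
        apply mul_le_mul_of_nonneg_right _ hv.le
        nlinarith
      have g5 := (abs_lt.1 h1).1
      have hak : 0 ≤ a - κ := by
        have : 0 < (a - κ) * x ^ P := by nlinarith
        exact (pos_of_mul_pos_left this hxP.le).le
      nlinarith [mul_le_mul_of_nonneg_left g1 hak]
    filter_upwards [eventually_ge_atTop R] with r1 hr1
    by_contra hcon
    push Not at hcon
    have hpos : ∀ r, r1 ≤ r → 0 < r := fun r hr => (hR r (hr1.trans hr)).2.2
    have T := trap v _ x r1 (fun r hr => hd r (hpos r hr)) hcon (fun r hr he => by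
      have := key r (hr1.trans hr) he.ge
      have h2 : 0 < v r ^ P := by rw [he]; exact hxP
      have h3 : 0 < κ / 2 * v r ^ P := by positivity
      linarith)
    obtain ⟨r, hr, hr0⟩ := lin_neg (fun r => v r ^ (1 - P)) _ r1 ((P - 1) * (κ / 2))
      (by have : 0 < P - 1 := by linarith
          positivity)
      (fun r hr => (hd r (hpos r hr)).rpow_const (Or.inl (hx0.trans_le (T r hr)).ne'))
      (fun r hr => by
        have hv : 0 < v r := hx0.trans_le (T r hr)
        have k := key r (hr1.trans hr) (T r hr)
        have e : v r ^ (1 - P - 1) * v r ^ P = 1 := by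
          rw [← Real.rpow_add hv]; simp
        have hq : 0 < v r ^ (1 - P - 1) := Real.rpow_pos_of_pos hv _
        have : κ / 2 ≤ (a * |v r| ^ P - n / r * v r - m + ε r) * v r ^ (1 - P - 1) := by
          calc κ / 2 = (κ / 2 * v r ^ P) * v r ^ (1 - P - 1) := by
                rw [mul_assoc, mul_comm (v r ^ P), e, mul_one]
            _ ≤ _ := mul_le_mul_of_nonneg_right k hq.le
        have hP1 : 0 < P - 1 := by linarith
        nlinarith [mul_le_mul_of_nonneg_left this hP1.le])
    have := Real.rpow_pos_of_pos (hx0.trans_le (T r hr)) (1 - P)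
    linarith
  have lo : ∀ x, 0 < x → x < v0 → ∀ᶠ r in atTop, x < v r := by
    intro x hx0 hx
    have hlt : x ^ P < v0 ^ P := Real.rpow_lt_rpow hx0.le hx (by linarith)
    obtain ⟨κ, hκ⟩ : ∃ κ, κ = m - a * x ^ P := ⟨_, rfl⟩
    have hκ0 : 0 < κ := by rw [hκ, ← hv0m]; nlinarith
    obtain ⟨R, hR⟩ := eventually_atTop.1 ((hε.eventually_lt_const (half_pos hκ0)).and
      (eventually_gt_atTop 0))
    have key : ∀ r, R ≤ r → 0 ≤ v r → v r ≤ x →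
        a * |v r| ^ P - n / r * v r - m + ε r ≤ - (κ / 2) := by
      intro r hr h0 hxv
      obtain ⟨h1, h3⟩ := hR r hr
      rw [abs_of_nonneg h0]
      have g1 : v r ^ P ≤ x ^ P := Real.rpow_le_rpow h0 hxv (by linarith)
      have g4 : 0 ≤ n / r * v r := by positivity
      nlinarith [mul_le_mul_of_nonneg_left g1 ha.le]
    filter_upwards [eventually_ge_atTop R] with r1 hr1
    by_contra hcon
    push Not at hcon
    have hpos : ∀ r, r1 ≤ r → 0 < r := fun r hr => (hR r (hr1.trans hr)).2
    have T := trap (fun r => - v r) _ (-x) r1 (fun r hr => (hd r (hpos r hr)).neg)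
      (by simpa using hcon) (fun r hr he => by
      have he : v r = x := by simpa using he
      have := key r (hr1.trans hr) (he ▸ hx0.le) he.le
      linarith)
    have T' : ∀ r, r1 ≤ r → v r ≤ x := fun r hr => by simpa using T r hr
    have : ∃ r2, r1 ≤ r2 ∧ v r2 ≤ 0 := by
      by_contra hno
      push Not at hno
      obtain ⟨r, hr, h⟩ := lin_neg v _ r1 (κ / 2) (half_pos hκ0) (fun r hr => hd r (hpos r hr))
        (fun r hr => key r (hr1.trans hr) (hno r hr).le (T' r hr))
      exact absurd h (not_le.2 (hno r hr))
    obtain ⟨r2, hr2, hv2⟩ := this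
    apply hneg r2 (hpos r2 hr2)
    have T2 := trap (fun r => - v r) _ 0 r2 (fun r hr => (hd r (hpos r (hr2.trans hr))).neg)
      (by simpa using hv2) (fun r hr he => by
      have he : v r = 0 := by simpa using he
      have := key r (hr1.trans (hr2.trans hr)) he.ge (he ▸ hx0.le)
      linarith)
    intro r hr
    simpa using T2 r hr
  refine tendsto_order.2 ⟨fun b hb => ?_, up⟩
  filter_upwards [lo (max b (v0 / 2)) (by positivity) (max_lt hb (by linarith))] with r hr
  exact (le_max_left _ _).trans_lt hr

lemma rate (φ φ' : ℝ → ℝ) (R a0 B : ℝ) (hR : 0 < R) (ha : 0 < a0) (hB : 0 ≤ B)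
    (hd : ∀ r, R ≤ r → HasDerivAt φ (φ' r) r)
    (h0 : Tendsto φ atTop (𝓝 0))
    (h : ∀ r, R ≤ r → 0 < φ r → a0 * φ r - B / r ≤ φ' r) :
    ∀ r, R ≤ r → φ r ≤ B / a0 / r := by
  intro r1 hr1
  by_contra hcon
  push Not at hcon
  have hr0 : 0 < r1 := hR.trans_le hr1
  have hpos : 0 < φ r1 := lt_of_le_of_lt (by positivity) hcon
  have hc : B / r1 < a0 * φ r1 := by
    have := mul_lt_mul_of_pos_left hcon ha
    have e : a0 * (B / a0 / r1) = B / r1 := by field_simp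
    linarith
  have T := trap φ φ' (φ r1) r1 (fun r hr => hd r (hr1.trans hr)) le_rfl (fun r hr he => by
    have h1 := h r (hr1.trans hr) (he ▸ hpos)
    have h2 : B / r ≤ B / r1 := div_le_div_of_nonneg_left hB hr0 hr
    rw [he] at h1
    linarith)
  have := ge_of_tendsto h0 (eventually_atTop.2 ⟨r1, T⟩)
  linarith

lemma asymp (a P m n s p K : ℝ) (ha : 0 < a) (hP : 1 < P) (hn : 0 ≤ n) (hs : 0 < s)
    (hp : 1 < p) (hK : 0 ≤ K)
    (v ε u u' : ℝ → ℝ) (v0 : ℝ) (hv0 : 0 < v0) (hv0m : a * v0 ^ P = m)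
    (hε : ∀ᶠ r in atTop, |ε r| ≤ K * r ^ (-p))
    (hd : ∀ r, 0 < r → HasDerivAt v (a * |v r| ^ P - n / r * v r - m + ε r) r)
    (hv : Tendsto v atTop (𝓝 v0))
    (hupos : ∀ r, 0 < r → 0 < u r)
    (hu : ∀ r, 0 < r → HasDerivAt u (u' r) r)
    (hu' : ∀ r, 0 < r → 0 < v r → u' r = - (v r ^ s) * u r) (k : ℝ)
    (hk : k * (a * (P * v0 ^ (P - 1))) = n * v0 * (s * v0 ^ (s - 1))) :
    ∃ l, Tendsto (fun r => Real.log (u r) + v0 ^ s * r + k * Real.log r) atTop (𝓝 l) := by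
  obtain ⟨C1, hC1, q1⟩ := rpow_quad s v0 hv0
  obtain ⟨C2, hC2, q2⟩ := rpow_quad P v0 hv0
  set g1 := s * v0 ^ (s - 1) with hg1
  set h1 := P * v0 ^ (P - 1) with hh1
  have hg1p : 0 < g1 := by positivity
  have hh1p : 0 < h1 := by positivity
  have hz : Tendsto (fun r => v r - v0) atTop (𝓝 0) := by
    simpa using hv.sub_const v0
  have hz2 : ∀ᶠ r in atTop, C2 * |v r - v0| < h1 / 2 := by
    have := (hz.abs).const_mul C2
    rw [abs_zero, mul_zero] at this
    exact this.eventually_lt_const (by positivity)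
  have hvp : ∀ᶠ r in atTop, 0 < v r := hv.eventually_const_lt hv0
  have hvb : ∀ᶠ r in atTop, v r < v0 + 1 := hv.eventually_lt_const (by linarith)
  obtain ⟨R, hR⟩ := eventually_atTop.1 ((hv.eventually q1).and ((hv.eventually q2).and
    (hz2.and (hvp.and (hvb.and (hε.and (eventually_ge_atTop 1)))))))
  have hR0 : 0 < max R 1 := by positivity
  obtain ⟨B, hB⟩ : ∃ B, B = n * (v0 + 1) + K := ⟨_, rfl⟩
  have hB0 : 0 ≤ B := by rw [hB]; positivity
  have low : ∀ r, max R 1 ≤ r → |- (n / r * v r) + ε r| ≤ B / r := by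
    intro r hr
    obtain ⟨-, -, -, x4, x5, x6, x7⟩ := hR r ((le_max_left _ _).trans hr)
    have hr0 : 0 < r := by linarith
    have i1 : |n / r * v r| ≤ n * (v0 + 1) / r := by
      rw [abs_of_nonneg (by positivity), div_mul_eq_mul_div]
      gcongr
    have i2 : r ^ (-p) ≤ 1 / r := by
      rw [one_div, ← Real.rpow_neg_one]
      exact Real.rpow_le_rpow_of_exponent_le x7 (by linarith)
    have i3 : |ε r| ≤ K / r := by
      refine x6.trans ?_
      rw [← mul_one_div]
      gcongr
    calc _ ≤ |- (n / r * v r)| + |ε r| := abs_add_le _ _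
      _ ≤ n * (v0 + 1) / r + K / r := by rw [abs_neg]; gcongr
      _ = B / r := by rw [hB]; ring
  have hH : ∀ r, max R 1 ≤ r → a * |v r| ^ P - m = a * (v r ^ P - v0 ^ P - h1 * (v r - v0))
      + a * h1 * (v r - v0) := by
    intro r hr
    obtain ⟨-, -, -, x4, -⟩ := hR r ((le_max_left _ _).trans hr)
    rw [abs_of_pos x4, ← hv0m]; ring
  have hY : ∀ r, max R 1 ≤ r → |a * (v r ^ P - v0 ^ P - h1 * (v r - v0))|
      ≤ a * h1 / 2 * |v r - v0| := by
    intro r hr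
    obtain ⟨-, x2, x3, -⟩ := hR r ((le_max_left _ _).trans hr)
    rw [abs_mul, abs_of_pos ha, mul_div_assoc, mul_assoc a]
    apply mul_le_mul_of_nonneg_left _ ha.le
    refine x2.trans ?_
    rw [← sq_abs]
    nlinarith [abs_nonneg (v r - v0)]
  have ru := rate (fun r => v r - v0) _ (max R 1) (a * h1 / 2) B hR0 (by positivity) hB0
    (fun r hr => (hd r (hR0.trans_le hr)).sub_const v0) hz (fun r hr hp => by
      have y1 := hH r hr
      have y2 := (abs_le.1 (hY r hr)).1
      have y3 := (abs_le.1 (low r hr)).1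
      rw [abs_of_pos hp] at y2
      linarith)
  have rl := rate (fun r => - (v r - v0)) _ (max R 1) (a * h1 / 2) B hR0 (by positivity) hB0
    (fun r hr => ((hd r (hR0.trans_le hr)).sub_const v0).neg) (by simpa using hz.neg)
    (fun r hr hp => by
      have y1 := hH r hr
      have y2 := (abs_le.1 (hY r hr)).2
      have y3 := (abs_le.1 (low r hr)).2
      rw [abs_of_neg (by linarith)] at y2
      linarith)
  obtain ⟨M, hM⟩ : ∃ M, M = B / (a * h1 / 2) := ⟨_, rfl⟩
  have hM0 : 0 ≤ M := by rw [hM]; positivity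
  have hzM : ∀ r, max R 1 ≤ r → |v r - v0| ≤ M / r := by
    intro r hr
    rw [hM]
    exact abs_le.2 ⟨by linarith [rl r hr], ru r hr⟩
  obtain ⟨c, hc⟩ : ∃ c, c = g1 / (a * h1) := ⟨_, rfl⟩
  have hc0 : 0 ≤ c := by rw [hc]; positivity
  have hch : c * (a * h1) = g1 := by rw [hc]; field_simp
  have hkc : k = c * n * v0 := by
    rw [hc]; field_simp; linarith
  obtain ⟨l, hl⟩ := conv_of
    (fun r => Real.log (u r) + v0 ^ s * r + k * Real.log r + c * (v r - v0))
    (fun r => u' r / u r + v0 ^ s * 1 + k * r⁻¹ +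
      c * (a * |v r| ^ P - n / r * v r - m + ε r)) (max R 1)
    ((C1 + c * a * C2) * M ^ 2 + c * n * M + c * K) p hR0 hp
    (fun r hr => by
      have hr0 := hR0.trans_le hr
      exact ((((hu r hr0).log (hupos r hr0).ne').add ((hasDerivAt_id r).const_mul _)).add
        ((Real.hasDerivAt_log hr0.ne').const_mul k)).add (((hd r hr0).sub_const v0).const_mul c))
    (fun r hr => by
      have hr0 := hR0.trans_le hr
      obtain ⟨x1, x2, x3, x4, x5, x6, x7⟩ := hR r ((le_max_left _ _).trans hr)
      have e1 : u' r / u r = - (v r ^ s) := by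
        rw [hu' r hr0 x4]; field_simp [(hupos r hr0).ne']
      have y1 := hH r hr
      have e2 : u' r / u r + v0 ^ s * 1 + k * r⁻¹ +
          c * (a * |v r| ^ P - n / r * v r - m + ε r) =
          - (v r ^ s - v0 ^ s - g1 * (v r - v0)) +
          c * a * (v r ^ P - v0 ^ P - h1 * (v r - v0)) - c * n / r * (v r - v0) + c * ε r := by
        rw [e1, hkc]
        have : a * |v r| ^ P - n / r * v r - m + ε r =
          (a * |v r| ^ P - m) - n / r * v r + ε r := by ring
        rw [this, y1]
        have e3 : c * n * v0 * r⁻¹ = c * (n / r * v0) := by ring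
        rw [e3]
        linear_combination (v r - v0) * hch
      rw [e2]
      have hzr := hzM r hr
      have s2 : r ^ (-2 : ℝ) = 1 / r ^ 2 := by
        rw [Real.rpow_neg hr0.le, one_div]; norm_cast
      have hzz : (v r - v0) ^ 2 ≤ M ^ 2 * r ^ (-2 : ℝ) := by
        rw [← sq_abs, s2, mul_one_div, ← div_pow]
        gcongr
      have t1 : |v r ^ s - v0 ^ s - g1 * (v r - v0)| ≤ C1 * M ^ 2 * r ^ (-2 : ℝ) := by
        rw [mul_assoc C1]
        exact x1.trans (by gcongr)
      have t2 : |c * a * (v r ^ P - v0 ^ P - h1 * (v r - v0))| ≤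
          c * a * C2 * M ^ 2 * r ^ (-2 : ℝ) := by
        rw [abs_mul, abs_of_nonneg (by positivity : 0 ≤ c * a), mul_assoc (c * a * C2),
          mul_assoc (c * a)]
        have := x2.trans (mul_le_mul_of_nonneg_left hzz hC2)
        gcongr
      have t3 : |c * n / r * (v r - v0)| ≤ c * n * M * r ^ (-2 : ℝ) := by
        rw [abs_mul, abs_of_nonneg (by positivity : 0 ≤ c * n / r)]
        calc c * n / r * |v r - v0| ≤ c * n / r * (M / r) := by gcongr
          _ = _ := by rw [s2]; field_simp
      have t4 : |c * ε r| ≤ c * K * r ^ (-p) := by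
        rw [abs_mul, abs_of_nonneg hc0, mul_assoc]
        gcongr
      have r1 : 0 ≤ r ^ (-2 : ℝ) := by positivity
      have r2 : 0 ≤ r ^ (-p) := by positivity
      have p1 : 0 ≤ ((C1 + c * a * C2) * M ^ 2 + c * n * M) * r ^ (-p) := by positivity
      have p2 : 0 ≤ c * K * r ^ (-2 : ℝ) := by positivity
      rw [abs_le] at t1 t2 t3 t4 ⊢
      constructor <;> linarith [t1.1, t1.2, t2.1, t2.2, t3.1, t3.2, t4.1, t4.2])
  refine ⟨l - c * 0, ?_⟩
  refine (hl.sub (hz.const_mul c)).congr (fun r => ?_)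
  ring

lemma decay (u u' y : ℝ → ℝ) (l k : ℝ) (hl : 0 < l) (hy : Tendsto y atTop (𝓝 l))
    (hupos : ∀ r, 0 < r → 0 < u r)
    (hu : ∀ r, 0 < r → HasDerivAt u (u' r) r)
    (hu' : ∀ᶠ r in atTop, u' r = - (y r) * u r) :
    ∃ D, 0 ≤ D ∧ ∀ᶠ r in atTop, u r ≤ D * r ^ (-k) := by
  have e1 : ∀ᶠ r : ℝ in atTop, k / r < l / 2 :=
    (tendsto_const_nhds.div_atTop tendsto_id).eventually_lt_const (by positivity)
  have e2 : ∀ᶠ r in atTop, l / 2 < y r := hy.eventually_const_lt (by linarith)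
  obtain ⟨R, hR⟩ := eventually_atTop.1 (e1.and (e2.and (hu'.and (eventually_gt_atTop 0))))
  have hR0 : 0 < R := (hR R le_rfl).2.2.2
  have A := anti_of (fun r => u r * r ^ k) (fun r => u' r * r ^ k + u r * (k * r ^ (k - 1))) R
    (fun r hr => (hu r (hR0.trans_le hr)).mul
      (Real.hasDerivAt_rpow_const (Or.inl (hR0.trans_le hr).ne')))
    (fun r hr => by
      obtain ⟨h1, h2, h3, h4⟩ := hR r hr
      rw [h3, Real.rpow_sub_one h4.ne']
      have : -y r * u r * r ^ k + u r * (k * (r ^ k / r)) = - (u r * r ^ k * (y r - k / r)) := by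
        ring
      rw [this]
      have := hupos r h4
      have h5 : 0 < r ^ k := by positivity
      have h6 : 0 < y r - k / r := by linarith
      have : 0 < u r * r ^ k * (y r - k / r) := by positivity
      linarith)
  refine ⟨u R * R ^ k, by have := hupos R hR0; positivity, ?_⟩
  filter_upwards [eventually_ge_atTop R] with r hr
  have h4 := hR0.trans_le hr
  have := A (self_mem_Ici) hr hr
  simp only at this
  rw [Real.rpow_neg h4.le, ← div_eq_mul_inv, le_div_iff₀ (by positivity)]
  exact this

lemma abs_flux (p x : ℝ) (hp : 1 < p) : |(|x| ^ (p - 2) * x)| = |x| ^ (p - 1) := by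
  rcases eq_or_ne x 0 with rfl | hx
  · simp [Real.zero_rpow (by linarith : p - 1 ≠ 0)]
  · have h : 0 < |x| := abs_pos.2 hx
    rw [abs_mul, abs_of_pos (Real.rpow_pos_of_pos h _)]
    rw [show p - 1 = (p - 2) + 1 by ring, Real.rpow_add_one h.ne']

lemma flux_mul (p x : ℝ) (hp : 1 < p) : |x| ^ (p - 2) * x * x = |x| ^ p := by
  rcases eq_or_ne x 0 with rfl | hx
  · simp [Real.zero_rpow (by linarith : p ≠ 0)]
  · have h : 0 < |x| := abs_pos.2 hx
    nth_rewrite 2 [show p = (p - 2) + 1 + 1 by ring]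
    rw [Real.rpow_add_one h.ne', Real.rpow_add_one h.ne', mul_assoc, mul_assoc, abs_mul_abs_self]

lemma v_abs (p x w : ℝ) (hp : 1 < p) (hw : 0 < w) :
    |-(|x| ^ (p - 2) * x) / w ^ (p - 1)| = (|x| / w) ^ (p - 1) := by
  rw [abs_div, abs_neg, abs_flux p x hp, abs_of_pos (Real.rpow_pos_of_pos hw _),
    Real.div_rpow (abs_nonneg x) hw.le]

lemma v_deriv (n p μ m : ℝ) (hp1 : 1 < p) (f u u' : ℝ → ℝ)
    (hu_pos : ∀ r : ℝ, 0 < r → 0 < u r)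
    (hu' : ∀ r : ℝ, 0 < r → HasDerivAt u (u' r) r)
    (hS : ∀ r : ℝ, 0 < r →
      HasDerivAt (fun s : ℝ => s ^ n * |u' s| ^ (p - 2) * u' s)
        (-(r ^ n * (μ / r ^ p * u r ^ (p - 1) - m * u r ^ (p - 1) + f (u r)))) r)
    (r : ℝ) (hr : 0 < r) :
    HasDerivAt (fun r => -(|u' r| ^ (p - 2) * u' r) / u r ^ (p - 1))
      ((p - 1) * |-(|u' r| ^ (p - 2) * u' r) / u r ^ (p - 1)| ^ (p / (p - 1))
        - n / r * (-(|u' r| ^ (p - 2) * u' r) / u r ^ (p - 1)) - m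
        + (μ / r ^ p + f (u r) / u r ^ (p - 1))) r := by
  have hu := hu_pos r hr
  have hT : 0 < r ^ n := Real.rpow_pos_of_pos hr n
  have hU : 0 < u r ^ (p - 1) := Real.rpow_pos_of_pos hu _
  have h1 := (hS r hr).div (Real.hasDerivAt_rpow_const (p := n) (Or.inl hr.ne')) hT.ne'
  have h2 : (fun s => |u' s| ^ (p - 2) * u' s) =ᶠ[𝓝 r]
      ((fun s => s ^ n * |u' s| ^ (p - 2) * u' s) / fun x => x ^ n) := by
    filter_upwards [lt_mem_nhds hr] with s hs
    have : 0 < s ^ n := Real.rpow_pos_of_pos hs n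
    simp only [Pi.div_apply]
    field_simp
  have h3 := (h1.congr_of_eventuallyEq h2).neg.div ((hu' r hr).rpow_const (p := p - 1) (Or.inl hu.ne')) hU.ne'
  refine h3.congr_deriv ?_
  have e : |-(|u' r| ^ (p - 2) * u' r) / u r ^ (p - 1)| ^ (p / (p - 1))
      = (|u' r| ^ (p - 2) * u' r) * u' r / (u r ^ (p - 1) * u r) := by
    rw [v_abs p _ _ hp1 hu, ← Real.rpow_mul (by positivity), flux_mul p _ hp1,
      mul_div_cancel₀ _ (by linarith : p - 1 ≠ 0), Real.div_rpow (abs_nonneg _) hu.le,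
      ← Real.rpow_add_one hu.ne', sub_add_cancel]
  rw [e, Real.rpow_sub_one hr.ne', Real.rpow_sub_one hu.ne' (p - 1)]
  have hrp : 0 < r ^ p := by positivity
  simp only [Pi.neg_apply]
  clear e h3 h1 h2
  generalize |u' r| ^ (p - 2) = W
  generalize u r ^ (p - 1) = U at *
  field_simp
  ring

lemma v_u (p x w v : ℝ) (hp : 1 < p) (hw : 0 < w)
    (hv : v = -(|x| ^ (p - 2) * x) / w ^ (p - 1)) (h : 0 < v) :
    x = - (v ^ (1 / (p - 1))) * w := by
  have hU : 0 < w ^ (p - 1) := Real.rpow_pos_of_pos hw _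
  have hx : x < 0 := by
    by_contra hx
    push Not at hx
    have : v ≤ 0 := by
      rw [hv]
      apply div_nonpos_of_nonpos_of_nonneg _ hU.le
      have : 0 ≤ |x| ^ (p - 2) * x := by positivity
      linarith
    linarith
  have h1 := v_abs p x w hp hw
  rw [← hv, abs_of_pos h, abs_of_neg hx] at h1
  have h0 : 0 ≤ -x / w := div_nonneg (by linarith) hw.le
  rw [h1, ← Real.rpow_mul h0, mul_one_div_cancel (by linarith), Real.rpow_one]
  field_simp

lemma v_u_neg (p x w v : ℝ) (hw : 0 < w)
    (hv : v = -(|x| ^ (p - 2) * x) / w ^ (p - 1)) (h : v ≤ 0) : 0 ≤ x := by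
  by_contra hx
  push Not at hx
  have hU : 0 < w ^ (p - 1) := Real.rpow_pos_of_pos hw _
  have h2 : 0 < |x| ^ (p - 2) := Real.rpow_pos_of_pos (abs_pos.2 hx.ne) _
  have : 0 < v := by
    rw [hv]; apply div_pos _ hU
    nlinarith
  linarith

theorem stmt_1
    (N : ℕ) (hN : 2 ≤ N) (p μ m : ℝ)
    (hp1 : 1 < p) (hpN : p < N)
    (hμ0 : 0 ≤ μ) (hμ : μ < (((N : ℝ) - p) / p) ^ p)
    (hm : 0 < m)
    (f : ℝ → ℝ) (hf : Continuous f)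
    (hF : ∃ A > (0:ℝ), ∃ q > p, ∃ t₀ > (0:ℝ),
      (∀ t : ℝ, |t| ≤ t₀ → |f t| ≤ A * |t| ^ (q - 1)) ∧
      (∀ t : ℝ, t₀ ≤ |t| → |f t| ≤ A * |t| ^ ((N : ℝ) * p / ((N : ℝ) - p) - 1)))
    (u u' : ℝ → ℝ)
    (hu_pos : ∀ r : ℝ, 0 < r → 0 < u r)
    (hu' : ∀ r : ℝ, 0 < r → HasDerivAt u (u' r) r)
    (hS : ∀ r : ℝ, 0 < r →
      HasDerivAt (fun s : ℝ => s ^ ((N : ℝ) - 1) * |u' s| ^ (p - 2) * u' s)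
        (-(r ^ ((N : ℝ) - 1) *
          (μ / r ^ p * u r ^ (p - 1) - m * u r ^ (p - 1) + f (u r)))) r)
    (hu0 : Tendsto u atTop (𝓝 0)) :
    ∃ C : ℝ, 0 < C ∧
      Tendsto (fun r : ℝ =>
        u r * r ^ (((N : ℝ) - 1) / (p * (p - 1))) *
          Real.exp ((m / (p - 1)) ^ ((1 : ℝ) / p) * r)) atTop (𝓝 C) := by
  obtain ⟨A, hA, q, hq, t₀, ht₀, hf1, -⟩ := hF
  have ha : 0 < p - 1 := by linarith
  have hn : (0:ℝ) ≤ (N : ℝ) - 1 := by linarith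
  have hP : 1 < p / (p - 1) := by rw [one_lt_div ha]; linarith
  have hqp : 0 < q - p := by linarith
  obtain ⟨v, hv⟩ : ∃ v : ℝ → ℝ, v = fun r => -(|u' r| ^ (p - 2) * u' r) / u r ^ (p - 1) := ⟨_, rfl⟩
  obtain ⟨ε, hε⟩ : ∃ ε : ℝ → ℝ, ε = fun r => μ / r ^ p + f (u r) / u r ^ (p - 1) := ⟨_, rfl⟩
  have hd : ∀ r, 0 < r → HasDerivAt v
      ((p - 1) * |v r| ^ (p / (p - 1)) - ((N : ℝ) - 1) / r * v r - m + ε r) r := by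
    intro r hr
    rw [hv, hε]
    exact v_deriv _ p μ m hp1 f u u' hu_pos hu' hS r hr
  have hv1 : ∀ r, 0 < r → 0 < v r → u' r = - (v r ^ (1 / (p - 1))) * u r := fun r hr h =>
    v_u p _ _ _ hp1 (hu_pos r hr) (by rw [hv]) h
  have hv2 : ∀ r, 0 < r → v r ≤ 0 → 0 ≤ u' r := fun r hr h =>
    v_u_neg p _ _ _ (hu_pos r hr) (by rw [hv]) h
  have hεb : ∀ᶠ r in atTop, |ε r| ≤ μ * r ^ (-p) + A * u r ^ (q - p) := by
    filter_upwards [eventually_gt_atTop 0, hu0.eventually_lt_const ht₀] with r hr hut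
    have hu := hu_pos r hr
    have h1 := hf1 (u r) (by rw [abs_of_pos hu]; exact hut.le)
    rw [abs_of_pos hu] at h1
    have hU : 0 < u r ^ (p - 1) := Real.rpow_pos_of_pos hu _
    have h2 : |f (u r) / u r ^ (p - 1)| ≤ A * u r ^ (q - p) := by
      rw [abs_div, abs_of_pos hU, div_le_iff₀ hU, mul_assoc, ← Real.rpow_add hu]
      rw [show q - p + (p - 1) = q - 1 by ring]
      exact h1
    have h3 : |μ / r ^ p| = μ * r ^ (-p) := by
      rw [abs_of_nonneg (by positivity), Real.rpow_neg hr.le, div_eq_mul_inv]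
    rw [hε]
    exact (abs_add_le _ _).trans (by rw [h3]; linarith)
  have hε0 : Tendsto ε atTop (𝓝 0) := by
    refine squeeze_zero_norm' (a := fun r => μ * r ^ (-p) + A * u r ^ (q - p)) hεb ?_
    have h1 := (tendsto_rpow_neg_atTop (by linarith : 0 < p)).const_mul μ
    have h2 := (hu0.rpow_const (p := q - p) (Or.inr hqp.le)).const_mul A
    rw [Real.zero_rpow hqp.ne'] at h2
    simpa using h1.add h2
  obtain ⟨v0, hv0⟩ : ∃ v0, v0 = (m / (p - 1)) ^ ((p - 1) / p) := ⟨_, rfl⟩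
  have hma : 0 < m / (p - 1) := by positivity
  have hv0p : 0 < v0 := by rw [hv0]; positivity
  have hv0m : (p - 1) * v0 ^ (p / (p - 1)) = m := by
    rw [hv0, ← Real.rpow_mul hma.le, show (p - 1) / p * (p / (p - 1)) = 1 by field_simp,
      Real.rpow_one]
    field_simp
  have hlam : v0 ^ (1 / (p - 1)) = (m / (p - 1)) ^ ((1 : ℝ) / p) := by
    rw [hv0, ← Real.rpow_mul hma.le]
    congr 1
    field_simp
  have hvt : Tendsto v atTop (𝓝 v0) := by
    refine riccati (p - 1) (p / (p - 1)) m ((N : ℝ) - 1) ha hP hm hn v ε v0 hv0p hv0m hε0 hd ?_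
    intro r1 hr1 hall
    have A1 := anti_of (fun r => - u r) (fun r => - u' r) r1
      (fun r hr => (hu' r (hr1.trans_le hr)).neg) (fun r hr => by
        have := hv2 r (hr1.trans_le hr) (hall r hr)
        linarith)
    have := ge_of_tendsto hu0 (eventually_atTop.2 ⟨r1, fun r hr => by
      have := A1 self_mem_Ici hr hr
      simpa using this⟩)
    have := hu_pos r1 hr1
    linarith
  have hyt : Tendsto (fun r => v r ^ (1 / (p - 1))) atTop (𝓝 (v0 ^ (1 / (p - 1)))) :=
    hvt.rpow_const (Or.inl hv0p.ne')
  obtain ⟨D, hD, hdec⟩ := decay u u' (fun r => v r ^ (1 / (p - 1))) _ (p / (q - p))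
    (by positivity) hyt hu_pos hu' (by
      filter_upwards [eventually_gt_atTop 0, hvt.eventually_const_lt hv0p] with r hr hvr
      exact hv1 r hr hvr)
  have hε2 : ∀ᶠ r in atTop, |ε r| ≤ (μ + A * D ^ (q - p)) * r ^ (-p) := by
    filter_upwards [hεb, hdec, eventually_gt_atTop 0] with r h1 h2 hr
    have h3 : u r ^ (q - p) ≤ D ^ (q - p) * r ^ (-p) := by
      calc u r ^ (q - p) ≤ (D * r ^ (-(p / (q - p)))) ^ (q - p) :=
            Real.rpow_le_rpow (hu_pos r hr).le h2 hqp.le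
        _ = _ := by
            rw [Real.mul_rpow hD (by positivity), ← Real.rpow_mul hr.le]
            congr 2
            field_simp
    nlinarith
  obtain ⟨l, hl⟩ := asymp (p - 1) (p / (p - 1)) m ((N : ℝ) - 1) (1 / (p - 1)) p
    (μ + A * D ^ (q - p)) ha hP hn (by positivity) hp1 (by positivity) v ε u u' v0 hv0p hv0m hε2 hd
    hvt hu_pos hu' hv1 (((N : ℝ) - 1) / (p * (p - 1))) (by
      rw [Real.rpow_sub_one hv0p.ne' (1 / (p - 1)),
        show p / (p - 1) - 1 = 1 / (p - 1) by field_simp; ring]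
      field_simp)
  refine ⟨Real.exp l, Real.exp_pos l, ?_⟩
  refine ((Real.continuous_exp.tendsto l).comp hl).congr' ?_
  filter_upwards [eventually_gt_atTop 0] with r hr
  rw [Function.comp_apply, Real.exp_add, Real.exp_add, Real.exp_log (hu_pos r hr), hlam,
    Real.rpow_def_of_pos hr, mul_comm (Real.log r)]
  ring
end

section
/- Let N ≥ 2 be an integer and let p, μ, m be real numbers with 1 < p < N, 0 ≤ μ < μ̄ := ((N−p)/p)^p and m > 0. Let f : ℝ → ℝ be continuous and satisfy (F0). Let u : (0,∞) → ℝ be a radial profile solution of the equation (hypothesis (S)) such that u(r) → 0 as r → ∞. Let k be the integer with k ≤ p < k+1. Then u'(r) < 0 for all sufficiently large r, and there exist real numbers c₀, c₁, …, c_k with c₀ = (m/(p−1))^{(p−1)/p} and c₁ = ((N−1)/p)·(m/(p−1))^{(p−2)/p}, satisfying for each i = 2, …, k the recursion (N−i)·c_{i−1} − p·(m/(p−1))^{1/p}·c_i = Σ_{n=2}^{i} (F^{(n)}(0)/n!) · Σ_{j₁+⋯+j_n = i, j₁,…,j_n > 0} c_{j₁}·c_{j₂}⋯c_{j_n} (where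 F(t) = (p−1)(c₀+t)^{p/(p−1)} and F^{(n)}(0) is its n-th derivative at 0), such that the function r ↦ (−u'(r)/u(r))^{p−1} − Σ_{i=0}^{k} c_i·r^{−i} + ((p−1)/m)^{1/p}·μ/(p·r^p) is O(r^{−(k+1)}) as r → ∞. -/
open Filter Topology Set Asymptotics

/-- fencing from below by a constant -/
lemma fence_const {z z' : ℝ → ℝ} {a L : ℝ} (hz : ∀ r, a ≤ r → HasDerivAt z (z' r) r)
    (ha : L ≤ z a) (hb : ∀ r, a ≤ r → z r = L → 0 < z' r) : ∀ r, a ≤ r → L ≤ z r := by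
  intro r hr
  have := image_le_of_deriv_right_lt_deriv_boundary' (f := fun x => - z x) (f' := fun x => - z' x)
    (a := a) (b := r) (B := fun _ => -L) (B' := fun _ => 0)
    (fun x hx => (hz x hx.1).neg.continuousAt.continuousWithinAt)
    (fun x hx => (hz x hx.1).neg.hasDerivWithinAt) (by simpa using ha)
    continuousOn_const (fun x _ => hasDerivWithinAt_const _ _ _)
    (fun x hx h => by
      have := hb x hx.1 (by linarith)
      linarith) (right_mem_Icc.2 hr)
  simpa using this

lemma barrier {z z' g : ℝ → ℝ} {R : ℝ} (hz : ∀ r, R ≤ r → HasDerivAt z (z' r) r)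
    (h0 : Tendsto z atTop (𝓝 0)) (hg : AntitoneOn g (Ici R)) (hgpos : ∀ r, R ≤ r → 0 < g r)
    (hb : ∀ r, R ≤ r → g r ≤ z r → 0 < z' r) : ∀ r, R ≤ r → z r ≤ g r := by
  intro r1 hr1
  by_contra hcon
  push Not at hcon
  have h1 : ∀ r, r1 ≤ r → z r1 ≤ z r := by
    apply fence_const (z' := z') (fun r hr => hz r (hr1.trans hr)) le_rfl
    intro r hr h
    apply hb r (hr1.trans hr)
    have := hg (mem_Ici.2 hr1) (mem_Ici.2 (hr1.trans hr)) hr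
    linarith
  have h2 : z r1 ≤ 0 := ge_of_tendsto h0 (by
    filter_upwards [eventually_ge_atTop r1] with r hr using h1 r hr)
  have := hgpos r1 hr1
  linarith

/-- linear growth from derivative bound -/
lemma growth {z z' : ℝ → ℝ} {a δ : ℝ} (hz : ∀ r, a ≤ r → HasDerivAt z (z' r) r)
    (hb : ∀ r, a ≤ r → δ ≤ z' r) : ∀ r, a ≤ r → δ * (r - a) ≤ z r - z a := by
  intro r hr
  refine (convex_Ici a).mul_sub_le_image_sub_of_le_deriv (f := z) ?_ ?_ ?_ a self_mem_Ici r hr hr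
  · exact fun x hx => (hz x hx).continuousAt.continuousWithinAt
  · intro x hx
    rw [interior_Ici] at hx
    exact (hz x (le_of_lt hx)).differentiableAt.differentiableWithinAt
  · intro x hx
    rw [interior_Ici] at hx
    rw [(hz x (le_of_lt hx)).deriv]
    exact hb x (le_of_lt hx)

lemma growth_contra {z z' : ℝ → ℝ} {a δ M : ℝ} (hδ : 0 < δ)
    (hz : ∀ r, a ≤ r → HasDerivAt z (z' r) r)
    (hb : ∀ r, a ≤ r → δ ≤ z' r) (hM : ∀ r, a ≤ r → z r ≤ M) : False := by
  have h0 := hM a le_rfl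
  have hr : a ≤ a + (M - z a + 1) / δ := by
    have : 0 ≤ (M - z a + 1) / δ := div_nonneg (by linarith) hδ.le
    linarith
  have h1 := growth hz hb _ hr
  have h2 := hM _ hr
  have h3 : δ * (a + (M - z a + 1) / δ - a) = M - z a + 1 := by
    field_simp
    ring
  linarith

lemma rpow_diff {s v w : ℝ} (hs : 1 ≤ s) (hv : 0 < v) (hvw : v ≤ w) :
    s * v ^ (s - 1) * (w - v) ≤ w ^ s - v ^ s := by
  have hw : 0 < w := hv.trans_le hvw
  have h := one_add_mul_self_le_rpow_one_add (s := w / v - 1)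
    (by have : 0 < w / v := by positivity
        linarith) hs
  have e : 1 + (w / v - 1) = w / v := by ring
  rw [e, Real.div_rpow hw.le hv.le, le_div_iff₀ (by positivity)] at h
  have e2 : v ^ (s - 1) = v ^ s / v := by rw [Real.rpow_sub hv, Real.rpow_one]
  rw [e2]
  have : s * (v ^ s / v) * (w - v) = (1 + s * (w / v - 1)) * v ^ s - v ^ s := by
    field_simp
    ring
  linarith

/-- convergence -/
lemma conv {W e : ℝ → ℝ} {R b κ s m c0 : ℝ} (hR : 0 < R) (hb : 0 ≤ b) (hκ : 0 < κ) (hs : 1 < s)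
    (hc0 : 0 < c0) (hm : κ * c0 ^ s = m)
    (hW : ∀ r, R ≤ r → 0 < W r)
    (hd : ∀ r, R ≤ r → HasDerivAt W (-(b / r) * W r + κ * (W r) ^ s - m + e r) r)
    (he : Tendsto e atTop (𝓝 0)) : Tendsto W atTop (𝓝 c0) := by
  have hbr : Tendsto (fun r : ℝ => b / r) atTop (𝓝 0) := tendsto_const_nhds.div_atTop tendsto_id
  rw [tendsto_order]
  constructor
  · intro a ha
    by_cases ha0 : a ≤ 0
    · filter_upwards [eventually_ge_atTop R] with r hr using ha0.trans_lt (hW r hr)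
    push Not at ha0
    have hlt : κ * a ^ s < m := by
      rw [← hm]
      exact mul_lt_mul_of_pos_left (Real.rpow_lt_rpow ha0.le ha (by linarith)) hκ
    set δ := (m - κ * a ^ s) / 2 with hδ
    have hδ0 : 0 < δ := by rw [hδ]; linarith
    obtain ⟨R1, hR1⟩ := eventually_atTop.1 (he.eventually (gt_mem_nhds hδ0))
    have hder : ∀ r, max R R1 ≤ r → W r ≤ a →
        -(b / r) * W r + κ * (W r) ^ s - m + e r ≤ -δ := by
      intro r hr hra
      have h1 := hR1 r ((le_max_right _ _).trans hr)
      have hrR := (le_max_left _ _).trans hr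
      have h2 := hW r hrR
      have h3 : W r ^ s ≤ a ^ s := Real.rpow_le_rpow h2.le hra (by linarith)
      have h4 : 0 ≤ b / r * W r := by
        have : 0 < r := hR.trans_le hrR
        positivity
      have h5 := mul_le_mul_of_nonneg_left h3 hκ.le
      linarith
    filter_upwards [eventually_ge_atTop (max R R1)] with r1 hr1
    by_contra hcon
    push Not at hcon
    have hle : ∀ r, r1 ≤ r → -a ≤ -W r := by
      apply fence_const (z := fun r => - W r)
        (fun r hr => (hd r ((le_max_left _ _).trans (hr1.trans hr))).neg)
      · linarith
      · intro r hr h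
        have := hder r (hr1.trans hr) (by linarith)
        linarith
    refine growth_contra (z := fun r => - W r) (M := 0) hδ0
        (fun r hr => (hd r ((le_max_left _ _).trans (hr1.trans hr))).neg) ?_ ?_
    · intro r hr
      have := hder r (hr1.trans hr) (by linarith [hle r hr])
      linarith
    · intro r hr
      have := hW r ((le_max_left _ _).trans (hr1.trans hr))
      linarith
  · intro a ha
    have ha0 : 0 < a := hc0.trans ha
    have hq : κ * c0 ^ s / a ^ s < κ := by
      rw [div_lt_iff₀ (by positivity)]
      exact mul_lt_mul_of_pos_left (Real.rpow_lt_rpow hc0.le ha (by linarith)) hκ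
    set δ := (κ - κ * c0 ^ s / a ^ s) / 2 with hδ
    have hδ0 : 0 < δ := by rw [hδ]; linarith
    have hlim : Tendsto (fun r => b / r * a ^ (1 - s) + |e r| * (a ^ s)⁻¹) atTop (𝓝 0) := by
      have h1 := (hbr.mul_const (a ^ (1 - s))).add (he.abs.mul_const ((a ^ s)⁻¹))
      simpa using h1
    obtain ⟨R1, hR1⟩ := eventually_atTop.1 (hlim.eventually (gt_mem_nhds hδ0))
    have hder : ∀ r, max R R1 ≤ r → a ≤ W r →
        δ * W r ^ s ≤ -(b / r) * W r + κ * (W r) ^ s - m + e r := by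
      intro r hr hra
      have h1 := hR1 r ((le_max_right _ _).trans hr)
      have hrR := (le_max_left _ _).trans hr
      have hr0 : 0 < r := hR.trans_le hrR
      have h2 := hW r hrR
      have hWs : 0 < W r ^ s := by positivity
      have h3 : a ^ s ≤ W r ^ s := Real.rpow_le_rpow ha0.le hra (by linarith)
      have h4 : W r ≤ W r ^ s * a ^ (1 - s) := by
        have : W r ^ (1 - s) ≤ a ^ (1 - s) :=
          Real.rpow_le_rpow_of_nonpos ha0 hra (by linarith)
        calc W r = W r ^ s * W r ^ (1 - s) := by
              rw [← Real.rpow_add h2]; simp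
          _ ≤ _ := mul_le_mul_of_nonneg_left this hWs.le
      have h5 : 1 ≤ W r ^ s * (a ^ s)⁻¹ := by
        rw [← div_eq_mul_inv, le_div_iff₀ (by positivity)]; linarith
      have h6 : b / r * W r ≤ b / r * (W r ^ s * a ^ (1 - s)) :=
        mul_le_mul_of_nonneg_left h4 (by positivity)
      have h7 : |e r| ≤ |e r| * (W r ^ s * (a ^ s)⁻¹) :=
        le_mul_of_one_le_right (abs_nonneg _) h5
      have h8 : m ≤ m * (W r ^ s * (a ^ s)⁻¹) :=
        le_mul_of_one_le_right (by rw [← hm]; positivity) h5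
      have h9 := mul_le_mul_of_nonneg_left h1.le hWs.le
      have h10 := neg_abs_le (e r)
      have h11 : m * (W r ^ s * (a ^ s)⁻¹) = (κ - 2 * δ) * W r ^ s := by
        rw [hδ, ← hm]; ring
      nlinarith
    filter_upwards [eventually_ge_atTop (max R R1)] with r1 hr1
    by_contra hcon
    push Not at hcon
    have hle : ∀ r, r1 ≤ r → a ≤ W r := by
      apply fence_const 
        (fun r hr => (hd r ((le_max_left _ _).trans (hr1.trans hr))))
      · linarith
      · intro r hr h
        have := hder r (hr1.trans hr) (by linarith)
        refine lt_of_lt_of_le ?_ this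
        rw [h]; positivity
    refine growth_contra (z := fun r => - (W r) ^ (1 - s)) (M := 0) (δ := (s - 1) * δ)
        (mul_pos (by linarith) hδ0)
        (fun r hr => ((hd r ((le_max_left _ _).trans (hr1.trans hr))).rpow_const
          (p := 1 - s) (Or.inl (hW r ((le_max_left _ _).trans (hr1.trans hr))).ne')).neg) ?_ ?_
    · intro r hr
      have h2 := hW r ((le_max_left _ _).trans (hr1.trans hr))
      have := hder r (hr1.trans hr) (by linarith [hle r hr])
      have e1 : W r ^ (1 - s - 1) = (W r ^ s)⁻¹ := by
        rw [← Real.rpow_neg h2.le]; congr 1; ring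
      rw [e1]
      have h3 : δ ≤ (-(b / r) * W r + κ * (W r) ^ s - m + e r) * (W r ^ s)⁻¹ := by
        rw [← div_eq_mul_inv, le_div_iff₀ (by positivity)]; exact this
      nlinarith
    · intro r hr
      have := hW r ((le_max_left _ _).trans (hr1.trans hr))
      simp only [Left.neg_nonpos_iff]
      positivity

lemma f_bound {p A q t₀ : ℝ} {f u : ℝ → ℝ} (ht₀ : 0 < t₀)
    (hF : ∀ t : ℝ, |t| ≤ t₀ → |f t| ≤ A * |t| ^ (q - 1))
    (hu_pos : ∀ r : ℝ, 0 < r → 0 < u r) (hu0 : Tendsto u atTop (𝓝 0)) :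
    ∀ᶠ r in atTop, |f (u r) / u r ^ (p - 1)| ≤ A * u r ^ (q - p) := by
  filter_upwards [eventually_gt_atTop 0, hu0.eventually (gt_mem_nhds ht₀)] with r hr h
  have h0 := hu_pos r hr
  have h1 := hF (u r) (by rw [abs_of_pos h0]; exact h.le)
  rw [abs_of_pos h0] at h1
  rw [abs_div, abs_of_pos (show 0 < u r ^ (p - 1) by positivity), div_le_iff₀ (by positivity),
    mul_assoc, ← Real.rpow_add h0]
  have e : q - p + (p - 1) = q - 1 := by ring
  rw [e]; exact h1

lemma e_tendsto {p μ A q t₀ : ℝ} {f u : ℝ → ℝ} (hp1 : 1 < p) (hq : p < q) (ht₀ : 0 < t₀)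
    (hF : ∀ t : ℝ, |t| ≤ t₀ → |f t| ≤ A * |t| ^ (q - 1))
    (hu_pos : ∀ r : ℝ, 0 < r → 0 < u r) (hu0 : Tendsto u atTop (𝓝 0)) :
    Tendsto (fun r => μ / r ^ p + f (u r) / u r ^ (p - 1)) atTop (𝓝 0) := by
  have h1 : Tendsto (fun r : ℝ => μ / r ^ p) atTop (𝓝 0) :=
    tendsto_const_nhds.div_atTop (tendsto_rpow_atTop (by linarith))
  have h2 : Tendsto (fun r : ℝ => A * u r ^ (q - p)) atTop (𝓝 0) := by
    have := (hu0.rpow_const (p := q - p) (Or.inr (by linarith))).const_mul A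
    rwa [Real.zero_rpow (by linarith), mul_zero] at this
  have h3 : Tendsto (fun r => f (u r) / u r ^ (p - 1)) atTop (𝓝 0) :=
    squeeze_zero_norm' (f_bound ht₀ hF hu_pos hu0) h2
  simpa using h1.add h3

lemma u'_neg {n p μ m : ℝ} {f u u' : ℝ → ℝ} (hm : 0 < m)
    (hu_pos : ∀ r : ℝ, 0 < r → 0 < u r)
    (hu' : ∀ r : ℝ, 0 < r → HasDerivAt u (u' r) r)
    (hS : ∀ r : ℝ, 0 < r →
      HasDerivAt (fun s : ℝ => s ^ n * |u' s| ^ (p - 2) * u' s)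
        (-(r ^ n *
          (μ / r ^ p * u r ^ (p - 1) - m * u r ^ (p - 1) + f (u r)))) r)
    (hu0 : Tendsto u atTop (𝓝 0))
    (he : Tendsto (fun r => μ / r ^ p + f (u r) / u r ^ (p - 1)) atTop (𝓝 0)) :
    ∃ R > 0, ∀ r, R ≤ r → u' r < 0 := by
  obtain ⟨R1, hR1⟩ := eventually_atTop.1 (he.eventually (gt_mem_nhds hm))
  refine ⟨max R1 1, by positivity, fun r1 hr1 => ?_⟩
  have hpos : ∀ r, r1 ≤ r → 0 < r := fun r hr => by
    have := (le_max_right R1 1).trans (hr1.trans hr)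
    linarith
  have hder : ∀ r, r1 ≤ r → 0 < (-(r ^ n *
          (μ / r ^ p * u r ^ (p - 1) - m * u r ^ (p - 1) + f (u r)))) := by
    intro r hr
    have hr0 := hpos r hr
    have h1 := hR1 r ((le_max_left _ _).trans (hr1.trans hr))
    have h0 := hu_pos r hr0
    have hu : 0 < u r ^ (p - 1) := by positivity
    have h2 : μ / r ^ p * u r ^ (p - 1) - m * u r ^ (p - 1) + f (u r)
      = ((μ / r ^ p + f (u r) / u r ^ (p - 1)) - m) * u r ^ (p - 1) := by
      field_simp
      ring
    rw [h2, ← mul_neg, ← neg_mul]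
    have : 0 < r ^ n := by positivity
    have : 0 < -((μ / r ^ p + f (u r) / u r ^ (p - 1)) - m) := by linarith
    positivity
  by_contra hcon
  push Not at hcon
  have hψ : ∀ r, r1 ≤ r → 0 ≤ r ^ n * |u' r| ^ (p - 2) * u' r := by
    apply fence_const (fun r hr => hS r (hpos r hr))
    · have := hpos r1 le_rfl
      positivity
    · intro r hr _
      exact hder r hr
  have hu'0 : ∀ r, r1 ≤ r → 0 ≤ u' r := by
    intro r hr
    by_contra hc
    push Not at hc
    have h1 := hψ r hr
    have h2 : 0 < r ^ n * |u' r| ^ (p - 2) := by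
      have := hpos r hr
      have : 0 < |u' r| := abs_pos.2 hc.ne
      positivity
    have := mul_neg_of_pos_of_neg h2 hc
    linarith
  have h3 : ∀ r, r1 ≤ r → u r1 ≤ u r := by
    intro r hr
    have := growth (fun r hr => hu' r (hpos r hr)) hu'0 r hr
    linarith
  have h4 : u r1 ≤ 0 := ge_of_tendsto hu0 (by
    filter_upwards [eventually_ge_atTop r1] with r hr using h3 r hr)
  have := hu_pos r1 (hpos r1 le_rfl)
  linarith

lemma ode {n p μ m R : ℝ} {f u u' : ℝ → ℝ} (hp1 : 1 < p) (hR : 0 < R)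
    (hu_pos : ∀ r : ℝ, 0 < r → 0 < u r)
    (hu' : ∀ r : ℝ, 0 < r → HasDerivAt u (u' r) r)
    (hS : ∀ r : ℝ, 0 < r →
      HasDerivAt (fun s : ℝ => s ^ n * |u' s| ^ (p - 2) * u' s)
        (-(r ^ n *
          (μ / r ^ p * u r ^ (p - 1) - m * u r ^ (p - 1) + f (u r)))) r)
    (hneg : ∀ r, R ≤ r → u' r < 0) (r : ℝ) (hr : R < r) :
    HasDerivAt (fun r => (-u' r / u r) ^ (p - 1))
      (-(n / r) * (-u' r / u r) ^ (p - 1) + (p - 1) * ((-u' r / u r) ^ (p - 1)) ^ (p / (p - 1))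
        - m + (μ / r ^ p + f (u r) / u r ^ (p - 1))) r := by
  have hr0 : 0 < r := hR.trans hr
  have key : ∀ s, R < s → (-u' s / u s) ^ (p - 1) =
      -(s ^ n * |u' s| ^ (p - 2) * u' s) / (s ^ n * u s ^ (p - 1)) := by
    intro s hs
    have hs0 : 0 < s := hR.trans hs
    have h1 : 0 < - u' s := by linarith [hneg s hs.le]
    have h2 := hu_pos s hs0
    rw [Real.div_rpow h1.le h2.le, abs_of_neg (hneg s hs.le)]
    have : (-u' s) ^ (p - 1) = (-u' s) ^ (p - 2) * (-u' s) := by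
      rw [← Real.rpow_add_one h1.ne']; congr 1; ring
    rw [this]
    have : 0 < s ^ n := by positivity
    have : 0 < u s ^ (p - 1) := by positivity
    field_simp
  have h2 := hu_pos r hr0
  have h1 : 0 < - u' r := by linarith [hneg r hr.le]
  have hrn : 0 < r ^ n := by positivity
  have hup : 0 < u r ^ (p - 1) := by positivity
  have hden := (Real.hasDerivAt_rpow_const (x := r) (p := n) (Or.inl hr0.ne')).mul
    ((hu' r hr0).rpow_const (p := p - 1) (Or.inl h2.ne'))
  have hd := (hS r hr0).neg.div hden (mul_pos hrn hup).ne'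
  have hev : (fun r => (-u' r / u r) ^ (p - 1)) =ᶠ[𝓝 r]
      fun s => -(s ^ n * |u' s| ^ (p - 2) * u' s) / (s ^ n * u s ^ (p - 1)) := by
    filter_upwards [lt_mem_nhds hr] with s hs using key s hs
  refine (hd.congr_of_eventuallyEq hev).congr_deriv ?_
  set y := -u' r / u r with hy
  have hy0 : 0 < y := by positivity
  have hu'y : u' r = - (y * u r) := by rw [hy]; field_simp
  have k1 := key r hr
  rw [eq_div_iff (by positivity)] at k1
  have e1 : (y ^ (p - 1)) ^ (p / (p - 1)) = y ^ (p - 1) * y := by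
    rw [← Real.rpow_mul hy0.le, ← Real.rpow_add_one hy0.ne']
    congr 1
    have : p - 1 ≠ 0 := by linarith
    field_simp; ring
  have e2 : u r ^ (p - 1 - 1) = u r ^ (p - 1) / u r := by
    rw [Real.rpow_sub h2 (p-1), Real.rpow_one]
  have e3 : r ^ (n - 1) = r ^ n / r := by
    rw [Real.rpow_sub hr0 n, Real.rpow_one]
  simp only [Pi.mul_apply, Pi.neg_apply]
  rw [e1, e2, e3, ← k1, hu'y]
  have : r ^ p ≠ 0 := by positivity
  field_simp
  ring

lemma final {w v v' e : ℝ → ℝ} {R b κ s m c0 : ℝ} (K : ℕ) (hκ : 0 < κ)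
    (hs : 1 < s) (hc0 : 0 < c0)
    (hw : ∀ r, R ≤ r → HasDerivAt w (-(b / r) * w r + κ * (w r) ^ s - m + e r) r)
    (hv : ∀ r, R ≤ r → HasDerivAt v (v' r) r)
    (hwl : Tendsto w atTop (𝓝 c0)) (hvl : Tendsto v atTop (𝓝 c0))
    (hρ : (fun r => e r - (v' r + (b / r) * v r - κ * (v r) ^ s + m)) =O[atTop]
      fun r : ℝ => (r⁻¹) ^ K) :
    (fun r => w r - v r) =O[atTop] fun r : ℝ => (r⁻¹) ^ K := by
  obtain ⟨C, hC, hCb⟩ := hρ.exists_pos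
  have hbr : Tendsto (fun r : ℝ => b / r) atTop (𝓝 0) := tendsto_const_nhds.div_atTop tendsto_id
  set α := κ * (s * (c0 / 2) ^ (s - 1)) with hα
  have hα0 : 0 < α := by
    have : 0 < s := by linarith
    positivity
  have hev := (((hwl.eventually (lt_mem_nhds (half_lt_self hc0))).and
    (hvl.eventually (lt_mem_nhds (half_lt_self hc0)))).and
    (hbr.eventually (gt_mem_nhds (half_pos hα0)))).and
    ((hCb.bound).and (eventually_ge_atTop (max R 1)))
  obtain ⟨R1, hR1⟩ := eventually_atTop.1 hev
  have hdiff : ∀ x y : ℝ, c0 / 2 < y → y ≤ x → α * (x - y) ≤ κ * x ^ s - κ * y ^ s := by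
    intro x y hy hxy
    have h1 := rpow_diff hs.le (by linarith) hxy
    have h2 : (c0 / 2) ^ (s - 1) ≤ y ^ (s - 1) :=
      Real.rpow_le_rpow (by positivity) hy.le (by linarith)
    have h3 : s * (c0 / 2) ^ (s - 1) * (x - y) ≤ s * y ^ (s - 1) * (x - y) := by
      apply mul_le_mul_of_nonneg_right _ (by linarith)
      exact mul_le_mul_of_nonneg_left h2 (by linarith)
    have h4 := mul_le_mul_of_nonneg_left (h3.trans h1) hκ.le
    rw [hα]; linarith
  set g : ℝ → ℝ := fun r => (4 * C / α) * (r⁻¹) ^ K with hg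
  have hRR : ∀ r, R1 ≤ r → R ≤ r ∧ 0 < r := fun r hr => by
    have := (hR1 r hr).2.2
    exact ⟨(le_max_left _ _).trans this, by linarith [(le_max_right R 1).trans this]⟩
  have hganti : AntitoneOn g (Ici R1) := by
    intro x hx y hy hxy
    have hx0 := (hRR x hx).2
    have hy0 := (hRR y hy).2
    have : y⁻¹ ≤ x⁻¹ := inv_anti₀ hx0 hxy
    simp only [hg]
    gcongr
  have hgpos : ∀ r, R1 ≤ r → 0 < g r := fun r hr => by
    have := (hRR r hr).2
    simp only [hg]; positivity
  have hge : ∀ r, R1 ≤ r → C * (r⁻¹) ^ K = α / 4 * g r := by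
    intro r hr
    simp only [hg]
    field_simp
  have hz : Tendsto (fun r => w r - v r) atTop (𝓝 0) := by simpa using hwl.sub hvl
  have hz2 : Tendsto (fun r => -(w r - v r)) atTop (𝓝 0) := by simpa using hz.neg
  have hub : ∀ r, R1 ≤ r →
      |e r - (v' r + (b / r) * v r - κ * (v r) ^ s + m)| ≤ α / 4 * g r := by
    intro r hr
    have h1 := (hR1 r hr).2.1
    have := (hRR r hr).2
    rw [Real.norm_eq_abs, Real.norm_eq_abs, abs_of_pos (show 0 < r⁻¹ ^ K by positivity),
      hge r hr] at h1
    exact h1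
  have hup := barrier (z := fun r => w r - v r)
    (fun r hr => (hw r (hRR r hr).1).sub (hv r (hRR r hr).1)) hz hganti hgpos (by
      intro r hr h
      have h1 := hub r hr
      have h2 := (abs_le.1 h1).1
      have h3 := hgpos r hr
      obtain ⟨⟨⟨hw1, hv1⟩, hb1⟩, _⟩ := hR1 r hr
      have h4 := hdiff (w r) (v r) hv1 (by linarith)
      have h5 : b / r * (w r - v r) ≤ α / 2 * (w r - v r) :=
        mul_le_mul_of_nonneg_right hb1.le (by linarith)
      have h6 := mul_le_mul_of_nonneg_left h hα0.le
      have h7 := mul_pos hα0 h3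
      nlinarith)
  have hlo := barrier (z := fun r => -(w r - v r))
    (fun r hr => ((hw r (hRR r hr).1).sub (hv r (hRR r hr).1)).neg) hz2 hganti hgpos (by
      intro r hr h
      have h1 := hub r hr
      have h2 := (abs_le.1 h1).2
      have h3 := hgpos r hr
      obtain ⟨⟨⟨hw1, hv1⟩, hb1⟩, _⟩ := hR1 r hr
      have h4 := hdiff (v r) (w r) hw1 (by linarith)
      have h5 : b / r * (v r - w r) ≤ α / 2 * (v r - w r) :=
        mul_le_mul_of_nonneg_right hb1.le (by linarith)
      have h6 := mul_le_mul_of_nonneg_left h hα0.le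
      have h7 := mul_pos hα0 h3
      nlinarith)
  refine IsBigO.of_bound (4 * C / α) ?_
  filter_upwards [eventually_ge_atTop R1] with r hr
  have := (hRR r hr).2
  rw [Real.norm_eq_abs, Real.norm_eq_abs, abs_of_pos (show 0 < r⁻¹ ^ K by positivity), abs_le]
  have h1 := hup r hr
  have h2 := hlo r hr
  simp only [hg] at h1 h2
  constructor <;> linarith

lemma f_decay {p A q t₀ c0 : ℝ} {f u u' : ℝ → ℝ} (K : ℕ) (hp1 : 1 < p) (hA : 0 < A)
    (hq : p < q) (ht₀ : 0 < t₀) (hc0 : 0 < c0)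
    (hF : ∀ t : ℝ, |t| ≤ t₀ → |f t| ≤ A * |t| ^ (q - 1))
    (hu_pos : ∀ r : ℝ, 0 < r → 0 < u r)
    (hu' : ∀ r : ℝ, 0 < r → HasDerivAt u (u' r) r)
    (hu0 : Tendsto u atTop (𝓝 0))
    (hneg : ∀ᶠ r in atTop, u' r < 0)
    (hW : Tendsto (fun r => (-u' r / u r) ^ (p - 1)) atTop (𝓝 c0)) :
    (fun r => f (u r) / u r ^ (p - 1)) =O[atTop] fun r : ℝ => (r⁻¹) ^ K := by
  set β := (c0 / 2) ^ (1 / (p - 1)) with hβ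
  have hβ0 : 0 < β := by positivity
  have hp0 : 0 < p - 1 := by linarith
  set M : ℝ := K / (q - p) with hM
  have hq0 : 0 < q - p := by linarith
  have hM0 : 0 ≤ M := by positivity
  have hev := (hneg.and (hW.eventually (lt_mem_nhds (half_lt_self hc0)))).and
    ((eventually_ge_atTop (max 1 (M / β))).and (f_bound (p := p) ht₀ hF hu_pos hu0))
  obtain ⟨R, hR⟩ := eventually_atTop.1 hev
  have hRR : ∀ r, R ≤ r → 0 < r ∧ M / β ≤ r := fun r hr => by
    have := (hR r hr).2.1
    exact ⟨by linarith [(le_max_left _ _).trans this], (le_max_right _ _).trans this⟩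
  have hder : ∀ r, R ≤ r → 0 ≤ -(u' r * r ^ M + u r * (M * r ^ (M - 1))) := by
    intro r hr
    obtain ⟨hr0, hrM⟩ := hRR r hr
    obtain ⟨⟨h1, h2⟩, _⟩ := hR r hr
    have hu := hu_pos r hr0
    have h3 : β ≤ -u' r / u r := by
      have hy : 0 ≤ -u' r / u r := div_nonneg (by linarith) hu.le
      have := Real.rpow_le_rpow (by positivity) h2.le (show 0 ≤ 1 / (p - 1) by positivity)
      rwa [← Real.rpow_mul hy, mul_one_div_cancel hp0.ne', Real.rpow_one] at this
    rw [le_div_iff₀ hu] at h3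
    rw [div_le_iff₀ hβ0] at hrM
    rw [Real.rpow_sub hr0, Real.rpow_one]
    have h4 : M / r ≤ β := by rw [div_le_iff₀ hr0]; linarith
    have h5 : 0 < r ^ M := by positivity
    have h6 : -(u' r * r ^ M + u r * (M * (r ^ M / r))) = r ^ M * (-u' r - M / r * u r) := by
      field_simp
      ring
    rw [h6]
    apply mul_nonneg h5.le
    nlinarith
  have hb : ∀ r, R ≤ r → u r * r ^ M ≤ u R * R ^ M := by
    intro r hr
    have := growth (z := fun r => -(u r * r ^ M))
      (fun r hr => ((hu' r (hRR r hr).1).mul (Real.hasDerivAt_rpow_const (p := M)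
        (Or.inl (hRR r hr).1.ne'))).neg) hder r hr
    simp only [zero_mul] at this
    linarith
  refine IsBigO.of_bound (A * (u R * R ^ M) ^ (q - p)) ?_
  filter_upwards [eventually_ge_atTop R] with r hr
  have hr0 := (hRR r hr).1
  have hu := hu_pos r hr0
  have h1 := (hR r hr).2.2
  have h2 := Real.rpow_le_rpow (by positivity) (hb r hr) hq0.le
  rw [Real.mul_rpow hu.le (by positivity), ← Real.rpow_mul hr0.le, hM,
    div_mul_cancel₀ _ hq0.ne', Real.rpow_natCast, ← hM] at h2
  rw [Real.norm_eq_abs, Real.norm_eq_abs, abs_of_pos (show 0 < r⁻¹ ^ K by positivity)]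
  refine h1.trans ?_
  rw [mul_assoc]
  refine mul_le_mul_of_nonneg_left ?_ hA.le
  rw [inv_pow, ← div_eq_mul_inv, le_div_iff₀ (by positivity)]
  exact h2

noncomputable def SS (c : ℕ → ℝ) (n i : ℕ) : ℝ :=
  ∑ j ∈ (Finset.Nat.antidiagonalTuple n i).filter (fun j => ∀ a, 0 < j a), ∏ a, c (j a)

noncomputable def recSeq (G : ℕ → (ℕ → ℝ) → ℝ) : ℕ → ℝ
  | i => G i (fun j => if _h : j < i then recSeq G j else 0)

lemma SS_zero (c : ℕ → ℝ) {n i : ℕ} (h : i < n) : SS c n i = 0 := by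
  unfold SS
  apply Finset.sum_eq_zero
  intro j hj
  rw [Finset.mem_filter, Finset.Nat.mem_antidiagonalTuple] at hj
  have : ∑ a : Fin n, 1 ≤ ∑ a, j a := Finset.sum_le_sum fun a _ => hj.2 a
  simp at this
  omega

lemma SS_congr {c d : ℕ → ℝ} {n i : ℕ} (hn : 2 ≤ n) (h : ∀ j < i, c j = d j) :
    SS c n i = SS d n i := by
  unfold SS
  apply Finset.sum_congr rfl
  intro j hj
  rw [Finset.mem_filter, Finset.Nat.mem_antidiagonalTuple] at hj
  apply Finset.prod_congr rfl
  intro a _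
  apply h
  have : Nontrivial (Fin n) := Fin.nontrivial_iff_two_le.2 hn
  obtain ⟨b, hb⟩ := exists_ne a
  have h1 := Finset.add_le_sum (f := j) (s := Finset.univ) (fun _ _ => Nat.zero_le _) (Finset.mem_univ a)
    (Finset.mem_univ b) hb.symm
  have h2 := hj.2 b
  omega

lemma exists_seq (N lam c0 c1 : ℝ) (hl : lam ≠ 0) (a : ℕ → ℝ) :
    ∃ c : ℕ → ℝ, c 0 = c0 ∧ c 1 = c1 ∧ ∀ i, 2 ≤ i →
      (N - i) * c (i - 1) - lam * c i = ∑ n ∈ Finset.Icc 2 i, a n * SS c n i := by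
  let G : ℕ → (ℕ → ℝ) → ℝ := fun i c => if i = 0 then c0 else if i = 1 then c1 else
    ((N - i) * c (i - 1) - ∑ n ∈ Finset.Icc 2 i, a n * SS c n i) / lam
  have hG : ∀ i, recSeq G i = G i (fun j => if _h : j < i then recSeq G j else 0) := by
    intro i
    rw [recSeq]
  refine ⟨recSeq G, ?_, ?_, ?_⟩
  · rw [hG]; simp [G]
  · rw [hG]; simp [G]
  · intro i hi
    have h1 := hG i
    have h0 : i ≠ 0 := by omega
    have h01 : i ≠ 1 := by omega
    simp only [G, h0, h01, if_false] at h1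
    rw [eq_div_iff hl, dif_pos (by omega)] at h1
    have h2 : ∑ n ∈ Finset.Icc 2 i, a n * SS (fun j => if _h : j < i then recSeq G j else 0) n i
      = ∑ n ∈ Finset.Icc 2 i, a n * SS (recSeq G) n i := by
      apply Finset.sum_congr rfl
      intro n hn
      rw [SS_congr (Finset.mem_Icc.1 hn).1]
      intro j hj
      simp [hj]
    rw [← h2]
    linarith

lemma x_pow_O {i k : ℕ} (h : k ≤ i) :
    (fun r : ℝ => r⁻¹ ^ i) =O[atTop] fun r : ℝ => r⁻¹ ^ k := by
  refine IsBigO.of_bound 1 ?_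
  filter_upwards [eventually_ge_atTop 1] with r hr
  have hr0 : 0 < r := by linarith
  rw [one_mul, Real.norm_eq_abs, Real.norm_eq_abs, abs_of_pos (by positivity),
    abs_of_pos (by positivity)]
  exact pow_le_pow_of_le_one (by positivity) (inv_le_one_of_one_le₀ hr) h

lemma pow_expand (c : ℕ → ℝ) (n k : ℕ) :
    (fun r : ℝ => (∑ i ∈ Finset.Icc 1 k, c i * r⁻¹ ^ i) ^ n
      - ∑ i ∈ Finset.range (k + 1), SS c n i * r⁻¹ ^ i) =O[atTop] fun r : ℝ => r⁻¹ ^ (k + 1) := by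
  have key : ∀ r : ℝ, (∑ i ∈ Finset.Icc 1 k, c i * r⁻¹ ^ i) ^ n
      - ∑ i ∈ Finset.range (k + 1), SS c n i * r⁻¹ ^ i =
      ∑ j ∈ (Fintype.piFinset fun _ : Fin n => Finset.Icc 1 k).filter (fun j => ¬ ∑ a, j a < k + 1),
        (∏ a, c (j a)) * r⁻¹ ^ (∑ a, j a) := by
    intro r
    rw [Finset.sum_pow', sub_eq_iff_eq_add]
    simp only [Finset.prod_mul_distrib, Finset.prod_pow_eq_pow_sum]
    rw [← Finset.sum_filter_add_sum_filter_not _ (fun j : Fin n → ℕ => ∑ a, j a < k + 1), add_comm]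
    congr 1
    rw [← Finset.sum_fiberwise_of_maps_to (g := fun j : Fin n → ℕ => ∑ a, j a)
      (t := Finset.range (k + 1)) (fun j hj => by
        rw [Finset.mem_filter] at hj
        exact Finset.mem_range.2 hj.2)]
    apply Finset.sum_congr rfl
    intro i hi
    rw [Finset.mem_range] at hi
    unfold SS
    rw [Finset.sum_mul]
    apply Finset.sum_congr_of_eq_on_inter
    · intro j hj hn
      exfalso; apply hn
      simp only [Finset.mem_filter, Fintype.mem_piFinset, Finset.mem_Icc] at hj
      rw [Finset.mem_filter, Finset.Nat.mem_antidiagonalTuple]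
      exact ⟨hj.2, fun a => (hj.1.1 a).1⟩
    · intro j hj hn
      exfalso; apply hn
      rw [Finset.mem_filter, Finset.Nat.mem_antidiagonalTuple] at hj
      simp only [Finset.mem_filter, Fintype.mem_piFinset, Finset.mem_Icc]
      refine ⟨⟨fun a => ⟨hj.2 a, ?_⟩, by omega⟩, hj.1⟩
      have := Finset.single_le_sum (f := j) (s := Finset.univ) (fun _ _ => Nat.zero_le _) (Finset.mem_univ a)
      omega
    · intro j hj _
      simp only [Finset.mem_filter] at hj
      rw [hj.2]
  simp only [key]
  apply IsBigO.fun_sum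
  intro j hj
  rw [Finset.mem_filter] at hj
  exact (x_pow_O (by omega)).const_mul_left _

lemma resid_bound {Φ : ℝ → ℝ} {a c : ℕ → ℝ} {k : ℕ} {N p d : ℝ} (hk1 : 1 ≤ k) (hkp : (k : ℝ) ≤ p)
    (hΦ : (fun y => Φ y - ∑ n ∈ Finset.range (k + 1), a n * y ^ n) =O[𝓝 0] fun y => y ^ (k + 1))
    (hrec : ∀ i, 1 ≤ i → i ≤ k →
      (N - i) * c (i - 1) - a 1 * c i = ∑ n ∈ Finset.Icc 2 i, a n * SS c n i) :
    (fun r : ℝ => ((∑ i ∈ Finset.range (k + 1), -(i : ℝ) * c i * r⁻¹ ^ (i + 1))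
        - p * (d * r ^ (-p)) * r⁻¹)
      + (N - 1) / r * ((∑ i ∈ Finset.range (k + 1), c i * r⁻¹ ^ i) + d * r ^ (-p))
      - Φ ((∑ i ∈ Finset.range (k + 1), c i * r⁻¹ ^ i) + d * r ^ (-p) - c 0) + a 0
      + a 1 * (d * r ^ (-p))) =O[atTop] fun r : ℝ => r⁻¹ ^ (k + 1) := by
  have hDk : (fun r : ℝ => d * r ^ (-p)) =O[atTop] fun r : ℝ => r⁻¹ ^ k := by
    apply IsBigO.const_mul_left
    refine IsBigO.of_bound 1 ?_
    filter_upwards [eventually_ge_atTop 1] with r hr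
    have hr0 : 0 < r := by linarith
    rw [one_mul, Real.norm_eq_abs, Real.norm_eq_abs, abs_of_pos (by positivity),
      abs_of_pos (by positivity), inv_pow, ← Real.rpow_natCast, ← Real.rpow_neg hr0.le]
    exact Real.rpow_le_rpow_of_exponent_le hr (by linarith)
  have hPx : (fun r : ℝ => ∑ i ∈ Finset.Icc 1 k, c i * r⁻¹ ^ i) =O[atTop] fun r : ℝ => r⁻¹ := by
    apply IsBigO.fun_sum
    intro i hi
    have := (x_pow_O (Finset.mem_Icc.1 hi).1).const_mul_left (c i)
    simpa using this
  have hDx : (fun r : ℝ => d * r ^ (-p)) =O[atTop] fun r : ℝ => r⁻¹ := by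
    have := hDk.trans (x_pow_O hk1)
    simpa using this
  have htx := hPx.add hDx
  have hx0 : Tendsto (fun r : ℝ => r⁻¹) atTop (𝓝 0) := tendsto_inv_atTop_zero
  have hx1 : (fun r : ℝ => r⁻¹) =O[atTop] fun _ => (1 : ℝ) := hx0.isBigO_one ℝ
  have ht0 := htx.trans_tendsto hx0
  set P : ℝ → ℝ := fun r => ∑ i ∈ Finset.Icc 1 k, c i * r⁻¹ ^ i with hP
  set D : ℝ → ℝ := fun r => d * r ^ (-p) with hD
  have hsplit : ∀ r : ℝ, ∑ i ∈ Finset.range (k + 1), c i * r⁻¹ ^ i = c 0 + P r := by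
    intro r
    rw [Finset.range_eq_Ico, Finset.sum_eq_sum_Ico_succ_bot (by omega)]
    simp [hP, Finset.Ico_add_one_right_eq_Icc]
  have hT1 : (fun r => Φ (P r + D r) - ∑ n ∈ Finset.range (k + 1), a n * (P r + D r) ^ n)
      =O[atTop] fun r : ℝ => r⁻¹ ^ (k + 1) :=
    (hΦ.comp_tendsto ht0).trans (htx.pow (k + 1))
  -- powers
  have hpw : ∀ n, (fun r => (P r + D r) ^ n - P r ^ n) =O[atTop] fun r : ℝ => r⁻¹ ^ k := by
    intro n
    induction n with
    | zero => simpa using isBigO_zero _ _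
    | succ n ih =>
      have h1 := (htx.trans hx1).mul ih
      have h2 := hDk.mul ((hPx.trans hx1).pow n)
      simp only [one_mul, one_pow, mul_one] at h1 h2
      refine (h1.add h2).congr_left fun r => ?_
      ring
  have hpw2 : ∀ n, 2 ≤ n →
      (fun r => (P r + D r) ^ n - P r ^ n) =O[atTop] fun r : ℝ => r⁻¹ ^ (k + 1) := by
    intro n hn
    obtain ⟨l, rfl⟩ : ∃ l, n = l + 1 + 1 := ⟨n - 2, by omega⟩
    have h1 := htx.mul (hpw (l + 1))
    have h2 := (hDk.mul ((hPx.trans hx1).pow l)).mul hPx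
    simp only [one_pow, mul_one] at h2
    refine ((h1.congr_right fun r => ?_).add (h2.congr_right fun r => ?_)).congr_left fun r => ?_
    all_goals ring
  have hT2 : (fun r => ∑ n ∈ Finset.Icc 2 k, (a n * ((P r + D r) ^ n - P r ^ n) +
      a n * (P r ^ n - ∑ i ∈ Finset.range (k + 1), SS c n i * r⁻¹ ^ i)))
      =O[atTop] fun r : ℝ => r⁻¹ ^ (k + 1) := by
    apply IsBigO.fun_sum
    intro n hn
    exact ((hpw2 n (Finset.mem_Icc.1 hn).1).const_mul_left _).add
      ((pow_expand c n k).const_mul_left _)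
  have hswap : ∀ r : ℝ, ∑ n ∈ Finset.Icc 2 k, a n * ∑ i ∈ Finset.range (k + 1), SS c n i * r⁻¹ ^ i
      = ∑ i ∈ Finset.Icc 1 k, ((N - i) * c (i - 1) - a 1 * c i) * r⁻¹ ^ i := by
    intro r
    simp only [Finset.mul_sum]
    rw [Finset.sum_comm, Finset.range_eq_Ico, Finset.sum_eq_sum_Ico_succ_bot (by omega),
      Finset.sum_eq_zero (s := Finset.Icc 2 k), zero_add, zero_add,
      Finset.Ico_add_one_right_eq_Icc]
    · apply Finset.sum_congr rfl
      intro i hi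
      rw [Finset.mem_Icc] at hi
      rw [hrec i hi.1 hi.2, Finset.sum_mul]
      symm
      apply Finset.sum_subset_zero_on_sdiff
      · exact Finset.Icc_subset_Icc_right hi.2
      · intro n hn
        rw [Finset.mem_sdiff, Finset.mem_Icc, Finset.mem_Icc] at hn
        rw [SS_zero c (by omega)]; simp
      · intro n _; ring
    · intro n hn
      rw [Finset.mem_Icc] at hn
      rw [SS_zero c (by omega)]; simp
  have hshift : ∀ r : ℝ, ∑ i ∈ Finset.Icc 1 k, (N - i) * c (i - 1) * r⁻¹ ^ i
      = ∑ i ∈ Finset.range k, (N - 1 - i) * c i * r⁻¹ ^ (i + 1) := by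
    intro r
    rw [← Finset.Ico_add_one_right_eq_Icc, Finset.sum_Ico_eq_sum_range]
    simp only [Nat.add_sub_cancel]
    apply Finset.sum_congr rfl
    intro i _
    rw [Nat.add_sub_cancel_left, add_comm 1 i]
    push_cast; ring
  have hrange : ∀ y : ℝ, ∑ n ∈ Finset.range (k + 1), a n * y ^ n
      = a 0 + a 1 * y + ∑ n ∈ Finset.Icc 2 k, a n * y ^ n := by
    intro y
    rw [Finset.range_eq_Ico, Finset.sum_eq_sum_Ico_succ_bot (by omega),
      Finset.sum_eq_sum_Ico_succ_bot (by omega), Finset.Ico_add_one_right_eq_Icc]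
    simp; ring
  have hE : (fun r : ℝ => (N - 1 - k) * c k * r⁻¹ ^ (k + 1) + (N - 1 - p) * (D r * r⁻¹))
      =O[atTop] fun r : ℝ => r⁻¹ ^ (k + 1) := by
    refine ((isBigO_refl _ _).const_mul_left _).add (IsBigO.const_mul_left ?_ _)
    exact (hDk.mul (isBigO_refl _ _)).congr_right fun r => by ring
  refine ((hE.sub hT1).sub hT2).congr_left fun r => ?_
  have e1 : ∑ i ∈ Finset.range (k + 1), -(i : ℝ) * c i * r⁻¹ ^ (i + 1)
      + (N - 1) / r * (∑ i ∈ Finset.range (k + 1), c i * r⁻¹ ^ i)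
      = ∑ i ∈ Finset.range k, (N - 1 - i) * c i * r⁻¹ ^ (i + 1)
        + (N - 1 - k) * c k * r⁻¹ ^ (k + 1) := by
    rw [Finset.mul_sum, ← Finset.sum_add_distrib, Finset.sum_range_succ]
    congr 1
    · apply Finset.sum_congr rfl
      intro i _
      ring
    · ring
  have e2 : ∑ i ∈ Finset.Icc 1 k, ((N - i) * c (i - 1) - a 1 * c i) * r⁻¹ ^ i
      = ∑ i ∈ Finset.Icc 1 k, (N - i) * c (i - 1) * r⁻¹ ^ i - a 1 * P r := by
    simp only [hP, Finset.mul_sum]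
    rw [← Finset.sum_sub_distrib]
    apply Finset.sum_congr rfl
    intro i _
    ring
  have e3 : ∑ n ∈ Finset.Icc 2 k, (a n * ((P r + D r) ^ n - P r ^ n) +
      a n * (P r ^ n - ∑ i ∈ Finset.range (k + 1), SS c n i * r⁻¹ ^ i))
      = ∑ n ∈ Finset.Icc 2 k, a n * (P r + D r) ^ n
        - ∑ n ∈ Finset.Icc 2 k, a n * ∑ i ∈ Finset.range (k + 1), SS c n i * r⁻¹ ^ i := by
    rw [← Finset.sum_sub_distrib]
    apply Finset.sum_congr rfl
    intro i _
    ring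
  have e4 : c 0 + P r + D r - c 0 = P r + D r := by ring
  rw [mul_add]
  rw [e3, hswap, e2, hshift, hrange]
  rw [hsplit] at e1 ⊢
  change _ = _ - p * D r * r⁻¹ + (_ + _ * D r) - Φ (c 0 + P r + D r - c 0) + _ + a 1 * D r
  rw [e4]
  have e5 : (N - 1) / r = (N - 1) * r⁻¹ := div_eq_mul_inv _ _
  rw [e5] at e1 ⊢
  linear_combination -e1

lemma taylor_Phi {c0 κ s : ℝ} (hc0 : 0 < c0) (k : ℕ) :
    (fun y => (fun t : ℝ => κ * (c0 + t) ^ s) y - ∑ n ∈ Finset.range k,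
      (iteratedDeriv n (fun t : ℝ => κ * (c0 + t) ^ s) 0 / (n.factorial : ℝ)) * y ^ n)
      =O[𝓝 0] fun y => y ^ k := by
  have hA : AnalyticAt ℝ (fun t : ℝ => κ * (c0 + t) ^ s) 0 := by
    have h1 : AnalyticAt ℝ (fun t : ℝ => κ * Real.exp (Real.log (c0 + t) * s)) 0 := by
      have : AnalyticAt ℝ (fun t : ℝ => c0 + t) 0 := analyticAt_const.add analyticAt_id
      exact analyticAt_const.mul (((this.log (by simpa using hc0)).mul analyticAt_const).rexp)
    refine h1.congr ?_
    have : ∀ᶠ t : ℝ in 𝓝 0, 0 < c0 + t := by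
      have : Tendsto (fun t : ℝ => c0 + t) (𝓝 0) (𝓝 (c0 + 0)) := tendsto_const_nhds.add tendsto_id
      exact this.eventually (lt_mem_nhds (by simpa using hc0))
    filter_upwards [this] with t ht
    rw [Real.rpow_def_of_pos ht]
  have := hA.hasFPowerSeriesAt.isBigO_sub_partialSum_pow k
  refine (this.congr_left fun y => ?_).trans (IsBigO.of_norm_left ?_)
  · simp only [FormalMultilinearSeries.partialSum, FormalMultilinearSeries.ofScalars_apply_eq,
      smul_eq_mul, zero_add]
  · simp only [norm_pow, norm_norm]
    exact (isBigO_refl _ _).norm_left.congr_left fun y => by simp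

theorem stmt_2
    (N : ℕ) (hN : 2 ≤ N) (p μ m : ℝ)
    (hp1 : 1 < p) (hpN : p < N)
    (hμ0 : 0 ≤ μ) (hμ : μ < (((N : ℝ) - p) / p) ^ p)
    (hm : 0 < m)
    (f : ℝ → ℝ) (hf : Continuous f)
    (hF0 : ∃ A > (0:ℝ), ∃ q > p, ∃ t₀ > (0:ℝ),
      ∀ t : ℝ, |t| ≤ t₀ → |f t| ≤ A * |t| ^ (q - 1))
    (u u' : ℝ → ℝ)
    (hu_pos : ∀ r : ℝ, 0 < r → 0 < u r)
    (hu' : ∀ r : ℝ, 0 < r → HasDerivAt u (u' r) r)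
    (hS : ∀ r : ℝ, 0 < r →
      HasDerivAt (fun s : ℝ => s ^ ((N : ℝ) - 1) * |u' s| ^ (p - 2) * u' s)
        (-(r ^ ((N : ℝ) - 1) *
          (μ / r ^ p * u r ^ (p - 1) - m * u r ^ (p - 1) + f (u r)))) r)
    (hu0 : Tendsto u atTop (𝓝 0))
    (k : ℕ) (hk : (k : ℝ) ≤ p ∧ p < (k : ℝ) + 1) :
    (∀ᶠ r in atTop, u' r < 0) ∧
    ∃ c : ℕ → ℝ,
      c 0 = (m / (p - 1)) ^ ((p - 1) / p) ∧
      c 1 = (((N : ℝ) - 1) / p) * (m / (p - 1)) ^ ((p - 2) / p) ∧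
      (∀ i : ℕ, 2 ≤ i → i ≤ k →
        ((N : ℝ) - i) * c (i - 1) - p * (m / (p - 1)) ^ ((1 : ℝ) / p) * c i =
          ∑ n ∈ Finset.Icc 2 i,
            (iteratedDeriv n
                (fun t : ℝ => (p - 1) * ((m / (p - 1)) ^ ((p - 1) / p) + t) ^ (p / (p - 1))) 0
              / (n.factorial : ℝ)) *
            ∑ j ∈ (Finset.Nat.antidiagonalTuple n i).filter (fun j => ∀ a, 0 < j a),
              ∏ a, c (j a)) ∧
      (fun r : ℝ =>
          (-u' r / u r) ^ (p - 1) - (∑ i ∈ Finset.range (k + 1), c i * r ^ (-(i : ℝ)))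
            + ((p - 1) / m) ^ ((1 : ℝ) / p) * μ / (p * r ^ p))
        =O[atTop] fun r : ℝ => r ^ (-((k : ℝ) + 1)) := by
  obtain ⟨A, hA, q, hq, t₀, ht₀, hF⟩ := hF0
  have hp0 : 0 < p := by linarith
  have hp10 : 0 < p - 1 := by linarith
  have hk1 : 1 ≤ k := by
    by_contra h
    have : k = 0 := by omega
    subst this
    norm_num at hk
    linarith
  have he := e_tendsto (μ := μ) hp1 hq ht₀ hF hu_pos hu0
  obtain ⟨R0, hR0, hneg⟩ := u'_neg hm hu_pos hu' hS hu0 he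
  have hnegev : ∀ᶠ r in atTop, u' r < 0 := by
    filter_upwards [eventually_ge_atTop R0] with r hr using hneg r hr
  refine ⟨hnegev, ?_⟩
  have hode := ode hp1 hR0 hu_pos hu' hS hneg
  set s := p / (p - 1) with hs
  have hs1 : 1 < s := by rw [hs, one_lt_div hp10]; linarith
  set Q := m / (p - 1) with hQ
  have hQ0 : 0 < Q := by positivity
  set c0 := Q ^ ((p - 1) / p) with hc0d
  have hc0 : 0 < c0 := by positivity
  have hc0s : (p - 1) * c0 ^ s = m := by
    rw [hc0d, ← Real.rpow_mul hQ0.le]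
    have : (p - 1) / p * s = 1 := by rw [hs]; field_simp
    rw [this, Real.rpow_one, hQ]; field_simp
  have hW : Tendsto (fun r => (-u' r / u r) ^ (p - 1)) atTop (𝓝 c0) := by
    refine conv (R := R0 + 1) (b := (N : ℝ) - 1) (by linarith) (by linarith) hp10 hs1 hc0 hc0s ?_
      (fun r hr => hode r (by linarith)) he
    intro r hr
    have h1 := hneg r (by linarith)
    have h2 := hu_pos r (by linarith)
    have : 0 < -u' r / u r := div_pos (by linarith) h2
    positivity
  have hfd := f_decay (k + 1) hp1 hA hq ht₀ hc0 hF hu_pos hu' hu0 hnegev hW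
  set Φ : ℝ → ℝ := fun t : ℝ => (p - 1) * (c0 + t) ^ s with hΦ
  set lam := p * Q ^ ((1 : ℝ) / p) with hlam
  have hlam0 : 0 < lam := by positivity
  have ha0 : iteratedDeriv 0 Φ 0 / (Nat.factorial 0 : ℝ) = m := by
    simp [hΦ, hc0s]
  have ha1 : iteratedDeriv 1 Φ 0 / (Nat.factorial 1 : ℝ) = lam := by
    have hd : HasDerivAt Φ ((p - 1) * (1 * s * (c0 + 0) ^ (s - 1))) 0 :=
      (((hasDerivAt_id (0 : ℝ)).const_add c0).rpow_const
        (Or.inl (by simpa using hc0.ne'))).const_mul (p - 1)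
    rw [iteratedDeriv_one, hd.deriv, Nat.factorial_one, Nat.cast_one, div_one, add_zero, hc0d,
      ← Real.rpow_mul hQ0.le]
    have h1 : (p - 1) / p * (s - 1) = 1 / p := by rw [hs]; field_simp; ring
    have h2 : (p - 1) * s = p := by rw [hs]; field_simp
    rw [h1, hlam]
    linear_combination Q ^ (1 / p) * h2
  obtain ⟨c, hcc0, hcc1, hrec⟩ := exists_seq N lam c0 (((N : ℝ) - 1) / p * Q ^ ((p - 2) / p))
    hlam0.ne' (fun n => iteratedDeriv n Φ 0 / (n.factorial : ℝ))
  refine ⟨c, hcc0, hcc1, fun i hi _ => hrec i hi, ?_⟩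
  set d : ℝ := -(μ / lam) with hd
  have hres := resid_bound (Φ := Φ) (a := fun n => iteratedDeriv n Φ 0 / (n.factorial : ℝ)) (c := c)
    (k := k) (N := N) (p := p) (d := d) hk1 hk.1 (taylor_Phi hc0 (k + 1)) (by
      intro i hi hik
      rcases Nat.lt_or_ge i 2 with h | h
      · have : i = 1 := by omega
        subst this
        simp only [ha1]
        rw [hcc1, hcc0, hlam, hc0d]
        have : Q ^ ((p - 1) / p) = Q ^ (1 / p) * Q ^ ((p - 2) / p) := by
          rw [← Real.rpow_add hQ0]; congr 1; field_simp; ring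
        rw [this]
        simp
        field_simp
        ring
      · simp only [ha1]
        exact hrec i h)
  set v : ℝ → ℝ := fun r => (∑ i ∈ Finset.range (k + 1), c i * r⁻¹ ^ i) + d * r ^ (-p) with hv
  set v' : ℝ → ℝ := fun r => (∑ i ∈ Finset.range (k + 1), -(i : ℝ) * c i * r⁻¹ ^ (i + 1))
        - p * (d * r ^ (-p)) * r⁻¹ with hv'
  have hvd : ∀ r, R0 + 1 ≤ r → HasDerivAt v (v' r) r := by
    intro r hr
    have hr0 : 0 < r := by linarith
    have h1 : ∀ i ∈ Finset.range (k + 1), HasDerivAt (fun r : ℝ => c i * r⁻¹ ^ i)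
        (-(i : ℝ) * c i * r⁻¹ ^ (i + 1)) r := by
      intro i _
      refine (((hasDerivAt_inv hr0.ne').pow i).const_mul (c i)).congr_deriv ?_
      rcases i with _ | i
      · simp
      · simp only [Nat.add_sub_cancel]
        push_cast
        ring
    have h2 := (Real.hasDerivAt_rpow_const (x := r) (p := -p) (Or.inl hr0.ne')).const_mul d
    refine ((HasDerivAt.fun_sum h1).add h2).congr_deriv ?_
    rw [Real.rpow_sub hr0, Real.rpow_one]
    simp only [hv']
    ring
  have hvl : Tendsto v atTop (𝓝 c0) := by
    have h1 : Tendsto (fun r : ℝ => ∑ i ∈ Finset.range (k + 1), c i * r⁻¹ ^ i) atTop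
        (𝓝 (∑ i ∈ Finset.range (k + 1), c i * (0 : ℝ) ^ i)) :=
      tendsto_finsetSum _ fun i _ => (tendsto_inv_atTop_zero.pow i).const_mul (c i)
    have h2 := (tendsto_rpow_neg_atTop hp0).const_mul d
    have h3 := h1.add h2
    rw [Finset.sum_range_succ'] at h3
    convert h3 using 2
    simp [hcc0]
  have hfin := final (R := R0 + 1) (v := v) (v' := v') (k + 1) (b := (N : ℝ) - 1)
    hp10 hs1 hc0 (fun r hr => hode r (by linarith)) hvd hW hvl (by
      refine (hfd.sub hres).congr' ?_ EventuallyEq.rfl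
      filter_upwards [eventually_gt_atTop 0] with r hr
      have e1 : Φ (v r - c 0) = (p - 1) * v r ^ s := by
        simp only [hΦ]
        rw [hcc0]; congr 2; ring
      have e2 : lam * (d * r ^ (-p)) = - (μ / r ^ p) := by
        rw [hd, Real.rpow_neg hr.le]; field_simp
      simp only [ha0, ha1]
      change _ - (v' r + _ * v r - Φ (v r - c 0) + _ + _) = _
      rw [e1, e2]
      ring)
  refine hfin.congr' ?_ ?_
  · filter_upwards [eventually_gt_atTop 0] with r hr
    have e1 : ∀ i : ℕ, r ^ (-(i : ℝ)) = r⁻¹ ^ i := fun i => by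
      rw [Real.rpow_neg hr.le, Real.rpow_natCast, inv_pow]
    have e2 : ((p - 1) / m) ^ ((1 : ℝ) / p) * μ / (p * r ^ p) = - (d * r ^ (-p)) := by
      have : (p - 1) / m = Q⁻¹ := by rw [hQ, inv_div]
      rw [this, Real.inv_rpow hQ0.le, hd, hlam, Real.rpow_neg hr.le]
      field_simp
    simp only [e1, e2, hv]
    ring
  · filter_upwards [eventually_gt_atTop 0] with r hr
    rw [Real.rpow_neg hr.le, inv_pow, ← Real.rpow_natCast]
    push_cast; rfl
end

section
/- Let N ≥ 2 be an integer and let p, μ, m be real numbers with 1 < p < N, 0 ≤ μ < μ̄ := ((N−p)/p)^p and m > 0. Let f : ℝ → ℝ be continuous and satisfy (F). Let u : (0,∞) → ℝ be a radial profile solution of the equation (hypothesis (S)) that also satisfies (W). Define w(r) = −r^{p−1}|u'(r)|^{p−2}u'(r)/u(r)^{p−1} for r > 0. Then there exist constants δ > 0, C > 0 and r₀ > 0 such that |w(r) − γ₁^{p−1}| ≤ C·r^{δ} for all 0 < r < r₀, where γ₁ is the unique zero of Γ_μ in [0, (N−p)/p). -/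
open Filter Topology MeasureTheory Set


lemma aux_barrier (b b' y y' : ℝ → ℝ) (T : ℝ)
    (hb : ∀ t, T ≤ t → HasDerivAt b (b' t) t) (hy : ∀ t, T ≤ t → HasDerivAt y (y' t) t)
    (h0 : b T ≤ y T) (h : ∀ t, T ≤ t → b t = y t → b' t < y' t) :
    ∀ t, T ≤ t → b t ≤ y t := by
  intro t ht
  refine image_le_of_deriv_right_lt_deriv_boundary' (a := T) (b := t) (f := b) (f' := b') (B := y)
    (B' := y') ?_ ?_ h0 ?_ ?_ ?_ ⟨ht, le_rfl⟩
  · intro x hx; exact (hb x hx.1).continuousAt.continuousWithinAt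
  · intro x hx; exact (hb x hx.1).hasDerivWithinAt
  · intro x hx; exact (hy x hx.1).continuousAt.continuousWithinAt
  · intro x hx; exact (hy x hx.1).hasDerivWithinAt
  · intro x hx; exact h x hx.1

lemma aux_A (y y' : ℝ → ℝ) (T c E D δ Bd : ℝ) (hc : 0 < c) (hE : 0 ≤ E) (hδ : 0 ≤ δ)
    (hD : E < c * D)
    (hy : ∀ t, T ≤ t → HasDerivAt y (y' t) t)
    (h : ∀ t, T ≤ t → 0 ≤ y t → c * y t - E * Real.exp (-δ * t) ≤ y' t)
    (hB : ∀ t, T ≤ t → y t ≤ Bd) :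
    ∀ t, T ≤ t → y t ≤ D * Real.exp (-δ * t) := by
  intro t₁ ht₁
  by_contra! hcon
  have hD0 : 0 < D := by
    by_contra! h0
    nlinarith
  set κ := (y t₁ - D * Real.exp (-δ * t₁)) with hκ
  have hκ0 : 0 < κ := by linarith
  have key := aux_barrier (fun t => D * Real.exp (-δ * t) + κ * Real.exp (c * (t - t₁)))
    (fun t => D * (Real.exp (-δ * t) * (-δ)) + κ * (Real.exp (c * (t - t₁)) * c)) y y' t₁
    (by
      intro t ht
      have h1 : HasDerivAt (fun t : ℝ => -δ * t) (-δ) t := by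
        simpa using (hasDerivAt_id t).const_mul (-δ)
      have h2 : HasDerivAt (fun t : ℝ => c * (t - t₁)) c t := by
        simpa using ((hasDerivAt_id t).sub_const t₁).const_mul c
      exact (h1.exp.const_mul D).add (h2.exp.const_mul κ))
    (fun t ht => hy t (ht₁.trans ht)) (by simp [hκ])
    (by
      intro t ht heq
      have e1 := Real.exp_pos (-δ * t)
      have e2 := Real.exp_pos (c * (t - t₁))
      have hy0 : 0 ≤ y t := by rw [← heq]; positivity
      have h3 := h t (ht₁.trans ht) hy0
      rw [← heq] at h3
      have h4 : 0 ≤ D * Real.exp (-δ * t) * δ := by positivity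
      have h5 : 0 < (c * D - E) * Real.exp (-δ * t) := mul_pos (by linarith) e1
      nlinarith)
  -- pick large t
  obtain ⟨t, ht, htB⟩ : ∃ t, t₁ ≤ t ∧ Bd < κ * (c * (t - t₁)) := by
    refine ⟨t₁ + (|Bd| + 1) / (κ * c), by
      have : 0 ≤ (|Bd| + 1) / (κ * c) := by positivity
      linarith, ?_⟩
    have : κ * (c * (t₁ + (|Bd| + 1) / (κ * c) - t₁)) = |Bd| + 1 := by field_simp; ring
    rw [this]
    linarith [le_abs_self Bd]
  have k1 := key t ht
  have k2 := hB t (ht₁.trans ht)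
  have k3 := Real.add_one_le_exp (c * (t - t₁))
  have k4 : 0 < D * Real.exp (-δ * t) := by positivity
  nlinarith

lemma aux_B (y y' : ℝ → ℝ) (T M κ s : ℝ) (hM : 0 < M) (hκ : 0 < κ) (hs : 1 < s)
    (hy : ∀ t, T ≤ t → HasDerivAt y (y' t) t)
    (h : ∀ t, T ≤ t → M ≤ y t → κ * y t ^ s ≤ y' t) :
    ∀ t, T ≤ t → y t ≤ M := by
  intro t₁ ht₁
  by_contra! hcon
  have key := aux_barrier (fun _ => M) (fun _ => 0) y y' t₁ (fun t _ => hasDerivAt_const t M)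
    (fun t ht => hy t (ht₁.trans ht)) hcon.le
    (by
      intro t ht heq
      have h3 := h t (ht₁.trans ht) heq.le
      have : 0 < κ * y t ^ s := mul_pos hκ (Real.rpow_pos_of_pos (by rw [← heq]; exact hM) _)
      linarith)
  have hd : ∀ t, t₁ ≤ t → HasDerivAt (fun t => y t ^ (1 - s) + (s - 1) * κ * t)
      (y' t * (1 - s) * y t ^ (1 - s - 1) + (s - 1) * κ) t := by
    intro t ht
    have hyt : 0 < y t := hM.trans_le (key t ht)
    have h1 := (hy t (ht₁.trans ht)).rpow_const (p := 1 - s) (Or.inl hyt.ne')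
    have h2 : HasDerivAt (fun t : ℝ => (s - 1) * κ * t) ((s - 1) * κ) t := by
      simpa using (hasDerivAt_id t).const_mul ((s - 1) * κ)
    exact h1.add h2
  have hanti : AntitoneOn (fun t => y t ^ (1 - s) + (s - 1) * κ * t) (Ici t₁) := by
    apply antitoneOn_of_deriv_nonpos (convex_Ici t₁)
    · intro t ht; exact (hd t ht).continuousAt.continuousWithinAt
    · intro t ht
      rw [interior_Ici] at ht
      exact (hd t (le_of_lt ht)).differentiableAt.differentiableWithinAt
    · intro t ht
      rw [interior_Ici] at ht
      have ht' : t₁ ≤ t := le_of_lt ht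
      rw [(hd t ht').deriv]
      have hyt : 0 < y t := hM.trans_le (key t ht')
      have h3 := h t (ht₁.trans ht') (key t ht')
      have h4 : y t ^ s * y t ^ (1 - s - 1) = 1 := by
        rw [← Real.rpow_add hyt]; ring_nf; simp
      have h5 : 0 < y t ^ (1 - s - 1) := Real.rpow_pos_of_pos hyt _
      have h6 : κ * 1 ≤ y' t * y t ^ (1 - s - 1) := by
        have h7 := mul_le_mul_of_nonneg_right h3 h5.le
        rwa [mul_assoc, h4] at h7
      nlinarith
  have hK : 0 < (s - 1) * κ := mul_pos (by linarith) hκ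
  have hy1 : 0 < y t₁ ^ (1 - s) := Real.rpow_pos_of_pos (hM.trans hcon) _
  set t₂ := t₁ + y t₁ ^ (1 - s) / ((s - 1) * κ) with ht₂
  have ht12 : t₁ ≤ t₂ := by
    have : 0 ≤ y t₁ ^ (1 - s) / ((s - 1) * κ) := by positivity
    linarith
  have h7 := hanti (mem_Ici.2 le_rfl) (mem_Ici.2 ht12) ht12
  have h8 : 0 < y t₂ ^ (1 - s) := Real.rpow_pos_of_pos (hM.trans_le (key t₂ ht12)) _
  have h9 : (s - 1) * κ * t₂ = (s - 1) * κ * t₁ + y t₁ ^ (1 - s) := by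
    have hs1 : s - 1 ≠ 0 := by linarith
    rw [ht₂]; field_simp
  simp only at h7
  linarith

lemma aux_conv (a b μ s : ℝ) (ha : 0 < a) (hs : 1 < s) :
    ConvexOn ℝ univ (fun x : ℝ => a * |x| ^ s - b * x + μ) := by
  have h1 : ConvexOn ℝ univ (fun x : ℝ => |x| ^ s) := by
    have h2 : ConvexOn ℝ univ (fun x : ℝ => |x|) := convexOn_univ_norm
    refine ⟨convex_univ, ?_⟩
    intro x _ y _ α β hα hβ hαβ
    have h3 := h2.2 (mem_univ x) (mem_univ y) hα hβ hαβ
    have h4 := (convexOn_rpow hs.le).2 (abs_nonneg x) (abs_nonneg y) hα hβ hαβ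
    exact (Real.rpow_le_rpow (abs_nonneg _) h3 (by linarith)).trans h4
  refine ⟨convex_univ, ?_⟩
  intro x hx y hy α β hα hβ hαβ
  have h5 := h1.2 hx hy hα hβ hαβ
  simp only [smul_eq_mul] at h5 ⊢
  have : β = 1 - α := by linarith
  subst this
  nlinarith

lemma aux_H (a b μ s x₁ x₂ : ℝ) (ha : 0 < a) (hs : 1 < s) (h12 : x₁ < x₂) (H : ℝ → ℝ)
    (hH : ∀ x, H x = a * |x| ^ s - b * x + μ) (h1 : H x₁ = 0) (h2 : H x₂ < 0) :
    ∃ c > 0, (∀ x, x ≤ x₁ → c * (x₁ - x) ≤ H x) ∧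
      (∀ x, x₁ ≤ x → x ≤ x₂ → H x ≤ - (c * (x - x₁))) := by
  have hc : ConvexOn ℝ univ H := by
    have := aux_conv a b μ s ha hs
    rwa [← funext hH] at this
  have hpos : 0 < x₂ - x₁ := by linarith
  refine ⟨-H x₂ / (x₂ - x₁), div_pos (by linarith) hpos, ?_, ?_⟩
  · intro x hx
    rcases hx.eq_or_lt with rfl | hx
    · simp [h1]
    have := hc.slope_mono_adjacent (mem_univ x) (mem_univ x₂) hx h12
    rw [h1] at this
    have hx' : 0 < x₁ - x := by linarith
    rw [div_le_iff₀ hx'] at this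
    have e : -H x₂ / (x₂ - x₁) * (x₁ - x) = - ((H x₂ - 0) / (x₂ - x₁) * (x₁ - x)) := by ring
    rw [e]; linarith
  · intro x hx hx2
    rcases hx.eq_or_lt with rfl | hx
    · simp [h1]
    have := hc.secant_mono (mem_univ x₁) (mem_univ x) (mem_univ x₂) hx.ne' h12.ne' hx2
    rw [h1] at this
    have hx' : 0 < x - x₁ := by linarith
    rw [div_le_iff₀ hx'] at this
    have e : -(-H x₂ / (x₂ - x₁) * (x - x₁)) = ((H x₂ - 0) / (x₂ - x₁) * (x - x₁)) := by ring
    rw [e]; linarith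

lemma aux_core (V e H : ℝ → ℝ) (a b μ s x₁ x₂ x₃ : ℝ) (ha : 0 < a) (hb : 0 ≤ b) (hμ : 0 ≤ μ)
    (hs : 1 < s)
    (h13 : x₁ < x₃) (h32 : x₃ < x₂)
    (hH : ∀ x, H x = a * |x| ^ s - b * x + μ) (h1 : H x₁ = 0) (h2 : H x₂ < 0)
    (hV : ∀ t, HasDerivAt V (-(H (V t)) - e t) t)
    (he : Tendsto e atTop (𝓝 0))
    (hnot : ¬ ∃ T, ∀ t, T ≤ t → x₂ ≤ V t)
    (hbet : (∃ T, ∀ t, T ≤ t → V t ≤ x₃) →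
      ∃ δ > 0, ∃ E ≥ 0, ∃ T, ∀ t, T ≤ t → |e t| ≤ E * Real.exp (-δ * t)) :
    ∃ δ > 0, ∃ C > 0, ∃ T, ∀ t, T ≤ t → |V t - x₁| ≤ C * Real.exp (-δ * t) := by
  have h12 := h13.trans h32
  obtain ⟨c, hc, hc1, hc2⟩ := aux_H a b μ s x₁ x₂ ha hs h12 H hH h1 h2
  have hev : ∀ η > 0, ∃ T, ∀ t, T ≤ t → |e t| ≤ η := by
    intro η hη
    have := he.eventually (Metric.ball_mem_nhds (0:ℝ) hη)
    obtain ⟨T, hT⟩ := eventually_atTop.1 this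
    refine ⟨T, fun t ht => ?_⟩
    have := hT t ht
    rw [Real.dist_eq, sub_zero] at this
    exact this.le
  -- claim 1
  obtain ⟨T₁, hT₁⟩ : ∃ T, ∀ t, T ≤ t → V t < x₂ := by
    obtain ⟨T, hT⟩ := hev (-H x₂ / 2) (by linarith)
    refine ⟨T, fun t₁ ht₁ => ?_⟩
    by_contra! hcon
    apply hnot
    refine ⟨t₁, aux_barrier (fun _ => x₂) (fun _ => 0) V _ t₁ (fun t _ => hasDerivAt_const t x₂)
      (fun t _ => hV t) hcon ?_⟩
    intro t ht heq
    have := abs_le.1 (hT t (ht₁.trans ht))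
    rw [← heq]; linarith [this.2]
  -- claim 2
  obtain ⟨T₂, M, hT₂⟩ : ∃ T M, ∀ t, T ≤ t → -V t ≤ M := by
    obtain ⟨T, hT⟩ := hev 1 one_pos
    set M : ℝ := (2 / a + 1) with hMdef
    have hM1 : 1 ≤ M := by have : 0 < 2 / a := by positivity
                           linarith
    refine ⟨T, M, aux_B (fun t => - V t) (fun t => -(-(H (V t)) - e t)) T M (a / 2) s (by linarith)
      (by positivity) hs (fun t _ => (hV t).neg) ?_⟩
    intro t ht hMt
    have he1 := abs_le.1 (hT t ht)
    have hneg : V t ≤ 0 := by linarith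
    rw [hH, abs_of_nonpos hneg]
    have hp1 : M ≤ (-V t) ^ s := by
      calc M ≤ -V t := hMt
        _ = (-V t) ^ (1:ℝ) := (Real.rpow_one _).symm
        _ ≤ (-V t) ^ s := Real.rpow_le_rpow_of_exponent_le (by linarith) hs.le
    have h5 : a / 2 * M ≤ a / 2 * (-V t) ^ s := mul_le_mul_of_nonneg_left hp1 (by positivity)
    have h6 : a / 2 * M = 1 + a / 2 := by rw [hMdef]; field_simp
    have h7 : 0 ≤ b * (- V t) := mul_nonneg hb (by linarith)
    nlinarith [he1.1]
  -- upper and lower bound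
  have hup : ∀ T E δ D, T₁ ≤ T → 0 ≤ E → 0 ≤ δ → E < c * D →
      (∀ t, T ≤ t → |e t| ≤ E * Real.exp (-δ * t)) →
      ∀ t, T ≤ t → V t - x₁ ≤ D * Real.exp (-δ * t) := by
    intro T E δ D hT hE hδ hD hb
    refine aux_A (fun t => V t - x₁) (fun t => -(H (V t)) - e t) T c E D δ (x₂ - x₁) hc hE hδ hD
      (fun t _ => (hV t).sub_const x₁) ?_ ?_
    · intro t ht h0
      have k1 := hc2 (V t) (by linarith) (hT₁ t (hT.trans ht)).le
      have k2 := abs_le.1 (hb t ht)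
      linarith [k2.2]
    · intro t ht
      have := hT₁ t (hT.trans ht)
      linarith
  have hlo : ∀ T E δ D, T₂ ≤ T → 0 ≤ E → 0 ≤ δ → E < c * D →
      (∀ t, T ≤ t → |e t| ≤ E * Real.exp (-δ * t)) →
      ∀ t, T ≤ t → x₁ - V t ≤ D * Real.exp (-δ * t) := by
    intro T E δ D hT hE hδ hD hb
    refine aux_A (fun t => x₁ - V t) (fun t => -(-(H (V t)) - e t)) T c E D δ (M + x₁) hc hE hδ hD
      (fun t _ => (hV t).const_sub x₁) ?_ ?_
    · intro t ht h0
      have k1 := hc1 (V t) (by linarith)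
      have k2 := abs_le.1 (hb t ht)
      linarith [k2.1]
    · intro t ht
      have := hT₂ t (hT.trans ht)
      linarith
  have hx3 : ∃ T, ∀ t, T ≤ t → V t ≤ x₃ := by
    have hE : 0 < c * (x₃ - x₁) / 2 := by have := mul_pos hc (sub_pos.2 h13); linarith
    obtain ⟨T, hT⟩ := hev _ hE
    refine ⟨max T T₁, fun t ht => ?_⟩
    have := hup (max T T₁) _ 0 (x₃ - x₁) (le_max_right _ _) hE.le le_rfl (by linarith)
      (fun t ht => by simpa using hT t ((le_max_left _ _).trans ht)) t ht
    simp at this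
    linarith
  obtain ⟨δ, hδ, E, hE, T, hT⟩ := hbet hx3
  have hD : E < c * ((E + 1) / c) := by
    have : c * ((E + 1) / c) = E + 1 := by field_simp
    linarith
  refine ⟨δ, hδ, (E + 1) / c, by positivity, max T (max T₁ T₂), fun t ht => ?_⟩
  have hT' : ∀ t, max T (max T₁ T₂) ≤ t → |e t| ≤ E * Real.exp (-δ * t) :=
    fun t ht => hT t ((le_max_left _ _).trans ht)
  have u1 := hup _ E δ _ ((le_max_left T₁ T₂).trans (le_max_right _ _)) hE hδ.le hD hT' t ht
  have u2 := hlo _ E δ _ ((le_max_right T₁ T₂).trans (le_max_right _ _)) hE hδ.le hD hT' t ht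
  rw [abs_le]; constructor <;> linarith

lemma aux_phi_abs (p x : ℝ) (hp : 1 < p) : |x| ^ (p - 2) * x ^ 2 = |x| ^ p := by
  by_cases hx : x = 0
  · subst hx; simp [Real.zero_rpow (by linarith : p ≠ 0)]
  have h : 0 < |x| := abs_pos.2 hx
  rw [← sq_abs, ← Real.rpow_natCast, ← Real.rpow_add h]; congr 1; push_cast; ring

lemma aux_phi_abs' (p x : ℝ) (hp : 1 < p) : |x| ^ (p - 2) * |x| = |x| ^ (p - 1) := by
  by_cases hx : x = 0
  · subst hx; simp [Real.zero_rpow (by linarith : p - 1 ≠ 0)]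
  have h : 0 < |x| := abs_pos.2 hx
  nth_rewrite 2 [← Real.rpow_one |x|]
  rw [← Real.rpow_add h]; congr 1; ring

/-- lower comparison -/
lemma aux_wge (p k r U v : ℝ) (hp : 1 < p) (hk : 0 < k) (hr : 0 < r) (hU : 0 < U)
    (h : k ^ (p - 1) ≤ -(r ^ (p - 1) * |v| ^ (p - 2) * v) / U ^ (p - 1)) : k * U + r * v ≤ 0 := by
  have hUp : 0 < U ^ (p - 1) := Real.rpow_pos_of_pos hU _
  have hrp : 0 < r ^ (p - 1) := Real.rpow_pos_of_pos hr _
  rw [le_div_iff₀ hUp, ← Real.mul_rpow hk.le hU.le] at h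
  by_cases hv : v < 0
  · have e : -(r ^ (p - 1) * |v| ^ (p - 2) * v) = (r * |v|) ^ (p - 1) := by
      rw [Real.mul_rpow hr.le (abs_nonneg v), ← aux_phi_abs' p v hp, abs_of_neg hv]; ring
    rw [e] at h
    have := (Real.rpow_le_rpow_iff (by positivity) (by positivity) (by linarith)).1 h
    rw [abs_of_neg hv] at this; linarith
  · have h1 : 0 < (k * U) ^ (p - 1) := by positivity
    have h2 : 0 ≤ r ^ (p - 1) * |v| ^ (p - 2) * v := mul_nonneg (by positivity) (not_lt.1 hv)
    linarith

lemma aux_wle (p k r U v : ℝ) (hp : 1 < p) (hk : 0 < k) (hr : 0 < r) (hU : 0 < U)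
    (h : -(r ^ (p - 1) * |v| ^ (p - 2) * v) / U ^ (p - 1) ≤ k ^ (p - 1)) : 0 ≤ k * U + r * v := by
  have hUp : 0 < U ^ (p - 1) := Real.rpow_pos_of_pos hU _
  rw [div_le_iff₀ hUp, ← Real.mul_rpow hk.le hU.le] at h
  by_cases hv : v < 0
  · have e : -(r ^ (p - 1) * |v| ^ (p - 2) * v) = (r * |v|) ^ (p - 1) := by
      rw [Real.mul_rpow hr.le (abs_nonneg v), ← aux_phi_abs' p v hp, abs_of_neg hv]; ring
    rw [e] at h
    have := (Real.rpow_le_rpow_iff (by positivity) (by positivity) (by linarith)).1 h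
    rw [abs_of_neg hv] at this; linarith
  · have : 0 ≤ v := not_lt.1 hv
    positivity

lemma aux_wabs (p r U v : ℝ) (hp : 1 < p) (hr : 0 < r) (hU : 0 < U) :
    |-(r ^ (p - 1) * |v| ^ (p - 2) * v) / U ^ (p - 1)| ^ (p / (p - 1))
      = r ^ p * (|v| ^ (p - 2) * v ^ 2) / U ^ p := by
  have hUp : 0 < U ^ (p - 1) := Real.rpow_pos_of_pos hU _
  have hrp : 0 < r ^ (p - 1) := Real.rpow_pos_of_pos hr _
  have e : |-(r ^ (p - 1) * |v| ^ (p - 2) * v) / U ^ (p - 1)| = (r * |v| / U) ^ (p - 1) := by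
    rw [abs_div, abs_neg, abs_mul, abs_mul, abs_of_pos hUp, abs_of_pos hrp,
      abs_of_nonneg (Real.rpow_nonneg (abs_nonneg v) _), mul_assoc, aux_phi_abs' p v hp,
      ← Real.mul_rpow hr.le (abs_nonneg v), Real.div_rpow (by positivity) hU.le]
  rw [e, ← Real.rpow_mul (by positivity), aux_phi_abs p v hp,
    ← Real.mul_rpow hr.le (abs_nonneg v), ← Real.div_rpow (by positivity) hU.le]
  congr 1
  have : p - 1 ≠ 0 := by linarith
  field_simp

lemma aux_deriv (n p μ m F : ℝ) (hp : 1 < p) (u u' w : ℝ → ℝ) (r : ℝ) (hr : 0 < r)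
    (hU : 0 < u r) (hu' : HasDerivAt u (u' r) r)
    (hS : HasDerivAt (fun s : ℝ => s ^ (n - 1) * |u' s| ^ (p - 2) * u' s)
        (-(r ^ (n - 1) * (μ / r ^ p * u r ^ (p - 1) - m * u r ^ (p - 1) + F))) r)
    (hw : ∀ r : ℝ, 0 < r →
      w r = -(r ^ (p - 1) * |u' r| ^ (p - 2) * u' r) / u r ^ (p - 1)) :
    HasDerivAt w (((p - 1) * |w r| ^ (p / (p - 1)) - (n - p) * w r + μ
      + r ^ p * (-m + F / u r ^ (p - 1))) / r) r := by
  have hev : w =ᶠ[𝓝 r] fun s => -(s ^ (p - n) * (s ^ (n - 1) * |u' s| ^ (p - 2) * u' s))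
      / u s ^ (p - 1) := by
    filter_upwards [lt_mem_nhds hr] with s hs
    rw [hw s hs]
    have : s ^ (p - 1) = s ^ (p - n) * s ^ (n - 1) := by rw [← Real.rpow_add hs]; congr 1; ring
    rw [this]; ring
  have h1 : HasDerivAt (fun s : ℝ => s ^ (p - n)) ((p - n) * r ^ (p - n - 1)) r :=
    Real.hasDerivAt_rpow_const (Or.inl hr.ne')
  have h2 := hu'.rpow_const (p := p - 1) (Or.inl hU.ne')
  have hUp : 0 < u r ^ (p - 1) := Real.rpow_pos_of_pos hU _
  have h3 := ((h1.mul hS).neg.div h2 hUp.ne')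
  refine (h3.congr_of_eventuallyEq ?_).congr_deriv ?_
  · exact hev
  · have hwr := hw r hr
    have := aux_wabs p r (u r) (u' r) hp hr hU
    rw [← hwr] at this
    rw [this, hwr]
    have hrp : 0 < r ^ p := Real.rpow_pos_of_pos hr _
    have hrn : 0 < r ^ n := Real.rpow_pos_of_pos hr _
    have hUpp : 0 < u r ^ p := Real.rpow_pos_of_pos hU _
    simp only [Pi.mul_apply, Pi.neg_apply, Real.rpow_sub hr, Real.rpow_sub hU, Real.rpow_one]
    generalize |u' r| ^ (p - 2) = a
    generalize r ^ p = R at *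
    generalize r ^ n = Rn at *
    generalize u r ^ p = Up at *
    field_simp
    ring

lemma aux_err (n p m A q t₀ F U r : ℝ) (hp : 1 < p) (hpn : p < n) (hm : 0 < m) (hA : 0 < A)
    (hq : p < q) (ht₀ : 0 < t₀) (hU : 0 < U) (hr : 0 < r)
    (h1 : U ≤ t₀ → |F| ≤ A * U ^ (q - 1))
    (h2 : t₀ ≤ U → |F| ≤ A * U ^ (n * p / (n - p) - 1)) :
    |r ^ p * (-m + F / U ^ (p - 1))| ≤ (m + A * t₀ ^ (q - p)) * r ^ p
      + A * (U * r ^ ((n - p) / p)) ^ (p ^ 2 / (n - p)) := by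
  have hnp : 0 < n - p := by linarith
  have hUp : 0 < U ^ (p - 1) := Real.rpow_pos_of_pos hU _
  have hrp : 0 < r ^ p := Real.rpow_pos_of_pos hr _
  have hX : 0 ≤ A * (U * r ^ ((n - p) / p)) ^ (p ^ 2 / (n - p)) := by positivity
  have hY : 0 ≤ A * t₀ ^ (q - p) * r ^ p := by positivity
  have hb : r ^ p * (|F| / U ^ (p - 1)) ≤ A * t₀ ^ (q - p) * r ^ p
      + A * (U * r ^ ((n - p) / p)) ^ (p ^ 2 / (n - p)) := by
    rcases le_total U t₀ with h | h
    · have k1 : |F| / U ^ (p - 1) ≤ A * t₀ ^ (q - p) := by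
        rw [div_le_iff₀ hUp]
        refine (h1 h).trans ?_
        have : U ^ (q - 1) = U ^ (q - p) * U ^ (p - 1) := by
          rw [← Real.rpow_add hU]; congr 1; ring
        rw [this, mul_assoc]
        have := Real.rpow_le_rpow hU.le h (by linarith : 0 ≤ q - p)
        gcongr
      nlinarith [mul_le_mul_of_nonneg_left k1 hrp.le]
    · have k1 : |F| / U ^ (p - 1) ≤ A * U ^ (p ^ 2 / (n - p)) := by
        rw [div_le_iff₀ hUp]
        refine (h2 h).trans (le_of_eq ?_)
        rw [mul_assoc, ← Real.rpow_add hU]; congr 2; field_simp; ring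
      have k2 : (U * r ^ ((n - p) / p)) ^ (p ^ 2 / (n - p)) = U ^ (p ^ 2 / (n - p)) * r ^ p := by
        rw [Real.mul_rpow hU.le (by positivity), ← Real.rpow_mul hr.le]
        congr 2; field_simp
      rw [k2]
      nlinarith [mul_le_mul_of_nonneg_left k1 hrp.le]
  rw [abs_mul, abs_of_pos hrp]
  have k3 : |-m + F / U ^ (p - 1)| ≤ m + |F| / U ^ (p - 1) := by
    refine (abs_add_le _ _).trans ?_
    rw [abs_neg, abs_of_pos hm, abs_div, abs_of_pos hUp]
  have := mul_le_mul_of_nonneg_left k3 hrp.le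
  linarith

lemma aux_g (u : ℝ → ℝ) (v κ r : ℝ) (hr : 0 < r) (hu : HasDerivAt u v r) :
    HasDerivAt (fun r => u r * r ^ κ) (r ^ (κ - 1) * (κ * u r + r * v)) r := by
  have h1 : HasDerivAt (fun s : ℝ => s ^ κ) (κ * r ^ (κ - 1)) r :=
    Real.hasDerivAt_rpow_const (Or.inl hr.ne')
  refine (hu.mul h1).congr_deriv ?_
  have : r ^ κ = r ^ (κ - 1) * r := by rw [← Real.rpow_add_one hr.ne']; congr 1; ring
  rw [this]; ring

lemma aux_Hval (n p μ g : ℝ) (hp : 1 < p) (hg : 0 ≤ g) :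
    (p - 1) * |g ^ (p - 1)| ^ (p / (p - 1)) - (n - p) * g ^ (p - 1) + μ
      = g ^ (p - 1) * ((p - 1) * g - (n - p)) + μ := by
  have hp1 : p - 1 ≠ 0 := by linarith
  have e : |g ^ (p - 1)| ^ (p / (p - 1)) = g ^ (p - 1) * g := by
    rw [abs_of_nonneg (Real.rpow_nonneg hg _), ← Real.rpow_mul hg]
    have h1 : (p - 1) * (p / (p - 1)) = p := by field_simp
    rw [h1]
    have h2 := Real.rpow_add_one' hg (y := p - 1) (by linarith)
    rw [← h2]; congr 1; ring
  rw [e]; ring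

theorem stmt_5
    (N : ℕ) (hN : 2 ≤ N) (p μ m : ℝ)
    (hp1 : 1 < p) (hpN : p < N)
    (hμ0 : 0 ≤ μ) (hμ : μ < (((N : ℝ) - p) / p) ^ p)
    (hm : 0 < m)
    (f : ℝ → ℝ) (hf : Continuous f)
    (hF : ∃ A > (0:ℝ), ∃ q > p, ∃ t₀ > (0:ℝ),
      (∀ t : ℝ, |t| ≤ t₀ → |f t| ≤ A * |t| ^ (q - 1)) ∧
      (∀ t : ℝ, t₀ ≤ |t| → |f t| ≤ A * |t| ^ ((N : ℝ) * p / ((N : ℝ) - p) - 1)))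
    (u u' : ℝ → ℝ)
    (hu_pos : ∀ r : ℝ, 0 < r → 0 < u r)
    (hu' : ∀ r : ℝ, 0 < r → HasDerivAt u (u' r) r)
    (hS : ∀ r : ℝ, 0 < r →
      HasDerivAt (fun s : ℝ => s ^ ((N : ℝ) - 1) * |u' s| ^ (p - 2) * u' s)
        (-(r ^ ((N : ℝ) - 1) *
          (μ / r ^ p * u r ^ (p - 1) - m * u r ^ (p - 1) + f (u r)))) r)
    (hW1 : IntegrableOn
      (fun r : ℝ => (u r ^ p + |u' r| ^ p) * r ^ ((N : ℝ) - 1)) (Ioo 0 1))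
    (hW2 : Tendsto (fun r : ℝ => u r * r ^ (((N : ℝ) - p) / p)) (𝓝[>] 0) (𝓝 0))
    (γ₁ : ℝ)
    (hγ₁ : 0 ≤ γ₁ ∧ γ₁ < ((N : ℝ) - p) / p ∧
      γ₁ ^ (p - 1) * ((p - 1) * γ₁ - ((N : ℝ) - p)) + μ = 0)
    (w : ℝ → ℝ)
    (hw : ∀ r : ℝ, 0 < r →
      w r = -(r ^ (p - 1) * |u' r| ^ (p - 2) * u' r) / u r ^ (p - 1)) :
    ∃ δ : ℝ, 0 < δ ∧ ∃ C : ℝ, 0 < C ∧ ∃ r₀ : ℝ, 0 < r₀ ∧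
      ∀ r : ℝ, 0 < r → r < r₀ → |w r - γ₁ ^ (p - 1)| ≤ C * r ^ δ := by
  
  obtain ⟨A, hA, q, hq, t₀, ht₀, hF1, hF2⟩ := hF
  obtain ⟨hg0, hgk, hgz⟩ := hγ₁
  generalize (N : ℝ) = n at *
  have hnp : 0 < n - p := by linarith
  have hp0 : 0 < p := by linarith
  set k := (n - p) / p with hk
  have hk0 : 0 < k := by positivity
  set σ := p ^ 2 / (n - p) with hσ
  have hσ0 : 0 < σ := by positivity
  set γ := (γ₁ + k) / 2 with hγ
  have hγ0 : 0 < γ := by positivity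
  have hγk : γ < k := by linarith
  have hγ1 : γ₁ < γ := by linarith
  have hp1' : 0 < p - 1 := by linarith
  let er : ℝ → ℝ := fun r => r ^ p * (-m + f (u r) / u r ^ (p - 1))
  have herr : ∀ r, 0 < r → |er r| ≤ (m + A * t₀ ^ (q - p)) * r ^ p + A * (u r * r ^ k) ^ σ := by
    intro r hr
    have hU := hu_pos r hr
    refine aux_err n p m A q t₀ (f (u r)) (u r) r hp1 hpN hm hA hq ht₀ hU hr ?_ ?_
    · intro h
      have := hF1 (u r) (by rwa [abs_of_pos hU])
      rwa [abs_of_pos hU] at this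
    · intro h
      have := hF2 (u r) (by rwa [abs_of_pos hU])
      rwa [abs_of_pos hU] at this
  have hexp : Tendsto (fun t : ℝ => Real.exp (-t)) atTop (𝓝[>] 0) := by
    refine tendsto_nhdsWithin_iff.2 ⟨Real.tendsto_exp_neg_atTop_nhds_zero, ?_⟩
    exact Eventually.of_forall fun t => Real.exp_pos _
  have hlogle : ∀ T r : ℝ, 0 < r → r ≤ Real.exp (-T) → T ≤ -Real.log r := by
    intro T r hr h
    have := Real.log_le_log hr h
    rw [Real.log_exp] at this; linarith
  have hexplog : ∀ r : ℝ, 0 < r → Real.exp (-(-Real.log r)) = r := by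
    intro r hr; rw [neg_neg, Real.exp_log hr]
  obtain ⟨δ, hδ, C, hC, T, hT⟩ := aux_core (fun t => w (Real.exp (-t))) (fun t => er (Real.exp (-t)))
    (fun x => (p - 1) * |x| ^ (p / (p - 1)) - (n - p) * x + μ) (p - 1) (n - p) μ (p / (p - 1))
    (γ₁ ^ (p - 1)) (k ^ (p - 1)) (γ ^ (p - 1)) hp1' hnp.le hμ0
    (by rw [lt_div_iff₀ hp1']; linarith)
    (Real.rpow_lt_rpow hg0 hγ1 hp1') (Real.rpow_lt_rpow hγ0.le hγk hp1')
    (fun x => rfl)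
    (by
      rw [aux_Hval n p μ γ₁ hp1 hg0, hgz])
    (by
      rw [aux_Hval n p μ k hp1 hk0.le]
      have h1 : n - p = p * k := by rw [hk]; field_simp
      have h2 : k ^ p = k ^ (p - 1) * k := by
        rw [← Real.rpow_add_one hk0.ne']; congr 1; ring
      rw [h1]
      rw [h2] at hμ
      nlinarith)
    (by
      intro t
      have hr := Real.exp_pos (-t)
      have h1 := aux_deriv n p μ m (f (u (Real.exp (-t)))) hp1 u u' w (Real.exp (-t)) hr
        (hu_pos _ hr) (hu' _ hr) (hS _ hr) hw
      have h2 : HasDerivAt (fun t : ℝ => Real.exp (-t)) (Real.exp (-t) * (-1)) t :=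
        (hasDerivAt_neg t).exp
      refine (h1.comp t h2).congr_deriv ?_
      simp only [er]
      field_simp
      ring)
    (by
      have h1 : Tendsto (fun r : ℝ => (m + A * t₀ ^ (q - p)) * r ^ p + A * (u r * r ^ k) ^ σ)
          (𝓝[>] 0) (𝓝 0) := by
        have a1 : Tendsto (fun r : ℝ => r ^ p) (𝓝[>] 0) (𝓝 0) := by
          have := (Real.continuousAt_rpow_const 0 p (Or.inr hp0.le)).tendsto
          rw [Real.zero_rpow hp0.ne'] at this
          exact this.mono_left nhdsWithin_le_nhds
        have a2 : Tendsto (fun r : ℝ => (u r * r ^ k) ^ σ) (𝓝[>] 0) (𝓝 0) := by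
          have := (Real.continuousAt_rpow_const 0 σ (Or.inr hσ0.le)).tendsto.comp hW2
          rwa [Real.zero_rpow hσ0.ne'] at this
        have := (a1.const_mul (m + A * t₀ ^ (q - p))).add (a2.const_mul A)
        simpa using this
      have h2 := h1.comp hexp
      refine squeeze_zero_norm (fun t => ?_) h2
      exact herr _ (Real.exp_pos _))
    (by
      rintro ⟨T, hT⟩
      set R := Real.exp (-T) with hR
      have hR0 : 0 < R := Real.exp_pos _
      have hanti : AntitoneOn (fun r => u r * r ^ k) (Ioc 0 R) := by
        apply antitoneOn_of_deriv_nonpos (convex_Ioc 0 R)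
        · intro r hr
          exact (aux_g u _ k r hr.1 (hu' r hr.1)).continuousAt.continuousWithinAt
        · intro r hr
          have hr' := interior_subset hr
          exact (aux_g u _ k r hr'.1 (hu' r hr'.1)).differentiableAt.differentiableWithinAt
        · intro r hr
          have hr' := interior_subset hr
          rw [(aux_g u _ k r hr'.1 (hu' r hr'.1)).deriv]
          have h1 := hT (-Real.log r) (hlogle T r hr'.1 hr'.2)
          simp only [hexplog r hr'.1] at h1
          rw [hw r hr'.1] at h1
          have h2 := aux_wge p k r (u r) (u' r) hp1 hk0 hr'.1 (hu_pos r hr'.1) h1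
          exact mul_nonpos_of_nonneg_of_nonpos (Real.rpow_nonneg hr'.1.le _) h2
      have hpos : 0 < u R * R ^ k := mul_pos (hu_pos R hR0) (Real.rpow_pos_of_pos hR0 _)
      have hle : u R * R ^ k ≤ 0 := by
        refine ge_of_tendsto hW2 ?_
        filter_upwards [Ioc_mem_nhdsGT hR0] with r hr
        exact hanti hr ⟨hR0, le_rfl⟩ hr.2
      linarith)
    (by
      rintro ⟨T, hT⟩
      set R := Real.exp (-T) with hR
      have hR0 : 0 < R := Real.exp_pos _
      have hmono : MonotoneOn (fun r => u r * r ^ γ) (Ioc 0 R) := by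
        apply monotoneOn_of_deriv_nonneg (convex_Ioc 0 R)
        · intro r hr
          exact (aux_g u _ γ r hr.1 (hu' r hr.1)).continuousAt.continuousWithinAt
        · intro r hr
          have hr' := interior_subset hr
          exact (aux_g u _ γ r hr'.1 (hu' r hr'.1)).differentiableAt.differentiableWithinAt
        · intro r hr
          have hr' := interior_subset hr
          rw [(aux_g u _ γ r hr'.1 (hu' r hr'.1)).deriv]
          have h1 := hT (-Real.log r) (hlogle T r hr'.1 hr'.2)
          simp only [hexplog r hr'.1] at h1
          rw [hw r hr'.1] at h1
          have h2 := aux_wle p γ r (u r) (u' r) hp1 hγ0 hr'.1 (hu_pos r hr'.1) h1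
          exact mul_nonneg (Real.rpow_nonneg hr'.1.le _) h2
      set G := u R * R ^ γ with hG
      have hG0 : 0 < G := mul_pos (hu_pos R hR0) (Real.rpow_pos_of_pos hR0 _)
      have hkγ : 0 < k - γ := by linarith
      set δ := min p ((k - γ) * σ) with hδ
      have hδ0 : 0 < δ := lt_min hp0 (by positivity)
      refine ⟨δ, hδ0, (m + A * t₀ ^ (q - p)) + A * G ^ σ, by positivity, max T 0, ?_⟩
      intro t ht
      have hr0 := Real.exp_pos (-t)
      have hrR : Real.exp (-t) ≤ R :=
        Real.exp_le_exp.2 (by linarith [(le_max_left T 0).trans ht])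
      have hr1 : Real.exp (-t) ≤ 1 :=
        Real.exp_le_one_iff.2 (by linarith [(le_max_right T 0).trans ht])
      have hE : Real.exp (-δ * t) = Real.exp (-t) ^ δ := by
        rw [← Real.exp_mul]; congr 1; ring
      rw [hE]
      generalize Real.exp (-t) = r at *
      refine (herr r hr0).trans ?_
      have b1 : r ^ p ≤ r ^ δ := Real.rpow_le_rpow_of_exponent_ge hr0 hr1 (min_le_left _ _)
      have b2 : r ^ ((k - γ) * σ) ≤ r ^ δ :=
        Real.rpow_le_rpow_of_exponent_ge hr0 hr1 (min_le_right _ _)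
      have b3 : u r * r ^ γ ≤ G := hmono ⟨hr0, hrR⟩ ⟨hR0, le_rfl⟩ hrR
      have b4 : u r * r ^ k ≤ G * r ^ (k - γ) := by
        have : r ^ k = r ^ γ * r ^ (k - γ) := by rw [← Real.rpow_add hr0]; congr 1; ring
        rw [this, ← mul_assoc]
        exact mul_le_mul_of_nonneg_right b3 (Real.rpow_nonneg hr0.le _)
      have hU := hu_pos r hr0
      have b5 : (u r * r ^ k) ^ σ ≤ G ^ σ * r ^ ((k - γ) * σ) := by
        rw [Real.rpow_mul hr0.le, ← Real.mul_rpow hG0.le (Real.rpow_nonneg hr0.le _)]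
        exact Real.rpow_le_rpow (by positivity) b4 hσ0.le
      have b6 : G ^ σ * r ^ ((k - γ) * σ) ≤ G ^ σ * r ^ δ :=
        mul_le_mul_of_nonneg_left b2 (by positivity)
      have b7 : (m + A * t₀ ^ (q - p)) * r ^ p ≤ (m + A * t₀ ^ (q - p)) * r ^ δ :=
        mul_le_mul_of_nonneg_left b1 (by positivity)
      have b8 : A * (u r * r ^ k) ^ σ ≤ A * (G ^ σ * r ^ δ) :=
        mul_le_mul_of_nonneg_left (b5.trans b6) hA.le
      linarith)
  refine ⟨δ, hδ, C, hC, Real.exp (-T), Real.exp_pos _, fun r hr hrT => ?_⟩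
  have h1 := hT (-Real.log r) (hlogle T r hr hrT.le)
  simp only [hexplog r hr] at h1
  refine h1.trans (le_of_eq ?_)
  rw [Real.rpow_def_of_pos hr]
  congr 2; ring
end

section
/- Let N ≥ 2 be an integer and let p, μ, m be real numbers with 1 < p < N, 0 ≤ μ < μ̄ := ((N−p)/p)^p and m > 0. Let f : ℝ → ℝ be continuous and satisfy (F0). Let u : (0,∞) → ℝ be a radial profile solution of the equation (hypothesis (S)) such that u(r) → 0 as r → ∞. Then the function r ↦ u'(r)/u(r) + (m/(p−1))^{1/p} + (N−1)/(p(p−1)·r) is O(r^{−min(p,2)}) as r → ∞. -/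
open Filter Topology Set Asymptotics

/-- barrier -/
theorem trap_s18 (g g' : ℝ → ℝ) (r1 B : ℝ) (hd : ∀ r, r1 ≤ r → HasDerivAt g (g' r) r)
    (h1 : B ≤ g r1) (hb : ∀ r, r1 ≤ r → g r = B → 0 < g' r) : ∀ r, r1 ≤ r → B ≤ g r := by
  intro r hr
  have := image_le_of_deriv_right_lt_deriv_boundary' (f := fun _ => B) (f' := fun _ => 0)
    (a := r1) (b := r) (B := g) (B' := g') continuousOn_const
    (fun x hx => hasDerivWithinAt_const _ _ _) h1
    (fun x hx => (hd x hx.1).continuousAt.continuousWithinAt)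
    (fun x hx => (hd x hx.1).hasDerivWithinAt)
    (fun x hx he => hb x hx.1 he.symm)
  exact this ⟨hr, le_rfl⟩

/-- a positive function that decreases at a definite rate below `B` stays above `B` -/
theorem stay (X X' : ℝ → ℝ) (R B c : ℝ) (hc : 0 < c)
    (hd : ∀ r, R ≤ r → HasDerivAt X (X' r) r) (hpos : ∀ r, R ≤ r → 0 < X r)
    (hb : ∀ r, R ≤ r → X r ≤ B → X' r ≤ -c) : ∀ r, R ≤ r → B < X r := by
  intro r1 hr1
  by_contra! hcon
  have htr : ∀ r, r1 ≤ r → X r ≤ B := by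
    intro r hr
    have := trap_s18 (fun r => - X r) (fun r => - X' r) r1 (-B)
      (fun r h => (hd r (hr1.trans h)).neg) (by simpa using hcon)
      (fun r h he => by
        have := hb r (hr1.trans h) (by simp at he; linarith)
        linarith) r hr
    simpa using this
  have hanti : AntitoneOn (fun r => X r + c * r) (Ici r1) := by
    have hd2 : ∀ r, r1 ≤ r → HasDerivAt (fun r => X r + c * r) (X' r + c * 1) r := fun r hr =>
      (hd r (hr1.trans hr)).add ((hasDerivAt_id r).const_mul c)
    apply antitoneOn_of_deriv_nonpos (convex_Ici r1)
    · exact fun x hx => (hd2 x hx).continuousAt.continuousWithinAt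
    · intro x hx
      rw [interior_Ici] at hx
      exact (hd2 x hx.le).differentiableAt.differentiableWithinAt
    · intro x hx
      rw [interior_Ici] at hx
      rw [(hd2 x hx.le).deriv]
      have := hb x (hr1.trans hx.le) (htr x hx.le)
      linarith
  have h0 := hpos r1 hr1
  have hq : 0 < X r1 / c := by positivity
  have h2 := hanti (mem_Ici.2 le_rfl) (mem_Ici.2 (by linarith : r1 ≤ r1 + X r1 / c)) (by linarith)
  simp only at h2
  have h3 := hpos (r1 + X r1 / c) (by linarith)
  have : c * (r1 + X r1 / c) = c * r1 + X r1 := by field_simp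
  linarith

theorem refine_half (h h' g : ℝ → ℝ) (R l : ℝ) (hl : 0 < l)
    (hd : ∀ r, R ≤ r → HasDerivAt h (h' r) r) (h0 : Tendsto h atTop (𝓝 0))
    (hg0 : ∀ r, R ≤ r → 0 ≤ g r) (hg : ∀ r s, R ≤ r → r ≤ s → g s ≤ g r)
    (hb : ∀ r, R ≤ r → |h' r - l * h r| ≤ l / 2 * |h r| + g r) :
    ∀ r, R ≤ r → h r ≤ 2 / l * g r := by
  intro r1 hr1
  by_contra! hcon
  have hp : 0 < h r1 := lt_of_le_of_lt (mul_nonneg (by positivity) (hg0 r1 hr1)) hcon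
  have := trap_s18 h h' r1 (h r1) (fun r hr => hd r (hr1.trans hr)) le_rfl (fun r hr he => by
    have h1 := (abs_le.1 (hb r (hr1.trans hr))).1
    have h2 := hg r1 r hr1 hr
    rw [he, abs_of_pos hp] at h1
    have : l / 2 * (2 / l * g r1) < l / 2 * h r1 := by
      apply mul_lt_mul_of_pos_left hcon; positivity
    have h4 : l / 2 * (2 / l * g r1) = g r1 := by field_simp
    nlinarith)
  obtain ⟨r, hr, hr2⟩ := ((h0.eventually_lt_const hp).and (eventually_ge_atTop r1)).exists
  linarith [this r hr2]

theorem refine_abs (h h' g : ℝ → ℝ) (R l : ℝ) (hl : 0 < l)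
    (hd : ∀ r, R ≤ r → HasDerivAt h (h' r) r) (h0 : Tendsto h atTop (𝓝 0))
    (hg0 : ∀ r, R ≤ r → 0 ≤ g r) (hg : ∀ r s, R ≤ r → r ≤ s → g s ≤ g r)
    (hb : ∀ r, R ≤ r → |h' r - l * h r| ≤ l / 2 * |h r| + g r) :
    ∀ r, R ≤ r → |h r| ≤ 2 / l * g r := by
  intro r hr
  rw [abs_le]
  have h1 := refine_half h h' g R l hl hd h0 hg0 hg hb r hr
  have h2 := refine_half (fun r => - h r) (fun r => - h' r) g R l hl (fun r hr => (hd r hr).neg)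
    (by simpa using h0.neg) hg0 hg (fun r hr => by
      have := hb r hr
      rw [abs_neg, show -h' r - l * -h r = -(h' r - l * h r) by ring, abs_neg]
      exact this) r hr
  exact ⟨by linarith, h1⟩

theorem taylor2 (p y0 : ℝ) (hy0 : 0 < y0) :
    ∃ C > 0, ∀ᶠ y in 𝓝 y0, |y ^ p - y0 ^ p - p * y0 ^ (p - 1) * (y - y0)| ≤ C * (y - y0) ^ 2 := by
  have hd : HasDerivAt (fun y : ℝ => p * y ^ (p - 1)) (p * ((p - 1) * y0 ^ (p - 1 - 1))) y0 :=
    (Real.hasDerivAt_rpow_const (Or.inl hy0.ne')).const_mul p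
  obtain ⟨C, hC, hO⟩ := hd.isBigO_sub.exists_pos
  refine ⟨C, hC, ?_⟩
  have hE := hO.bound.and (eventually_gt_nhds hy0)
  obtain ⟨δ, hδ, hball⟩ := Metric.eventually_nhds_iff_ball.1 hE
  filter_upwards [Metric.ball_mem_nhds y0 hδ] with y hy
  have hsub : ∀ x ∈ Metric.closedBall y0 |y - y0|, x ∈ Metric.ball y0 δ := by
    intro x hx
    rw [Metric.mem_closedBall] at hx
    rw [Metric.mem_ball, Real.dist_eq] at *
    linarith
  have := Convex.norm_image_sub_le_of_norm_hasDerivWithin_le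
    (f := fun x : ℝ => x ^ p - p * y0 ^ (p - 1) * x)
    (f' := fun x : ℝ => p * x ^ (p - 1) - p * y0 ^ (p - 1) * 1) (C := C * |y - y0|)
    (s := Metric.closedBall y0 |y - y0|) (x := y0) (y := y) ?_ ?_ (convex_closedBall _ _) ?_ ?_
  · simp only [Real.norm_eq_abs] at this
    rw [← sq_abs (y - y0)]
    calc _ = |y ^ p - p * y0 ^ (p - 1) * y - (y0 ^ p - p * y0 ^ (p - 1) * y0)| := by ring_nf
      _ ≤ _ := this
      _ = _ := by ring
  · intro x hx
    have hx2 := (hball x (hsub x hx)).2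
    exact ((Real.hasDerivAt_rpow_const (Or.inl hx2.ne')).sub
      ((hasDerivAt_id x).const_mul _)).hasDerivWithinAt
  · intro x hx
    have hx2 := (hball x (hsub x hx)).1
    rw [mul_one]
    refine hx2.trans ?_
    rw [Metric.mem_closedBall, Real.dist_eq] at hx
    rw [Real.norm_eq_abs]
    exact mul_le_mul_of_nonneg_left hx hC.le
  · simp
  · simp [Real.dist_eq]

theorem y_tendsto (y k : ℝ → ℝ) (p a k0 y0 R : ℝ) (hp : 1 < p) (ha : 0 ≤ a) (hk0 : 0 < k0)
    (hy0 : 0 < y0) (hky : k0 * y0 ^ p = 1) (hR : 0 < R)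
    (hk : Tendsto k atTop (𝓝 k0)) (hpos : ∀ r, R ≤ r → 0 < y r)
    (hd : ∀ r, R ≤ r → HasDerivAt y (k r * y r ^ p + a / r * y r - 1) r) :
    Tendsto y atTop (𝓝 y0) := by
  have hinv : Tendsto (fun r : ℝ => a / r) atTop (𝓝 0) := tendsto_const_nhds.div_atTop tendsto_id
  rw [tendsto_order]
  constructor
  · intro b hb
    rcases le_or_gt b 0 with hb0 | hb0
    · filter_upwards [eventually_ge_atTop R] with r hr
      exact hb0.trans_lt (hpos r hr)
    have hlim : Tendsto (fun r => k r * b ^ p + a / r * b - 1) atTop (𝓝 (k0 * b ^ p + 0 * b - 1)) :=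
      ((hk.mul_const _).add (hinv.mul_const _)).sub_const _
    have hlt : b ^ p < y0 ^ p := Real.rpow_lt_rpow hb0.le hb (by linarith)
    have hneg : k0 * b ^ p + 0 * b - 1 < 0 := by nlinarith
    set L := k0 * b ^ p + 0 * b - 1 with hL
    have hev := (hlim.eventually_lt_const (show L < L / 2 by linarith)).and
      ((hk.eventually_const_lt hk0).and (eventually_ge_atTop R))
    obtain ⟨R1, hR1⟩ := eventually_atTop.1 hev
    filter_upwards [eventually_ge_atTop R1] with r hr
    refine stay y _ R1 b (-(L/2)) (by linarith) (fun r hr => hd r (hR1 r hr).2.2)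
      (fun r hr => hpos r (hR1 r hr).2.2) ?_ r hr
    intro r hr hyb
    obtain ⟨h1, h2, h3⟩ := hR1 r hr
    have hyp := hpos r h3
    have h4 : y r ^ p ≤ b ^ p := Real.rpow_le_rpow hyp.le hyb (by linarith)
    have h5 := mul_le_mul_of_nonneg_left h4 h2.le
    have h6 : a / r * y r ≤ a / r * b :=
      mul_le_mul_of_nonneg_left hyb (div_nonneg ha (hR.le.trans h3))
    linarith
  · intro b hb
    have hb0 : 0 < b := hy0.trans hb
    -- work with v = y^(1-p)
    have hdv : ∀ r, R ≤ r → HasDerivAt (fun r => y r ^ (1 - p))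
        ((p - 1) * (y r ^ (-p) - k r) - (p - 1) * (a / r) * y r ^ (1 - p)) r := by
      intro r hr
      have hyp := hpos r hr
      have := (hd r hr).rpow_const (p := 1 - p) (Or.inl hyp.ne')
      convert this using 1
      have e1 : y r ^ (1 - p - 1) = y r ^ (-p) := by congr 1; ring
      have e2 : y r ^ (1 - p) = y r * y r ^ (-p) := by
        rw [show 1 - p = 1 + (-p) by ring, Real.rpow_add hyp, Real.rpow_one]
      have e3 : y r ^ p * y r ^ (-p) = 1 := by
        rw [← Real.rpow_add hyp]; simp
      rw [e1, e2]
      linear_combination (p - 1) * k r * e3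
    have hlim : Tendsto (fun r => (p - 1) * (b ^ (-p) - k r)) atTop
        (𝓝 ((p - 1) * (b ^ (-p) - k0))) := (tendsto_const_nhds.sub hk).const_mul _
    have hk0e : k0 = y0 ^ (-p) := by
      rw [Real.rpow_neg hy0.le]; exact eq_inv_of_mul_eq_one_left hky
    have hlt : b ^ (-p) < y0 ^ (-p) := Real.rpow_lt_rpow_of_neg hy0 hb (by linarith)
    have hneg : (p - 1) * (b ^ (-p) - k0) < 0 := by nlinarith
    set L := (p - 1) * (b ^ (-p) - k0) with hL
    have hev := (hlim.eventually_lt_const (show L < L / 2 by linarith)).and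
      (eventually_ge_atTop R)
    obtain ⟨R1, hR1⟩ := eventually_atTop.1 hev
    filter_upwards [eventually_ge_atTop R1] with r hr
    have key := stay (fun r => y r ^ (1 - p)) _ R1 (b ^ (1 - p)) (-(L/2)) (by linarith)
      (fun r hr => hdv r (hR1 r hr).2)
      (fun r hr => Real.rpow_pos_of_pos (hpos r (hR1 r hr).2) _) ?_ r hr
    · exact (Real.rpow_lt_rpow_iff_of_neg hb0 (hpos r (hR1 r hr).2) (by linarith)).1 key
    intro r hr hyb
    obtain ⟨h1, h3⟩ := hR1 r hr
    have hyp := hpos r h3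
    have hyb2 : b ≤ y r := (Real.rpow_le_rpow_iff_of_neg hyp hb0 (by linarith)).1 hyb
    have h4 : y r ^ (-p) ≤ b ^ (-p) := Real.rpow_le_rpow_of_nonpos hb0 hyb2 (by linarith)
    have h5 := mul_le_mul_of_nonneg_left h4 (by linarith : 0 ≤ p - 1)
    have h6 : 0 ≤ (p - 1) * (a / r) * y r ^ (1 - p) := by
      have := div_nonneg ha (hR.le.trans h3)
      have : 0 ≤ p - 1 := by linarith
      positivity
    linarith

theorem rpow_O {s t : ℝ} (h : s ≤ t) : (fun r : ℝ => r ^ (-t)) =O[atTop] fun r : ℝ => r ^ (-s) := by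
  apply IsBigO.of_bound 1
  filter_upwards [eventually_ge_atTop 1] with r hr
  rw [Real.norm_of_nonneg (by positivity), Real.norm_of_nonneg (by positivity), one_mul]
  exact Real.rpow_le_rpow_of_exponent_le hr (by linarith)

theorem refine_O (h h' T G : ℝ → ℝ) (l s : ℝ) (hl : 0 < l) (hs : 0 ≤ s)
    (hd : ∀ᶠ r in atTop, HasDerivAt h (h' r) r) (h0 : Tendsto h atTop (𝓝 0))
    (he : ∀ᶠ r in atTop, h' r - l * h r = T r + G r)
    (hT : ∀ᶠ r in atTop, |T r| ≤ l / 2 * |h r|)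
    (hG : G =O[atTop] fun r : ℝ => r ^ (-s)) : h =O[atTop] fun r : ℝ => r ^ (-s) := by
  obtain ⟨C, hC, hGb⟩ := hG.exists_pos
  obtain ⟨R, hR⟩ := eventually_atTop.1
    (hd.and (he.and (hT.and (hGb.bound.and (eventually_gt_atTop 0)))))
  have key := refine_abs h h' (fun r => C * r ^ (-s)) R l hl (fun r hr => (hR r hr).1) h0
    (fun r hr => by have := (hR r hr).2.2.2.2; positivity)
    (fun r t hr ht => by
      have := (hR r hr).2.2.2.2
      exact mul_le_mul_of_nonneg_left (Real.rpow_le_rpow_of_nonpos this ht (by linarith)) hC.le)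
    (fun r hr => by
      obtain ⟨_, h1, h2, h3, h4⟩ := hR r hr
      rw [h1]
      rw [Real.norm_eq_abs, Real.norm_of_nonneg (by positivity)] at h3
      exact (abs_add_le _ _).trans (add_le_add h2 h3))
  apply IsBigO.of_bound (2 / l * C)
  filter_upwards [eventually_ge_atTop R] with r hr
  have h4 := (hR r hr).2.2.2.2
  rw [Real.norm_eq_abs, Real.norm_of_nonneg (by positivity), mul_assoc]
  exact key r hr

theorem y_refine (y k : ℝ → ℝ) (p a k0 y0 : ℝ) (hp : 1 < p) (hk0 : 0 < k0)
    (hy0 : 0 < y0) (hky : k0 * y0 ^ p = 1)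
    (hk : (fun r => k r - k0) =O[atTop] fun r : ℝ => r ^ (-p))
    (hd : ∀ᶠ r in atTop, HasDerivAt y (k r * y r ^ p + a / r * y r - 1) r)
    (hy : Tendsto y atTop (𝓝 y0)) :
    (fun r => -(1 / y r) + 1 / y0 + a / (p * r)) =O[atTop] fun r : ℝ => r ^ (-(min p 2)) := by
  have hp0 : 0 < p := by linarith
  set l := p / y0 with hl
  have hlpos : 0 < l := by positivity
  have hlk : k0 * (p * y0 ^ (p - 1)) = l := by
    rw [Real.rpow_sub_one hy0.ne', hl]
    field_simp
    linear_combination hky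
  obtain ⟨C, hC, hTay⟩ := taylor2 p y0 hy0
  have hTay' := hy.eventually hTay
  have hh0 : Tendsto (fun r => y r - y0) atTop (𝓝 0) := by simpa using hy.sub_const y0
  set T : ℝ → ℝ := fun r => k0 * (y r ^ p - y0 ^ p - p * y0 ^ (p - 1) * (y r - y0)) with hTdef
  have hTb : ∀ᶠ r in atTop, |T r| ≤ k0 * C * (y r - y0) ^ 2 := by
    filter_upwards [hTay'] with r hr
    rw [hTdef]
    simp only
    rw [abs_mul, abs_of_pos hk0, mul_assoc k0 C]
    exact mul_le_mul_of_nonneg_left hr hk0.le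
  have hyO : y =O[atTop] (fun _ => (1:ℝ)) := hy.isBigO_one ℝ
  have hypO : (fun r => y r ^ p) =O[atTop] (fun _ => (1:ℝ)) :=
    (hy.rpow_const (p := p) (Or.inl hy0.ne')).isBigO_one ℝ
  have hkyO : (fun r => (k r - k0) * y r ^ p) =O[atTop] fun r : ℝ => r ^ (-p) := by
    simpa using hk.mul hypO
  have hinvO : ∀ c : ℝ, (fun r : ℝ => c / r) =O[atTop] fun r : ℝ => r ^ (-(1:ℝ)) := by
    intro c
    have : (fun r : ℝ => c / r) = fun r : ℝ => c * r ^ (-(1:ℝ)) := by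
      ext r; rw [Real.rpow_neg_one, div_eq_mul_inv]
    rw [this]
    exact (isBigO_refl _ _).const_mul_left c
  have hinv0 : ∀ c : ℝ, Tendsto (fun r : ℝ => c / r) atTop (𝓝 0) := fun c =>
    tendsto_const_nhds.div_atTop tendsto_id
  have hsq : ∀ g1 g2 : ℝ → ℝ, g1 =O[atTop] (fun r : ℝ => r ^ (-(1:ℝ))) →
      g2 =O[atTop] (fun r : ℝ => r ^ (-(1:ℝ))) →
      (fun r => g1 r * g2 r) =O[atTop] fun r : ℝ => r ^ (-(2:ℝ)) := by
    intro g1 g2 h1 h2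
    refine (h1.mul h2).trans_eventuallyEq ?_
    filter_upwards [eventually_gt_atTop 0] with r hr
    rw [← Real.rpow_add hr]; norm_num
  -- step 1
  have hh1 : (fun r => y r - y0) =O[atTop] fun r : ℝ => r ^ (-(1:ℝ)) := by
    refine refine_O _ (fun r => k r * y r ^ p + a / r * y r - 1) T
      (fun r => (k r - k0) * y r ^ p + a / r * y r) l 1 hlpos (by norm_num) ?_ hh0 ?_ ?_ ?_
    · filter_upwards [hd] with r hr using hr.sub_const y0
    · filter_upwards with r
      rw [hTdef]
      linear_combination (y r - y0) * hlk + hky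
    · have : Tendsto (fun r => k0 * C * |y r - y0|) atTop (𝓝 (k0 * C * |0|)) :=
        hh0.abs.const_mul _
      rw [abs_zero, mul_zero] at this
      filter_upwards [hTb, this.eventually_lt_const (show 0 < l / 2 by positivity)] with r h1 h2
      refine h1.trans ?_
      rw [← sq_abs, sq, ← mul_assoc]
      exact mul_le_mul_of_nonneg_right h2.le (abs_nonneg _)
    · refine (hkyO.trans (rpow_O hp.le)).add ?_
      simpa using (hinvO a).mul hyO
  -- step 2
  set σ := min p 2 with hσ
  have hσp : σ ≤ p := min_le_left _ _
  have hσ2 : σ ≤ 2 := min_le_right _ _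
  have hσ0 : 0 ≤ σ := le_min hp0.le (by norm_num)
  set c := a * y0 ^ 2 / p with hc
  have hlc : l * c = a * y0 := by rw [hl, hc]; field_simp
  have hh2 : (fun r => y r - y0 + c / r) =O[atTop] fun r : ℝ => r ^ (-σ) := by
    refine refine_O _ (fun r => k r * y r ^ p + a / r * y r - 1 + c * (-(r ^ 2)⁻¹)) (fun _ => 0)
      (fun r => T r + (k r - k0) * y r ^ p + a / r * (y r - y0) + (-c) / r * (1 / r)) l σ hlpos hσ0
      ?_ ?_ ?_ ?_ ?_
    · filter_upwards [hd, eventually_gt_atTop 0] with r hr hr0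
      exact (hr.sub_const y0).add ((hasDerivAt_inv hr0.ne').const_mul c)
    · simpa using hh0.add (hinv0 c)
    · filter_upwards [eventually_gt_atTop 0] with r hr0
      rw [hTdef]
      simp only
      have e1 : l * (c / r) = a * y0 / r := by rw [← hlc]; ring
      have e2 : c * (-(r ^ 2)⁻¹) = (-c) / r * (1 / r) := by field_simp
      rw [e2]
      linear_combination (y r - y0) * hlk + hky - e1
    · filter_upwards with r
      simp; positivity
    · refine ((IsBigO.add ?_ ?_).add ?_).add ?_
      · refine IsBigO.trans (IsBigO.of_bound (k0 * C) ?_) ((hsq _ _ hh1 hh1).trans (rpow_O hσ2))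
        filter_upwards [hTb] with r hr
        rw [Real.norm_eq_abs, Real.norm_of_nonneg (mul_self_nonneg _), ← sq]
        exact hr
      · exact hkyO.trans (rpow_O hσp)
      · exact (hsq _ _ (hinvO a) hh1).trans (rpow_O hσ2)
      · exact (hsq _ _ (hinvO (-c)) (hinvO 1)).trans (rpow_O hσ2)
  have hyi : (fun r => 1 / (y r * y0 ^ 2)) =O[atTop] (fun _ => (1:ℝ)) := by
    have : Tendsto (fun r => 1 / (y r * y0 ^ 2)) atTop (𝓝 (1 / (y0 * y0 ^ 2))) :=
      tendsto_const_nhds.div (hy.mul_const _) (by positivity)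
    exact this.isBigO_one ℝ
  have hfin : (fun r => 1 / y0 ^ 2 * (y r - y0 + c / r)
      - (y r - y0) * (y r - y0) * (1 / (y r * y0 ^ 2))) =O[atTop] fun r : ℝ => r ^ (-σ) := by
    refine (hh2.const_mul_left _).sub ?_
    have := ((hsq _ _ hh1 hh1).trans (rpow_O hσ2)).mul hyi
    simpa using this
  refine hfin.congr' ?_ EventuallyEq.rfl
  filter_upwards [eventually_gt_atTop 0, hy.eventually_const_lt hy0] with r hr hyr
  rw [hc]
  field_simp
  ring

theorem stmt_18
    (N : ℕ) (hN : 2 ≤ N) (p μ m : ℝ)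
    (hp1 : 1 < p) (hpN : p < N)
    (hμ0 : 0 ≤ μ) (hμ : μ < (((N : ℝ) - p) / p) ^ p)
    (hm : 0 < m)
    (f : ℝ → ℝ) (hf : Continuous f)
    (hF0 : ∃ A > (0:ℝ), ∃ q > p, ∃ t₀ > (0:ℝ),
      ∀ t : ℝ, |t| ≤ t₀ → |f t| ≤ A * |t| ^ (q - 1))
    (u u' : ℝ → ℝ)
    (hu_pos : ∀ r : ℝ, 0 < r → 0 < u r)
    (hu' : ∀ r : ℝ, 0 < r → HasDerivAt u (u' r) r)
    (hS : ∀ r : ℝ, 0 < r →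
      HasDerivAt (fun s : ℝ => s ^ ((N : ℝ) - 1) * |u' s| ^ (p - 2) * u' s)
        (-(r ^ ((N : ℝ) - 1) *
          (μ / r ^ p * u r ^ (p - 1) - m * u r ^ (p - 1) + f (u r)))) r)
    (hu0 : Tendsto u atTop (𝓝 0)) :
    (fun r : ℝ =>
        u' r / u r + (m / (p - 1)) ^ ((1 : ℝ) / p)
          + ((N : ℝ) - 1) / (p * (p - 1) * r)) =O[atTop]
      fun r : ℝ => r ^ (-(min p 2)) := by
  obtain ⟨A, hA, q, hq, t₀, ht₀, hfA⟩ := hF0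
  have hp0 : 0 < p := by linarith
  have hpp : 0 < p - 1 := by linarith
  set e : ℝ → ℝ := fun r => μ / r ^ p + f (u r) / u r ^ (p - 1) with he
  set W : ℝ → ℝ := fun s : ℝ => s ^ ((N : ℝ) - 1) * |u' s| ^ (p - 2) * u' s with hW
  have hWd : ∀ r, 0 < r → HasDerivAt W (r ^ ((N : ℝ) - 1) * u r ^ (p - 1) * (m - e r)) r := by
    intro r hr
    convert hS r hr using 1
    have : 0 < u r ^ (p - 1) := Real.rpow_pos_of_pos (hu_pos r hr) _
    rw [he]
    field_simp
    ring
  have hfb : ∀ᶠ r in atTop, |f (u r) / u r ^ (p - 1)| ≤ A * u r ^ (q - p) := by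
    filter_upwards [hu0.eventually_le_const ht₀, eventually_gt_atTop 0] with r h1 hr
    have hur := hu_pos r hr
    have h2 := hfA (u r) (by rwa [abs_of_pos hur])
    have h3 : 0 < u r ^ (p - 1) := Real.rpow_pos_of_pos hur _
    rw [abs_div, abs_of_pos h3, div_le_iff₀ h3]
    rw [abs_of_pos hur] at h2
    rw [mul_assoc, ← Real.rpow_add hur]
    rwa [show q - p + (p - 1) = q - 1 by ring]
  have hμr : (fun r : ℝ => μ / r ^ p) =O[atTop] fun r : ℝ => r ^ (-p) := by
    refine ((isBigO_refl (fun r : ℝ => r ^ (-p)) atTop).const_mul_left μ).congr' ?_ EventuallyEq.rfl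
    filter_upwards [eventually_gt_atTop 0] with r hr
    rw [Real.rpow_neg hr.le, div_eq_mul_inv]
  have hfO : (fun r => f (u r) / u r ^ (p - 1)) =O[atTop] fun r => u r ^ (q - p) := by
    apply IsBigO.of_bound A
    filter_upwards [hfb, eventually_gt_atTop 0] with r h1 hr
    have hur := hu_pos r hr
    rw [Real.norm_eq_abs, Real.norm_of_nonneg (by positivity)]
    exact h1
  have he0 : Tendsto e atTop (𝓝 0) := by
    have h1 := hμr.trans_tendsto (tendsto_rpow_neg_atTop hp0)
    have h2 : Tendsto (fun r => u r ^ (q - p)) atTop (𝓝 0) := by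
      have := hu0.rpow_const (p := q - p) (Or.inr (by linarith))
      rwa [Real.zero_rpow (by linarith)] at this
    simpa using h1.add (hfO.trans_tendsto h2)
  -- negativity of the derivative
  obtain ⟨R0, hR0⟩ := eventually_atTop.1 ((he0.eventually_lt_const hm).and (eventually_gt_atTop 0))
  have hWmono : StrictMonoOn W (Ici R0) := by
    apply strictMonoOn_of_deriv_pos (convex_Ici _)
    · exact fun x hx => (hWd x (hR0 x hx).2).continuousAt.continuousWithinAt
    · intro x hx
      rw [interior_Ici] at hx
      obtain ⟨h1, h2⟩ := hR0 x (le_of_lt hx)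
      rw [(hWd x h2).deriv]
      have := hu_pos x h2
      have : 0 < m - e x := by linarith
      positivity
  have hneg : ∀ r, R0 ≤ r → u' r < 0 := by
    intro r1 hr1
    by_contra! hcon
    have hW1 : 0 ≤ W r1 := by
      have := (hR0 r1 hr1).2
      rw [hW]; positivity
    have hup : ∀ r, r1 < r → 0 < u' r := by
      intro r hr
      have h1 := hWmono hr1 (hr1.trans hr.le) hr
      have h2 : 0 < W r := by linarith
      have := (hR0 r (hr1.trans hr.le)).2
      have h3 : 0 ≤ r ^ ((N : ℝ) - 1) * |u' r| ^ (p - 2) := by positivity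
      exact pos_of_mul_pos_right h2 h3
    have hmono : StrictMonoOn u (Ici r1) := by
      apply strictMonoOn_of_deriv_pos (convex_Ici _)
      · exact fun x hx => (hu' x (hR0 x (hr1.trans hx)).2).continuousAt.continuousWithinAt
      · intro x hx
        rw [interior_Ici] at hx
        rw [(hu' x (hR0 x (hr1.trans (le_of_lt hx))).2).deriv]
        exact hup x hx
    have hu1 := hu_pos r1 (hR0 r1 hr1).2
    obtain ⟨r, h1, h2⟩ := ((hu0.eventually_lt_const hu1).and (eventually_gt_atTop r1)).exists
    have := hmono (mem_Ici.2 le_rfl) (mem_Ici.2 h2.le) h2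
    linarith
  -- the function y
  set v : ℝ → ℝ := fun r => -W r / (r ^ ((N : ℝ) - 1) * u r ^ (p - 1)) with hv
  set y : ℝ → ℝ := fun r => v r ^ (-(1 / (p - 1))) with hy
  have hvz : ∀ r, R0 ≤ r → v r = (-u' r / u r) ^ (p - 1) := by
    intro r hr
    have hr0 := (hR0 r hr).2
    have hur := hu_pos r hr0
    have hn : 0 < -u' r := by linarith [hneg r hr]
    rw [hv]
    simp only
    rw [Real.div_rpow hn.le hur.le, hW]
    simp only
    rw [abs_of_neg (hneg r hr)]
    have h1 : (-u' r) ^ (p - 1) = (-u' r) ^ (p - 2) * (-u' r) := by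
      rw [show p - 1 = (p - 2) + 1 by ring, Real.rpow_add hn, Real.rpow_one]
    have h2 : 0 < r ^ ((N : ℝ) - 1) := Real.rpow_pos_of_pos hr0 _
    have h3 : 0 < u r ^ (p - 1) := Real.rpow_pos_of_pos hur _
    rw [h1]
    field_simp
  have hzpos : ∀ r, R0 ≤ r → 0 < -u' r / u r := fun r hr =>
    div_pos (by linarith [hneg r hr]) (hu_pos r (hR0 r hr).2)
  have hyz : ∀ r, R0 ≤ r → y r = u r / (-u' r) := by
    intro r hr
    rw [hy]
    simp only
    rw [hvz r hr, ← Real.rpow_mul (hzpos r hr).le,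
      show (p - 1) * -(1 / (p - 1)) = -1 by field_simp, Real.rpow_neg_one, inv_div]
  have hypos : ∀ r, R0 ≤ r → 0 < y r := by
    intro r hr
    rw [hyz r hr]
    exact div_pos (hu_pos r (hR0 r hr).2) (by linarith [hneg r hr])
  have hvpos : ∀ r, R0 ≤ r → 0 < v r := by
    intro r hr
    rw [hvz r hr]
    exact Real.rpow_pos_of_pos (hzpos r hr) _
  have hvd : ∀ r, R0 ≤ r →
      HasDerivAt v (-(m - e r) - (N - 1) / r * v r + (p - 1) * v r / y r) r := by
    intro r hr
    have hr0 := (hR0 r hr).2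
    have hur := hu_pos r hr0
    have h1 : HasDerivAt (fun r : ℝ => r ^ ((N : ℝ) - 1)) (((N : ℝ) - 1) * r ^ ((N : ℝ) - 1 - 1)) r :=
      Real.hasDerivAt_rpow_const (Or.inl hr0.ne')
    have h2 := (hu' r hr0).rpow_const (p := p - 1) (Or.inl hur.ne')
    have h3 : 0 < r ^ ((N : ℝ) - 1) := Real.rpow_pos_of_pos hr0 _
    have h4 : 0 < u r ^ (p - 1) := Real.rpow_pos_of_pos hur _
    have h5 := (hWd r hr0).neg.div (h1.mul h2) (mul_pos h3 h4).ne'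
    refine HasDerivAt.congr_deriv (f := v) h5 ?_
    symm
    have hn := hneg r hr
    have hvW : W r = - v r * (r ^ ((N : ℝ) - 1) * u r ^ (p - 1)) := by
      rw [hv]; field_simp
    rw [hyz r hr, Real.rpow_sub_one hr0.ne' ((N : ℝ) - 1), Real.rpow_sub_one hur.ne' (p - 1)]
    simp only [Pi.mul_apply, Pi.neg_apply]
    rw [hvW]
    generalize v r = V
    generalize e r = E
    clear h5 hvW h1 h2
    generalize r ^ ((N : ℝ) - 1) = P at h3 ⊢
    generalize u r ^ (p - 1) = Q at h4 ⊢
    field_simp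
    ring
  set a : ℝ := (N - 1) / (p - 1) with ha
  set k : ℝ → ℝ := fun r => (m - e r) / (p - 1) with hk
  have hyd : ∀ r, R0 ≤ r → HasDerivAt y (k r * y r ^ p + a / r * y r - 1) r := by
    intro r hr
    have hr0 := (hR0 r hr).2
    have hV := hvpos r hr
    have hY := hypos r hr
    have h1 := (hvd r hr).rpow_const (p := -(1 / (p - 1))) (Or.inl hV.ne')
    convert h1 using 1
    rw [Real.rpow_sub_one hV.ne']
    have h2 : v r ^ (-(1 / (p - 1))) = y r := rfl
    have h3 : y r ^ p = y r / v r := by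
      rw [← h2, ← Real.rpow_sub_one hV.ne', ← Real.rpow_mul hV.le]
      congr 1
      field_simp
      ring
    rw [h2, h3, hk, ha]
    simp only
    field_simp
    ring
  set k0 : ℝ := m / (p - 1) with hk0
  have hk0pos : 0 < k0 := by positivity
  set z0 : ℝ := k0 ^ ((1 : ℝ) / p) with hz0
  have hz0pos : 0 < z0 := by positivity
  have hky : k0 * (1 / z0) ^ p = 1 := by
    rw [Real.div_rpow zero_le_one hz0pos.le, hz0, ← Real.rpow_mul hk0pos.le,
      one_div_mul_cancel hp0.ne', Real.rpow_one, Real.one_rpow]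
    field_simp
  have hN1 : (2:ℝ) ≤ N := by exact_mod_cast hN
  have hkl : Tendsto k atTop (𝓝 k0) := by
    have : Tendsto k atTop (𝓝 ((m - 0) / (p - 1))) := (he0.const_sub m).div_const _
    simpa using this
  have hylim : Tendsto y atTop (𝓝 (1 / z0)) :=
    y_tendsto y k p a k0 (1 / z0) R0 hp1 (div_nonneg (by linarith) hpp.le) hk0pos (by positivity)
      hky (hR0 R0 le_rfl).2 hkl hypos hyd
  -- exponential decay of u
  have hexp : (fun r => u r ^ (q - p)) =O[atTop] fun r : ℝ => r ^ (-p) := by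
    have hev : ∀ᶠ r in atTop, y r < 2 / z0 ∧ R0 ≤ r :=
      (hylim.eventually_lt_const (by gcongr; norm_num)).and (eventually_ge_atTop R0)
    obtain ⟨R1, hR1⟩ := eventually_atTop.1 hev
    have hanti : AntitoneOn (fun r => u r * Real.exp (z0 / 2 * r)) (Ici R1) := by
      have hd2 : ∀ r, R1 ≤ r → HasDerivAt (fun r => u r * Real.exp (z0 / 2 * r))
          (u' r * Real.exp (z0 / 2 * r) + u r * (Real.exp (z0 / 2 * r) * (z0 / 2 * 1))) r :=
        fun r hr => (hu' r (hR0 r (hR1 r hr).2).2).mul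
          (((hasDerivAt_id r).const_mul (z0 / 2)).exp)
      apply antitoneOn_of_deriv_nonpos (convex_Ici R1)
      · exact fun x hx => (hd2 x hx).continuousAt.continuousWithinAt
      · intro x hx
        rw [interior_Ici] at hx
        exact (hd2 x (le_of_lt hx)).differentiableAt.differentiableWithinAt
      · intro x hx
        rw [interior_Ici] at hx
        have hx' : R1 ≤ x := le_of_lt hx
        rw [(hd2 x hx').deriv]
        obtain ⟨h1, h2⟩ := hR1 x hx'
        have hn : 0 < -u' x := by linarith [hneg x h2]
        rw [hyz x h2, div_lt_div_iff₀ hn hz0pos] at h1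
        have := Real.exp_pos (z0 / 2 * x)
        nlinarith
    set K := u R1 * Real.exp (z0 / 2 * R1) with hK
    have hR1p := (hR0 R1 (hR1 R1 le_rfl).2).2
    have hKp : 0 < K := mul_pos (hu_pos R1 hR1p) (Real.exp_pos _)
    have hqp : 0 < q - p := by linarith
    have hO : (fun r => u r ^ (q - p)) =O[atTop]
        fun r : ℝ => Real.exp (-(z0 / 2 * (q - p)) * r) := by
      apply IsBigO.of_bound (K ^ (q - p))
      filter_upwards [eventually_ge_atTop R1] with r hr
      have hur := hu_pos r (hR0 r (hR1 r hr).2).2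
      have h1 : u r * Real.exp (z0 / 2 * r) ≤ K := hanti (mem_Ici.2 le_rfl) (mem_Ici.2 hr) hr
      have h2 : u r ≤ K * Real.exp (-(z0 / 2 * r)) := by
        rw [Real.exp_neg, ← div_eq_mul_inv, le_div_iff₀ (Real.exp_pos _)]
        exact h1
      rw [Real.norm_of_nonneg (by positivity), Real.norm_of_nonneg (by positivity)]
      calc u r ^ (q - p) ≤ (K * Real.exp (-(z0 / 2 * r))) ^ (q - p) :=
            Real.rpow_le_rpow hur.le h2 hqp.le
        _ = _ := by
            rw [Real.mul_rpow hKp.le (Real.exp_pos _).le, ← Real.exp_mul]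
            congr 2
            ring
    exact hO.trans (isLittleO_exp_neg_mul_rpow_atTop (by positivity) _).isBigO
  have hkO : (fun r => k r - k0) =O[atTop] fun r : ℝ => r ^ (-p) := by
    refine ((hμr.add (hfO.trans hexp)).const_mul_left (-(1 / (p - 1)))).congr_left ?_
    intro r
    rw [hk, hk0, he]
    ring
  have hfin := y_refine y k p a k0 (1 / z0) hp1 hk0pos (by positivity) hky hkO
    (by filter_upwards [eventually_ge_atTop R0] with r hr using hyd r hr) hylim
  refine hfin.congr' ?_ EventuallyEq.rfl
  filter_upwards [eventually_ge_atTop R0] with r hr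
  have hr0 := (hR0 r hr).2
  rw [hyz r hr, ha, one_div_one_div, one_div_div]
  have h1 : -(-u' r / u r) = u' r / u r := by ring
  rw [h1]
  congr 1
  field_simp
end
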